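/- arXiv:1607.00979 — 2 statements merged into one kernel-verified Lean document; each statement's English description precedes it below -/
import Mathlib

section
/- Let d ≥ 1, 1 ≤ e ≤ d and α ∈ (−∞,−1]^e × (−1,∞)^{d−e}. Define, for measurable f ≥ 0, 𝕂_{*,1}^α f(x) = sup_{0<s<1} ∫_{(0,∞)^d} χ_{{x_i/2 ≤ y_i ≤ 2x_i for i=1,…,e}} 𝕂_s^α(x,y) f(y) dν_α(y). Then there is a constant C such that ν_α{x ∈ (0,∞)^d : 𝕂_{*,1}^α f(x) > λ} ≤ (C/λ) ∫_{(0,∞)^d} f dν_α for every λ > 0 and every 0 ≤ f ∈ L¹(dν_α). -/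
open MeasureTheory

/-- The measure `ν_α` on `(0,∞)^d` with density `(∏ x_i^{2α_i+1}) e^{−|x|²}`
with respect to Lebesgue measure. -/
noncomputable def nu (d : ℕ) (α : Fin d → ℝ) : Measure (Fin d → ℝ) :=
  ((volume : Measure (Fin d → ℝ)).withDensity fun x =>
    ENNReal.ofReal ((∏ i, x i ^ (2 * α i + 1)) * Real.exp (-∑ i, x i ^ 2))).restrict
    {x | ∀ i, 0 < x i}

/-- The kernel
`K_s^α(x,y) = s^{−d/2} (∏ (x_i + √s)^{−2α_i−1}) exp(|x|² − |(1+s)x − (1−s)y|²/(8s))`. -/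
noncomputable def Kker (d : ℕ) (α : Fin d → ℝ) (s : ℝ) (x y : Fin d → ℝ) : ℝ :=
  s ^ (-(d : ℝ) / 2) * (∏ i, (x i + Real.sqrt s) ^ (-(2 * α i + 1))) *
    Real.exp ((∑ i, x i ^ 2) - (∑ i, ((1 + s) * x i - (1 - s) * y i) ^ 2) / (8 * s))

/-- The kernel `𝕂_s^α(x,y) = (1−s)^{−2⟨α′⟩} (∏_{i<e} (x_i y_i)^{−2α_i})
K_s^{−α′}(x′,y′) K_s^{α″}(x″,y″)`, where `z′ = (z_1,…,z_e)`, `z″ = (z_{e+1},…,z_d)`. -/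
noncomputable def KK (d e : ℕ) (hed : e ≤ d) (α : Fin d → ℝ) (s : ℝ)
    (x y : Fin d → ℝ) : ℝ :=
  (1 - s) ^ (-2 * ∑ i : Fin e, α (Fin.castLE hed i)) *
    (∏ i : Fin e, (x (Fin.castLE hed i) * y (Fin.castLE hed i)) ^
      (-2 * α (Fin.castLE hed i))) *
    Kker e (fun i => -α (Fin.castLE hed i)) s
      (fun i => x (Fin.castLE hed i)) (fun i => y (Fin.castLE hed i)) *
    Kker (d - e) (fun i => α ⟨e + (i : ℕ), by have h := i.isLt; omega⟩) s
      (fun i => x ⟨e + (i : ℕ), by have h := i.isLt; omega⟩)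
      (fun i => y ⟨e + (i : ℕ), by have h := i.isLt; omega⟩)


section helpers
open scoped ENNReal NNReal

/-- one-dimensional weight -/
noncomputable def w1 (b u : ℝ) : ℝ≥0∞ := if 0 < u then ENNReal.ofReal (u ^ b) else 0

noncomputable def wW {d : ℕ} (a : Fin d → ℝ) (x : Fin d → ℝ) : ℝ≥0∞ := ∏ i, w1 (a i) (x i)

noncomputable def vV {d : ℕ} (a : Fin d → ℝ) (x : Fin d → ℝ) (τ : ℝ) : ℝ :=
  ∏ i, (τ * (x i + τ) ^ (a i))

noncomputable def qQ {d : ℕ} (x : Fin d → ℝ) : ℝ := ∑ i, x i ^ 2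

noncomputable def nN {d : ℕ} (a : Fin d → ℝ) : ℝ := d + ∑ i, |a i|

lemma measurable_w1 (b : ℝ) : Measurable (w1 b) := by
  unfold w1
  exact Measurable.ite measurableSet_Ioi (by fun_prop) measurable_const

lemma measurable_wW {d : ℕ} (a : Fin d → ℝ) : Measurable (wW a) := by
  unfold wW
  exact Finset.measurable_prod _ fun i _ => (measurable_w1 _).comp (measurable_pi_apply i)

lemma measurable_qQ {d : ℕ} : Measurable (qQ (d := d)) := by
  unfold qQ; fun_prop

lemma measurable_vV {d : ℕ} (a : Fin d → ℝ) (τ : ℝ) : Measurable (fun x => vV a x τ) := by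
  unfold vV; fun_prop

lemma nN_nonneg {d : ℕ} (a : Fin d → ℝ) : 0 ≤ nN a := by unfold nN; positivity

lemma wW_zero {d : ℕ} (a x : Fin d → ℝ) (h : ¬ ∀ i, 0 < x i) : wW a x = 0 := by
  push Not at h
  obtain ⟨i, hi⟩ := h
  exact Finset.prod_eq_zero (Finset.mem_univ i) (by simp [w1, not_lt.mpr hi])

lemma vV_pos {d : ℕ} (a x : Fin d → ℝ) (τ : ℝ) (hx : ∀ i, 0 ≤ x i) (hτ : 0 < τ) :
    0 < vV a x τ := by
  unfold vV
  refine Finset.prod_pos fun i _ => mul_pos hτ (Real.rpow_pos_of_pos ?_ _)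
  have := hx i; linarith

lemma rpow_cmp (p q R b : ℝ) (hp : 0 < p) (hq : 0 < q) (hR : 1 ≤ R) (h1 : p ≤ R * q)
    (h2 : q ≤ R * p) : p ^ b ≤ R ^ |b| * q ^ b := by
  have hR0 : 0 < R := by linarith
  rcases le_total 0 b with hb | hb
  · rw [abs_of_nonneg hb, ← Real.mul_rpow hR0.le hq.le]
    exact Real.rpow_le_rpow hp.le h1 hb
  · rw [abs_of_nonpos hb]
    have : (R * p) ^ b ≤ q ^ b := Real.rpow_le_rpow_of_nonpos hq h2 hb
    rw [Real.mul_rpow hR0.le hp.le] at this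
    calc p ^ b = R ^ (-b) * (R ^ b * p ^ b) := by
          rw [← mul_assoc, ← Real.rpow_add hR0]; simp
      _ ≤ _ := by gcongr

lemma vV_cmp {d : ℕ} (a x x' : Fin d → ℝ) (τ τ' R : ℝ) (hx : ∀ i, 0 ≤ x i) (hx' : ∀ i, 0 ≤ x' i)
    (hτ : 0 < τ) (hτ' : 0 < τ') (hR : 1 ≤ R) (h1 : τ ≤ R * τ')
    (h3 : ∀ i, x i + τ ≤ R * (x' i + τ')) (h4 : ∀ i, x' i + τ' ≤ R * (x i + τ)) :
    vV a x τ ≤ R ^ nN a * vV a x' τ' := by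
  have hR0 : 0 < R := by linarith
  have e : R ^ nN a = ∏ i, (R * R ^ |a i|) := by
    rw [Finset.prod_mul_distrib, ← Real.rpow_sum_of_pos hR0]
    simp [nN, Real.rpow_add hR0]
  rw [e]; unfold vV
  rw [← Finset.prod_mul_distrib]
  refine Finset.prod_le_prod (fun i _ => ?_) (fun i _ => ?_)
  · have := hx i; positivity
  · have p1 : 0 < x i + τ := by have := hx i; linarith
    have p2 : 0 < x' i + τ' := by have := hx' i; linarith
    have := rpow_cmp _ _ R (a i) p1 p2 hR (h3 i) (h4 i)
    calc τ * (x i + τ) ^ a i ≤ (R * τ') * (R ^ |a i| * (x' i + τ') ^ a i) := by gcongr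
      _ = _ := by ring

/-- inverse version -/
lemma vV_inv_cmp {d : ℕ} (a x x' : Fin d → ℝ) (τ τ' R : ℝ) (hx : ∀ i, 0 ≤ x i)
    (hx' : ∀ i, 0 ≤ x' i)
    (hτ : 0 < τ) (hτ' : 0 < τ') (hR : 1 ≤ R) (h1 : τ ≤ R * τ')
    (h3 : ∀ i, x i + τ ≤ R * (x' i + τ')) (h4 : ∀ i, x' i + τ' ≤ R * (x i + τ)) :
    (vV a x' τ')⁻¹ ≤ R ^ nN a * (vV a x τ)⁻¹ := by
  have h := vV_cmp a x x' τ τ' R hx hx' hτ hτ' hR h1 h3 h4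
  have p := vV_pos a x τ hx hτ
  have p' := vV_pos a x' τ' hx' hτ'
  rw [inv_le_iff_one_le_mul₀ p', mul_assoc, mul_comm, mul_assoc,
    mul_comm (vV a x' τ')]
  rw [← div_eq_inv_mul, le_div_iff₀ p]
  linarith

/-- product lintegral -/
lemma lint_prod {d : ℕ} (f : Fin d → ℝ → ℝ≥0∞) (hf : ∀ i, Measurable (f i)) :
    ∫⁻ x : Fin d → ℝ, ∏ i, f i (x i) = ∏ i, ∫⁻ u, f i u := by
  induction d with
  | zero => simp [volume_pi, Measure.pi_of_empty]
  | succ n ih =>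
    have := (volume_preserving_piFinSuccAbove (fun _ : Fin (n+1) => ℝ) 0).symm
    rw [← this.lintegral_comp_emb (MeasurableEquiv.measurableEmbedding _)]
    rw [Fin.prod_univ_succ, ← ih _ (fun i => hf _)]
    simp only [MeasurableEquiv.piFinSuccAbove_symm_apply, Fin.insertNthEquiv_zero,
      Fin.consEquiv_symm_apply, Fin.prod_univ_succ]
    simp only [Fin.consEquiv, Equiv.coe_fn_mk, Fin.cons_zero, Fin.cons_succ]
    rw [Measure.volume_eq_prod]
    exact lintegral_prod_mul (hf 0).aemeasurable
      (Finset.measurable_prod _ fun i _ => (hf _).comp (measurable_pi_apply i)).aemeasurable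

lemma pow_exp_bound (K c : ℝ) (hc : 0 < c) :
    ∃ C : ℝ, 0 < C ∧ ∀ p : ℝ, 1 ≤ p → p ^ K * Real.exp (-(c * p ^ 2)) ≤ C := by
  obtain ⟨n, hn⟩ := exists_nat_ge K
  refine ⟨n.factorial / c ^ n, by positivity, fun p hp => ?_⟩
  have h1 : p ^ K ≤ (p ^ 2) ^ n := by
    calc p ^ K ≤ p ^ (n : ℝ) := Real.rpow_le_rpow_of_exponent_le hp hn
      _ = p ^ n := Real.rpow_natCast _ _
      _ ≤ (p ^ 2) ^ n := by gcongr; nlinarith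
  have h2 := Real.pow_div_factorial_le_exp (x := c * p ^ 2) (by positivity) n
  rw [div_le_iff₀ (by positivity), mul_pow] at h2
  rw [Real.exp_neg, ← div_eq_mul_inv, div_le_div_iff₀ (Real.exp_pos _) (by positivity)]
  nlinarith [pow_pos hc n]

end helpers


section helpers
open scoped ENNReal NNReal

lemma lint_smul {d : ℕ} (f : (Fin d → ℝ) → ℝ≥0∞) (hf : Measurable f) (r : ℝ) (hr : 0 < r) :
    ∫⁻ x, f (r • x) = ENNReal.ofReal (r ^ (-(d : ℝ))) * ∫⁻ x, f x := by
  have h := Measure.map_addHaar_smul (volume : Measure (Fin d → ℝ)) hr.ne'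
  rw [← lintegral_map (f := f) (g := fun x => r • x) hf (by fun_prop), h, lintegral_smul_measure]
  simp only [Module.finrank_fintype_fun_eq_card, Fintype.card_fin, smul_eq_mul]
  rw [abs_of_pos (by positivity), Real.rpow_neg hr.le, Real.rpow_natCast]

lemma lint_smul1 (f : ℝ → ℝ≥0∞) (hf : Measurable f) (r : ℝ) (hr : 0 < r) :
    ∫⁻ x, f (r * x) = ENNReal.ofReal r⁻¹ * ∫⁻ x, f x := by
  have h := Measure.map_addHaar_smul (volume : Measure ℝ) hr.ne'
  rw [← lintegral_map (f := f) (g := fun x => r * x) hf (by fun_prop)]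
  simp only [smul_eq_mul] at h
  rw [h, lintegral_smul_measure]
  simp only [Module.finrank_self, pow_one, smul_eq_mul]
  rw [abs_of_pos (by positivity)]

lemma gauss1_fin (c : ℝ) (hc : 0 < c) : ∫⁻ v : ℝ, ENNReal.ofReal (Real.exp (-c * v ^ 2)) < ∞ :=
  (integrable_exp_neg_mul_sq hc).lintegral_lt_top

lemma pow1_fin (b : ℝ) (hb : -1 < b) :
    ∫⁻ v : ℝ, (Set.Ioo (0:ℝ) 1).indicator (fun v => ENNReal.ofReal (v ^ b)) v < ∞ := by
  rw [lintegral_indicator measurableSet_Ioo]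
  exact Integrable.lintegral_lt_top
    ((intervalIntegral.integrableOn_Ioo_rpow_iff zero_lt_one).2 hb)

lemma one_dim (b c : ℝ) (hb : -1 < b) (hc : 0 < c) :
    ∃ C : ℝ≥0∞, C < ∞ ∧ ∀ z τ : ℝ, 0 < τ →
      ∫⁻ u, w1 b u * ENNReal.ofReal ((τ * (u + τ) ^ b)⁻¹ * Real.exp (-c * (τ⁻¹ * (u - z)) ^ 2)) ≤ C := by
  set A := ∫⁻ v : ℝ, ENNReal.ofReal (Real.exp (-c * v ^ 2)) with hA
  set B := ∫⁻ v : ℝ, (Set.Ioo (0:ℝ) 1).indicator (fun v => ENNReal.ofReal (v ^ b)) v with hB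
  have hA' := gauss1_fin c hc
  have hB' := pow1_fin b hb
  refine ⟨ENNReal.ofReal (2 ^ |b|) * (A + B), ENNReal.mul_lt_top (by simp)
    (ENNReal.add_lt_top.2 ⟨hA', hB'⟩), fun z τ hτ => ?_⟩
  set h1 : ℝ → ℝ≥0∞ := fun v => ENNReal.ofReal (Real.exp (-c * v ^ 2)) with hh1
  set h2 : ℝ → ℝ≥0∞ := (Set.Ioo (0:ℝ) 1).indicator (fun v => ENNReal.ofReal (v ^ b)) with hh2
  have m1 : Measurable h1 := by fun_prop
  have m2 : Measurable h2 := Measurable.indicator (by fun_prop) measurableSet_Ioo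
  have key : ∀ u, w1 b u * ENNReal.ofReal ((τ * (u + τ) ^ b)⁻¹ * Real.exp (-c * (τ⁻¹ * (u - z)) ^ 2))
      ≤ ENNReal.ofReal (2 ^ |b|) * (ENNReal.ofReal τ⁻¹ * (h1 (τ⁻¹ * (u - z)) + h2 (τ⁻¹ * u))) := by
    intro u
    unfold w1
    split_ifs with hu
    swap
    · simp
    have hs : 0 < u + τ := by linarith
    have h2b : (1:ℝ) ≤ 2 ^ |b| := Real.one_le_rpow (by norm_num) (abs_nonneg b)
    set E := Real.exp (-c * (τ⁻¹ * (u - z)) ^ 2) with hE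
    have hE0 : 0 < E := Real.exp_pos _
    have hE1 : E ≤ 1 := Real.exp_le_one_iff.2 (by nlinarith [sq_nonneg (τ⁻¹ * (u - z))])
    rw [← ENNReal.ofReal_mul (by positivity)]
    by_cases hut : τ ≤ u
    · have : u ^ b ≤ 2 ^ |b| * (u + τ) ^ b := rpow_cmp _ _ 2 b hu hs (by norm_num) (by linarith) (by linarith)
      calc ENNReal.ofReal (u ^ b * ((τ * (u + τ) ^ b)⁻¹ * E))
          ≤ ENNReal.ofReal (2 ^ |b| * (τ⁻¹ * E)) := by
            apply ENNReal.ofReal_le_ofReal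
            have hp : 0 < (u + τ) ^ b := Real.rpow_pos_of_pos hs _
            calc u ^ b * ((τ * (u + τ) ^ b)⁻¹ * E) ≤ (2 ^ |b| * (u + τ) ^ b) * ((τ * (u + τ) ^ b)⁻¹ * E) := by gcongr
              _ = _ := by field_simp
        _ = ENNReal.ofReal (2 ^ |b|) * (ENNReal.ofReal τ⁻¹ * h1 (τ⁻¹ * (u - z))) := by
            rw [ENNReal.ofReal_mul (by positivity), ENNReal.ofReal_mul (by positivity)]
        _ ≤ _ := by gcongr; exact le_self_add
    · push Not at hut
      have : τ ^ b ≤ 2 ^ |b| * (u + τ) ^ b := rpow_cmp _ _ 2 b hτ hs (by norm_num) (by linarith) (by linarith)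
      have hmem : τ⁻¹ * u ∈ Set.Ioo (0:ℝ) 1 := ⟨by positivity, by
        rw [inv_mul_lt_iff₀ hτ]; linarith⟩
      have e2 : h2 (τ⁻¹ * u) = ENNReal.ofReal ((τ⁻¹ * u) ^ b) := by simp only [hh2]; rw [Set.indicator_of_mem hmem]
      calc ENNReal.ofReal (u ^ b * ((τ * (u + τ) ^ b)⁻¹ * E))
          ≤ ENNReal.ofReal (2 ^ |b| * (τ⁻¹ * (τ⁻¹ * u) ^ b)) := by
            apply ENNReal.ofReal_le_ofReal
            have hp : 0 < (u + τ) ^ b := Real.rpow_pos_of_pos hs _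
            have hq : 0 < τ ^ b := Real.rpow_pos_of_pos hτ _
            rw [Real.mul_rpow (by positivity) hu.le, Real.inv_rpow hτ.le]
            have hub : 0 < u ^ b := Real.rpow_pos_of_pos hu _
            calc u ^ b * ((τ * (u + τ) ^ b)⁻¹ * E) ≤ u ^ b * ((τ * (u + τ) ^ b)⁻¹ * 1) := by gcongr
              _ = u ^ b * τ⁻¹ * ((u + τ) ^ b)⁻¹ := by rw [mul_inv]; ring
              _ ≤ u ^ b * τ⁻¹ * (2 ^ |b| * (τ ^ b)⁻¹) := by
                gcongr
                rw [inv_le_iff_one_le_mul₀ hp, mul_assoc, mul_comm, mul_assoc, ← div_eq_inv_mul, le_div_iff₀ hq]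
                linarith
              _ = _ := by ring
        _ = ENNReal.ofReal (2 ^ |b|) * (ENNReal.ofReal τ⁻¹ * h2 (τ⁻¹ * u)) := by
            rw [ENNReal.ofReal_mul (by positivity), ENNReal.ofReal_mul (by positivity), e2]
        _ ≤ _ := by gcongr; exact le_add_self
  refine (lintegral_mono key).trans ?_
  have m1' : Measurable fun u => h1 (τ⁻¹ * (u - z)) := m1.comp (by fun_prop)
  have m2' : Measurable fun u => h2 (τ⁻¹ * u) := m2.comp (by fun_prop)
  rw [lintegral_const_mul _ (by fun_prop), lintegral_const_mul _ (by fun_prop), lintegral_add_left m1']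
  gcongr
  rw [lintegral_sub_right_eq_self (fun u => h1 (τ⁻¹ * u)) z, lint_smul1 _ m1 _ (by positivity),
    lint_smul1 _ m2 _ (by positivity), ← mul_add, ← mul_assoc, ← ENNReal.ofReal_mul (by positivity)]
  rw [inv_inv, inv_mul_cancel₀ hτ.ne']; simp [hA, hB, hh1, hh2]

lemma sum_sq_le_norm {d : ℕ} (x : Fin d → ℝ) : ∑ i, x i ^ 2 ≤ d * ‖x‖ ^ 2 := by
  calc ∑ i, x i ^ 2 ≤ ∑ i : Fin d, ‖x‖ ^ 2 := by
        refine Finset.sum_le_sum fun i _ => ?_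
        rw [← sq_abs]
        exact pow_le_pow_left₀ (abs_nonneg _) (norm_le_pi_norm x i) 2
    _ = _ := by simp

lemma norm_sq_le_sum {d : ℕ} (x : Fin d → ℝ) : ‖x‖ ^ 2 ≤ ∑ i, x i ^ 2 := by
  have h0 : 0 ≤ ∑ i, x i ^ 2 := Finset.sum_nonneg fun i _ => sq_nonneg _
  have : ‖x‖ ≤ Real.sqrt (∑ i, x i ^ 2) := by
    rw [pi_norm_le_iff_of_nonneg (Real.sqrt_nonneg _)]
    intro i
    apply Real.le_sqrt_of_sq_le
    rw [Real.norm_eq_abs, sq_abs]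
    exact Finset.single_le_sum (f := fun i => x i ^ 2) (fun i _ => sq_nonneg _) (Finset.mem_univ i)
  calc ‖x‖ ^ 2 ≤ Real.sqrt (∑ i, x i ^ 2) ^ 2 := by gcongr
    _ = _ := Real.sq_sqrt h0

lemma multi_dim {d : ℕ} (a : Fin d → ℝ) (ha : ∀ i, -1 < a i) (c : ℝ) (hc : 0 < c) :
    ∃ C : ℝ≥0∞, C < ∞ ∧ ∀ (z : Fin d → ℝ) (τ : ℝ), 0 < τ →
      ∫⁻ x, wW a x * ENNReal.ofReal ((vV a x τ)⁻¹ * Real.exp (-(c * ‖x - z‖ ^ 2 / τ ^ 2))) ≤ C := by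
  have hc' : 0 < c / (d + 1) := by positivity
  choose C hC hCb using fun i => one_dim (a i) (c / (d + 1)) (ha i) hc'
  refine ⟨∏ i, C i, ENNReal.prod_lt_top fun i _ => hC i, fun z τ hτ => ?_⟩
  calc _ ≤ ∫⁻ x : Fin d → ℝ, ∏ i, (w1 (a i) (x i) * ENNReal.ofReal ((τ * (x i + τ) ^ a i)⁻¹ *
          Real.exp (-(c / (d + 1)) * (τ⁻¹ * (x i - z i)) ^ 2))) := by
        refine lintegral_mono fun x => ?_
        by_cases hx : ∀ i, 0 < x i
        swap
        · simp [wW_zero a x hx]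
        rw [Finset.prod_mul_distrib, ← ENNReal.ofReal_prod_of_nonneg]
        swap
        · intro i _; have := hx i; positivity
        refine mul_le_mul' le_rfl (ENNReal.ofReal_le_ofReal ?_)
        rw [Finset.prod_mul_distrib, Finset.prod_inv_distrib, ← Real.exp_sum]
        have hv : 0 < vV a x τ := vV_pos a x τ (fun i => (hx i).le) hτ
        change (vV a x τ)⁻¹ * _ ≤ (vV a x τ)⁻¹ * _
        gcongr
        rw [← Finset.mul_sum, neg_mul, neg_le_neg_iff]
        simp_rw [mul_pow]
        rw [← Finset.mul_sum]
        have h := sum_sq_le_norm (x - z)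
        simp only [Pi.sub_apply] at h
        have h2 : ∑ i, (x i - z i) ^ 2 ≤ (d + 1) * ‖x - z‖ ^ 2 := by nlinarith [sq_nonneg ‖x - z‖]
        calc c / (d + 1) * (τ⁻¹ ^ 2 * ∑ i, (x i - z i) ^ 2) ≤ c / (d + 1) * (τ⁻¹ ^ 2 * ((d + 1) * ‖x - z‖ ^ 2)) := by gcongr
          _ = _ := by field_simp
    _ = ∏ i, ∫⁻ u, (w1 (a i) u * ENNReal.ofReal ((τ * (u + τ) ^ a i)⁻¹ *
          Real.exp (-(c / (d + 1)) * (τ⁻¹ * (u - z i)) ^ 2))) :=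
        lint_prod (fun i u => (w1 (a i) u * ENNReal.ofReal ((τ * (u + τ) ^ a i)⁻¹ *
          Real.exp (-(c / (d + 1)) * (τ⁻¹ * (u - z i)) ^ 2)))) fun i => (measurable_w1 _).mul (by fun_prop)
    _ ≤ _ := Finset.prod_le_prod' fun i _ => hCb i _ _ hτ

lemma gauss_fin {d : ℕ} (a : Fin d → ℝ) (ha : ∀ i, -1 < a i) :
    ∫⁻ x, ENNReal.ofReal (Real.exp (-(qQ x / 2))) * wW a x < ∞ := by
  have e : ∀ x : Fin d → ℝ, ENNReal.ofReal (Real.exp (-(qQ x / 2))) * wW a x =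
      ∏ i, (ENNReal.ofReal (Real.exp (-(1/2) * x i ^ 2)) * w1 (a i) (x i)) := by
    intro x
    rw [Finset.prod_mul_distrib, ← ENNReal.ofReal_prod_of_nonneg (fun i _ => (Real.exp_pos _).le),
      ← Real.exp_sum, ← Finset.mul_sum]
    unfold wW qQ
    congr 4; ring
  simp_rw [e]
  rw [lint_prod (fun i u => ENNReal.ofReal (Real.exp (-(1/2) * u ^ 2)) * w1 (a i) u)
    fun i => Measurable.mul (by fun_prop) (measurable_w1 _)]
  refine ENNReal.prod_lt_top fun i _ => ?_
  have h := (integrableOn_rpow_mul_exp_neg_mul_sq (b := 1/2) (by norm_num) (ha i)).lintegral_lt_top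
  rw [← lintegral_indicator measurableSet_Ioi] at h
  convert h using 2
  ext u
  unfold w1
  by_cases hu : 0 < u
  · rw [Set.indicator_of_mem (by exact hu), if_pos hu, ← ENNReal.ofReal_mul (Real.exp_pos _).le, mul_comm]
  · rw [Set.indicator_of_notMem (by exact hu), if_neg hu, mul_zero]

end helpers


section helpers
open scoped ENNReal NNReal

noncomputable def sS {d : ℕ} (c τ : ℝ) (x y : Fin d → ℝ) : ℝ≥0∞ :=
  ⨆ u : ℝ≥0, ENNReal.ofReal (Real.exp (-(c * ‖x - (u : ℝ) • y‖ ^ 2 / τ ^ 2)))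

lemma measurable_sS {d : ℕ} (c τ : ℝ) :
    Measurable (fun p : (Fin d → ℝ) × (Fin d → ℝ) => sS c τ p.1 p.2) := by
  apply LowerSemicontinuous.measurable
  unfold sS
  apply lowerSemicontinuous_iSup
  intro u
  apply Continuous.lowerSemicontinuous
  exact ENNReal.continuous_ofReal.comp (by fun_prop)

lemma sS_le_one {d : ℕ} (c τ : ℝ) (hc : 0 ≤ c) (x y : Fin d → ℝ) : sS c τ x y ≤ 1 := by
  refine iSup_le fun u => ?_
  rw [← ENNReal.ofReal_one]
  apply ENNReal.ofReal_le_ofReal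
  rw [Real.exp_le_one_iff, neg_nonpos]
  positivity

lemma sS_bound {d : ℕ} (c τ M : ℝ) (hc : 0 < c) (hτ : 0 < τ) (x y : Fin d → ℝ) (hx : ‖x‖ ≤ M) :
    sS c τ x y ≤ ENNReal.ofReal (Real.exp (c / 4)) * ∑ j ∈ Finset.range (⌊M / τ⌋₊ + 1),
      ENNReal.ofReal (Real.exp (-(c / 8 * ‖x - ((j : ℝ) * τ) • (‖y‖⁻¹ • y)‖ ^ 2 / τ ^ 2))) := by
  have hM : 0 ≤ M := (norm_nonneg x).trans hx
  refine iSup_le fun u => ?_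
  set η := ‖y‖⁻¹ • y with hη
  have hη1 : ‖η‖ ≤ 1 := by
    rw [hη, norm_smul, norm_inv, norm_norm]
    exact inv_mul_le_one
  set p := min (u * ‖y‖) M with hp
  have hp0 : 0 ≤ p := le_min (by positivity) hM
  have huy : (u : ℝ) • y = ((u : ℝ) * ‖y‖) • η := by
    rw [hη, smul_smul]
    by_cases hy : y = 0
    · simp [hy]
    · rw [mul_assoc, mul_inv_cancel₀ (norm_ne_zero_iff.2 hy), mul_one]
  have h1 : ‖x - p • η‖ ≤ 2 * ‖x - (u : ℝ) • y‖ := by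
    rcases le_total (u * ‖y‖) M with h | h
    · rw [hp, min_eq_left h, ← huy]; linarith [norm_nonneg (x - (u : ℝ) • y)]
    · rw [hp, min_eq_right h]
      have e : x - M • η = (x - (u : ℝ) • y) + ((u : ℝ) * ‖y‖ - M) • η := by
        rw [huy, sub_smul]; abel
      have n1 : ‖((u : ℝ) * ‖y‖ - M) • η‖ ≤ (u : ℝ) * ‖y‖ - M := by
        rw [norm_smul, Real.norm_eq_abs, abs_of_nonneg (by linarith)]
        nlinarith
      have n2 : ‖(u : ℝ) • y‖ ≤ ‖x‖ + ‖x - (u : ℝ) • y‖ := norm_le_insert x _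
      rw [norm_smul, Real.norm_eq_abs, abs_of_nonneg u.coe_nonneg] at n2
      have n2' : (u : ℝ) * ‖y‖ ≤ ‖x‖ + ‖x - (u : ℝ) • y‖ := n2
      rw [e]
      have := norm_add_le (x - (u : ℝ) • y) (((u : ℝ) * ‖y‖ - M) • η)
      linarith
  set j := ⌊p / τ⌋₊ with hj
  have hj1 : (j : ℝ) * τ ≤ p := by
    rw [← le_div_iff₀ hτ]; exact Nat.floor_le (by positivity)
  have hj2 : p ≤ (j : ℝ) * τ + τ := by
    have := (Nat.lt_floor_add_one (p / τ)).le
    rw [div_le_iff₀ hτ] at this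
    rw [← hj] at this; linarith
  have hjm : j ∈ Finset.range (⌊M / τ⌋₊ + 1) := by
    rw [Finset.mem_range, Nat.lt_succ_iff]
    apply Nat.floor_le_floor
    gcongr; exact min_le_right _ _
  have h2 : ‖x - ((j : ℝ) * τ) • η‖ ≤ 2 * ‖x - (u : ℝ) • y‖ + τ := by
    have e : x - ((j : ℝ) * τ) • η = (x - p • η) + (p - (j : ℝ) * τ) • η := by
      rw [sub_smul]; abel
    have n1 : ‖(p - (j : ℝ) * τ) • η‖ ≤ τ := by
      rw [norm_smul, Real.norm_eq_abs, abs_of_nonneg (by linarith)]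
      nlinarith [norm_nonneg η]
    rw [e]
    have := norm_add_le (x - p • η) ((p - (j : ℝ) * τ) • η)
    linarith
  have h3 : ‖x - ((j : ℝ) * τ) • η‖ ^ 2 ≤ 8 * ‖x - (u : ℝ) • y‖ ^ 2 + 2 * τ ^ 2 := by
    have := pow_le_pow_left₀ (norm_nonneg _) h2 2
    nlinarith [sq_nonneg (2 * ‖x - (u : ℝ) • y‖ - τ)]
  calc ENNReal.ofReal (Real.exp (-(c * ‖x - (u : ℝ) • y‖ ^ 2 / τ ^ 2)))
      ≤ ENNReal.ofReal (Real.exp (c / 4) * Real.exp (-(c / 8 * ‖x - ((j : ℝ) * τ) • η‖ ^ 2 / τ ^ 2))) := by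
        apply ENNReal.ofReal_le_ofReal
        rw [← Real.exp_add]
        apply Real.exp_le_exp.2
        have : c / 8 * ‖x - ((j : ℝ) * τ) • η‖ ^ 2 / τ ^ 2 ≤ c / 8 * (8 * ‖x - (u : ℝ) • y‖ ^ 2 + 2 * τ ^ 2) / τ ^ 2 := by
          gcongr
        have e : c / 8 * (8 * ‖x - (u : ℝ) • y‖ ^ 2 + 2 * τ ^ 2) / τ ^ 2 = c * ‖x - (u : ℝ) • y‖ ^ 2 / τ ^ 2 + c / 4 := by
          field_simp; ring
        linarith
    _ = ENNReal.ofReal (Real.exp (c / 4)) * ENNReal.ofReal (Real.exp (-(c / 8 * ‖x - ((j : ℝ) * τ) • η‖ ^ 2 / τ ^ 2))) :=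
        ENNReal.ofReal_mul (Real.exp_pos _).le
    _ ≤ _ := by
        gcongr
        exact Finset.single_le_sum (f := fun j : ℕ => ENNReal.ofReal (Real.exp (-(c / 8 * ‖x - ((j : ℝ) * τ) • η‖ ^ 2 / τ ^ 2)))) (fun _ _ => zero_le) hjm

lemma ray_int {d : ℕ} (a : Fin d → ℝ) (ha : ∀ i, -1 < a i) (c : ℝ) (hc : 0 < c) :
    ∃ C : ℝ≥0∞, C < ∞ ∧ ∀ (y : Fin d → ℝ) (τ M : ℝ), 0 < τ → 0 ≤ M →
      ∫⁻ x in {x | ‖x‖ ≤ M}, wW a x * ENNReal.ofReal (vV a x τ)⁻¹ * sS c τ x y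
        ≤ C * ENNReal.ofReal (M / τ + 1) := by
  obtain ⟨C, hC, hCb⟩ := multi_dim a ha (c / 8) (by positivity)
  refine ⟨ENNReal.ofReal (Real.exp (c / 4)) * C, ENNReal.mul_lt_top (by simp) hC,
    fun y τ M hτ hM => ?_⟩
  have hms : MeasurableSet {x : Fin d → ℝ | ‖x‖ ≤ M} := measurableSet_le (by fun_prop) measurable_const
  have mv := measurable_vV a τ
  have mw := measurable_wW a
  calc _ ≤ ∫⁻ x in {x | ‖x‖ ≤ M}, ENNReal.ofReal (Real.exp (c / 4)) *
        ∑ j ∈ Finset.range (⌊M / τ⌋₊ + 1), wW a x * ENNReal.ofReal ((vV a x τ)⁻¹ *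
        (Real.exp (-(c / 8 * ‖x - ((j : ℝ) * τ) • (‖y‖⁻¹ • y)‖ ^ 2 / τ ^ 2)))) := by
        refine setLIntegral_mono' hms fun x hx => ?_
        by_cases hx0 : ∀ i, 0 < x i
        swap
        · simp [wW_zero a x hx0]
        have hv : 0 < vV a x τ := vV_pos a x τ (fun i => (hx0 i).le) hτ
        calc _ ≤ wW a x * ENNReal.ofReal (vV a x τ)⁻¹ * (ENNReal.ofReal (Real.exp (c / 4)) * ∑ j ∈ Finset.range (⌊M / τ⌋₊ + 1),
              ENNReal.ofReal (Real.exp (-(c / 8 * ‖x - ((j : ℝ) * τ) • (‖y‖⁻¹ • y)‖ ^ 2 / τ ^ 2)))) := by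
              gcongr; exact sS_bound c τ M hc hτ x y hx
          _ = _ := by
              rw [mul_left_comm, Finset.mul_sum]
              simp_rw [ENNReal.ofReal_mul (inv_nonneg.2 hv.le), mul_assoc]
    _ ≤ ∫⁻ x, ENNReal.ofReal (Real.exp (c / 4)) *
        ∑ j ∈ Finset.range (⌊M / τ⌋₊ + 1), wW a x * ENNReal.ofReal ((vV a x τ)⁻¹ *
        (Real.exp (-(c / 8 * ‖x - ((j : ℝ) * τ) • (‖y‖⁻¹ • y)‖ ^ 2 / τ ^ 2)))) := setLIntegral_le_lintegral _ _
    _ ≤ ENNReal.ofReal (Real.exp (c / 4)) * ∑ j ∈ Finset.range (⌊M / τ⌋₊ + 1), C := by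
        rw [lintegral_const_mul _ (by fun_prop), lintegral_finsetSum _ (by fun_prop)]
        gcongr with j hj
        exact hCb _ _ hτ
    _ ≤ _ := by
        rw [Finset.sum_const, Finset.card_range, nsmul_eq_mul, mul_assoc, mul_comm C]
        gcongr
        rw [← ENNReal.ofReal_natCast]
        apply ENNReal.ofReal_le_ofReal
        push_cast
        gcongr
        exact Nat.floor_le (by positivity)

lemma wW_smul {d : ℕ} (a x : Fin d → ℝ) (t : ℝ) (ht : 0 < t) :
    wW a (t • x) = ENNReal.ofReal (t ^ (∑ i, a i)) * wW a x := by
  unfold wW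
  rw [Real.rpow_sum_of_pos ht, ENNReal.ofReal_prod_of_nonneg (fun i _ => by positivity),
    ← Finset.prod_mul_distrib]
  refine Finset.prod_congr rfl fun i _ => ?_
  unfold w1
  simp only [Pi.smul_apply, smul_eq_mul, mul_pos_iff_of_pos_left ht]
  split_ifs with h
  · rw [Real.mul_rpow ht.le h.le, ENNReal.ofReal_mul (by positivity)]
  · simp

lemma qQ_smul {d : ℕ} (x : Fin d → ℝ) (t : ℝ) : qQ (t • x) = t ^ 2 * qQ x := by
  simp [qQ, mul_pow, Finset.mul_sum]

lemma log_int (q l : ℝ) (hq : 0 < q) (hl : 0 < l) :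
    ENNReal.ofReal (Real.log 2) ≤ ∫⁻ t in Set.Ioi (0:ℝ), ENNReal.ofReal t⁻¹ *
      {t : ℝ | l ≤ q / t ^ 2 ∧ q / t ^ 2 ≤ 4 * l}.indicator 1 t := by
  set A := Real.sqrt (q / l) with hA
  have hA0 : 0 < A := Real.sqrt_pos.2 (by positivity)
  have hA2 : A ^ 2 = q / l := Real.sq_sqrt (by positivity)
  have h : ∫ t in (A/2)..A, t⁻¹ = Real.log 2 := by
    rw [integral_inv_of_pos (by positivity) hA0]
    congr 1; field_simp
  rw [intervalIntegral.integral_of_le (by linarith)] at h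
  rw [← h, ofReal_integral_eq_lintegral_ofReal]
  · calc _ = ∫⁻ t in Set.Ioc (A/2) A, ENNReal.ofReal t⁻¹ *
      {t : ℝ | l ≤ q / t ^ 2 ∧ q / t ^ 2 ≤ 4 * l}.indicator 1 t := by
          refine setLIntegral_congr_fun measurableSet_Ioc fun t ht => ?_
          have ht0 : 0 < t := by linarith [ht.1]
          have hm : t ∈ {t : ℝ | l ≤ q / t ^ 2 ∧ q / t ^ 2 ≤ 4 * l} := by
            have e : q = A ^ 2 * l := by rw [hA2]; field_simp
            constructor
            · rw [le_div_iff₀ (by positivity), e]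
              have : t ^ 2 ≤ A ^ 2 := pow_le_pow_left₀ ht0.le ht.2 2
              nlinarith
            · rw [div_le_iff₀ (by positivity), e]
              have : (A / 2) ^ 2 ≤ t ^ 2 := pow_le_pow_left₀ (by positivity) ht.1.le 2
              nlinarith
          rw [Set.indicator_of_mem hm]; simp
      _ ≤ _ := lintegral_mono_set fun t ht => by
          have := ht.1
          exact lt_trans (by positivity) this
  · have := (intervalIntegral.intervalIntegrable_inv (μ := volume) (a := A/2) (b := A) (f := fun t => t)
      (fun x hx => by
        rw [Set.uIcc_of_le (by linarith)] at hx
        have := hx.1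
        have : 0 < x := lt_of_lt_of_le (by positivity) this
        exact this.ne') (by fun_prop))
    rwa [intervalIntegrable_iff_integrableOn_Ioc_of_le (by linarith)] at this
  · refine (ae_restrict_iff' measurableSet_Ioc).2 (Filter.Eventually.of_forall fun t ht => ?_)
    have := ht.1
    have : 0 < t := lt_trans (by positivity) this
    simp; positivity

lemma dil_fubini {d : ℕ} (hd : 1 ≤ d) (a : Fin d → ℝ) (F : (Fin d → ℝ) → ℝ≥0∞) (hF : Measurable F)
    (l : ℝ) (hl : 0 < l) :
    ENNReal.ofReal (Real.log 2) * ∫⁻ x, F x * wW a x ≤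
      ∫⁻ x in {x | l ≤ qQ x ∧ qQ x ≤ 4 * l},
        (∫⁻ t in Set.Ioi (0:ℝ), F (t • x) * ENNReal.ofReal (t ^ ((d:ℝ) + ∑ i, a i - 1))) * wW a x := by
  have mw := measurable_wW a
  have mq := measurable_qQ (d := d)
  set S : Set (Fin d → ℝ) := {x | l ≤ qQ x ∧ qQ x ≤ 4 * l} with hS
  have mS : MeasurableSet S := (measurableSet_le measurable_const mq).inter (measurableSet_le mq measurable_const)
  have mI : Measurable (S.indicator (1 : (Fin d → ℝ) → ℝ≥0∞)) := measurable_one.indicator mS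
  set A := ∑ i, a i with hA
  rw [← ge_iff_le]
  have mF' : Measurable (fun p : (Fin d → ℝ) × ℝ => F (p.2 • p.1)) := hF.comp (by fun_prop)
  calc ∫⁻ x in S, (∫⁻ t in Set.Ioi (0:ℝ), F (t • x) * ENNReal.ofReal (t ^ ((d:ℝ) + A - 1))) * wW a x
      = ∫⁻ x, ∫⁻ t in Set.Ioi (0:ℝ), S.indicator 1 x * (F (t • x) * ENNReal.ofReal (t ^ ((d:ℝ) + A - 1)) * wW a x) := by
        rw [← lintegral_indicator mS]
        refine lintegral_congr fun x => ?_
        have m1 : Measurable (fun t : ℝ => F (t • x)) := hF.comp (by fun_prop)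
        rw [lintegral_const_mul _ (by fun_prop), lintegral_mul_const _ (by fun_prop)]
        by_cases hx : x ∈ S <;> simp [hx]
    _ = ∫⁻ t in Set.Ioi (0:ℝ), ∫⁻ x, S.indicator 1 x * (F (t • x) * ENNReal.ofReal (t ^ ((d:ℝ) + A - 1)) * wW a x) := by
        rw [lintegral_lintegral_swap]
        apply Measurable.aemeasurable
        change Measurable (fun p : (Fin d → ℝ) × ℝ => S.indicator 1 p.1 * (F (p.2 • p.1) * ENNReal.ofReal (p.2 ^ ((d:ℝ) + A - 1)) * wW a p.1))
        fun_prop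
    _ = ∫⁻ t in Set.Ioi (0:ℝ), ∫⁻ x, ENNReal.ofReal t⁻¹ * (S.indicator 1 (t⁻¹ • x) * (F x * wW a x)) := by
        refine setLIntegral_congr_fun measurableSet_Ioi fun t ht => ?_
        have ht : 0 < t := ht
        have m1 : Measurable fun x => S.indicator (1 : (Fin d → ℝ) → ℝ≥0∞) (t⁻¹ • x) := mI.comp (by fun_prop)
        have h := lint_smul (fun x => S.indicator 1 (t⁻¹ • x) * (F x * wW a x)) (by fun_prop) t ht
        rw [lintegral_const_mul _ (by fun_prop)]
        have e : ∫⁻ x, S.indicator 1 (t⁻¹ • x) * (F x * wW a x) = ENNReal.ofReal (t ^ (d:ℝ)) * ∫⁻ x, S.indicator 1 (t⁻¹ • t • x) * (F (t • x) * wW a (t • x)) := by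
          rw [h, ← mul_assoc, ← ENNReal.ofReal_mul (by positivity), ← Real.rpow_add ht]; simp
        rw [e, ← mul_assoc, ← ENNReal.ofReal_mul (by positivity)]
        have m2 : Measurable fun x => F (t • x) := hF.comp (by fun_prop)
        have m3 : Measurable fun x => wW a (t • x) := mw.comp (by fun_prop)
        have m4 : Measurable fun x => S.indicator (1 : (Fin d → ℝ) → ℝ≥0∞) (t⁻¹ • t • x) := mI.comp (by fun_prop)
        rw [← lintegral_const_mul _ (by fun_prop)]
        refine lintegral_congr fun x => ?_
        rw [inv_smul_smul₀ ht.ne', wW_smul a x t ht]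
        have e3 : ENNReal.ofReal (t ^ ((d:ℝ) + A - 1)) = ENNReal.ofReal (t⁻¹ * t ^ (d:ℝ)) * ENNReal.ofReal (t ^ A) := by
          rw [← ENNReal.ofReal_mul (by positivity)]
          congr 1
          rw [Real.rpow_sub ht, Real.rpow_add ht, Real.rpow_one]; field_simp
        rw [e3]; ring
    _ = ∫⁻ x, ∫⁻ t in Set.Ioi (0:ℝ), ENNReal.ofReal t⁻¹ * (S.indicator 1 (t⁻¹ • x) * (F x * wW a x)) := by
        rw [lintegral_lintegral_swap]
        apply Measurable.aemeasurable
        have m1 : Measurable fun p : ℝ × (Fin d → ℝ) => S.indicator (1 : (Fin d → ℝ) → ℝ≥0∞) (p.1⁻¹ • p.2) := mI.comp (by fun_prop)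
        change Measurable fun p : ℝ × (Fin d → ℝ) => ENNReal.ofReal p.1⁻¹ * (S.indicator 1 (p.1⁻¹ • p.2) * (F p.2 * wW a p.2))
        fun_prop
    _ ≥ ∫⁻ x, ENNReal.ofReal (Real.log 2) * (F x * wW a x) := by
        refine lintegral_mono fun x => ?_
        by_cases hx : ∀ i, 0 < x i
        swap
        · simp [wW_zero a x hx]
        have hq : 0 < qQ x := by
          refine Finset.sum_pos (fun i _ => pow_pos (hx i) 2) ⟨⟨0, by omega⟩, Finset.mem_univ _⟩
        have m1 : Measurable fun t : ℝ => S.indicator (1 : (Fin d → ℝ) → ℝ≥0∞) (t⁻¹ • x) := mI.comp (by fun_prop)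
        simp_rw [← mul_assoc (ENNReal.ofReal _) (S.indicator _ _)]
        rw [lintegral_mul_const _ (by fun_prop)]
        gcongr
        refine (log_int (qQ x) l hq hl).trans (le_of_eq ?_)
        refine lintegral_congr fun t => ?_
        congr 1
        have e : qQ (t⁻¹ • x) = qQ x / t ^ 2 := by rw [qQ_smul]; ring
        simp only [Set.indicator, hS, Set.mem_ofPred_eq, e, Pi.one_apply]
    _ = _ := by
        rw [lintegral_const_mul _ (by fun_prop)]

end helpers


section helpers
open scoped ENNReal NNReal

lemma pow2_sum (R : ℝ) (hR : 1 ≤ R) :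
    ∑' k : ℕ, (if (2:ℝ) ^ k ≤ R then ENNReal.ofReal ((2:ℝ) ^ k) else 0) ≤ ENNReal.ofReal (2 * R) := by
  obtain ⟨n, hn1, hn2⟩ := exists_nat_pow_near hR (one_lt_two)
  rw [tsum_eq_sum (s := Finset.range (n + 1))]
  · calc _ ≤ ∑ k ∈ Finset.range (n + 1), ENNReal.ofReal ((2:ℝ) ^ k) := by
          refine Finset.sum_le_sum fun k _ => ?_
          split_ifs <;> simp
      _ = ENNReal.ofReal (∑ k ∈ Finset.range (n + 1), (2:ℝ) ^ k) :=
          (ENNReal.ofReal_sum_of_nonneg fun k _ => by positivity).symm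
      _ ≤ _ := by
          apply ENNReal.ofReal_le_ofReal
          rw [geom_sum_eq (by norm_num)]
          rw [pow_succ]; linarith
  · intro k hk
    rw [if_neg]
    rw [Finset.mem_range, not_lt] at hk
    rw [not_le]
    exact hn2.trans_le (pow_le_pow_right₀ (by norm_num) hk)

lemma exp_int (q t0 : ℝ) (hq : 0 < q) (h0 : 0 ≤ t0) :
    ∫⁻ t in Set.Ioi t0, ENNReal.ofReal (t * Real.exp (-(t ^ 2 * q))) =
      ENNReal.ofReal (Real.exp (-(t0 ^ 2 * q)) / (2 * q)) := by
  have hd : ∀ t ∈ Set.Ici t0, HasDerivAt (fun t : ℝ => -(Real.exp (-(t ^ 2 * q)) / (2 * q)))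
      (t * Real.exp (-(t ^ 2 * q))) t := by
    intro t _
    have h := (((((hasDerivAt_pow 2 t).mul_const q).fun_neg).exp).div_const (2 * q)).fun_neg
    refine h.congr_deriv ?_
    field_simp
    push_cast; ring
  have hlim : Filter.Tendsto (fun t : ℝ => -(Real.exp (-(t ^ 2 * q)) / (2 * q))) Filter.atTop (nhds 0) := by
    have h1 : Filter.Tendsto (fun t : ℝ => t ^ 2 * q) Filter.atTop Filter.atTop :=
      (Filter.tendsto_pow_atTop (by norm_num)).atTop_mul_const hq
    have h2 := Real.tendsto_exp_neg_atTop_nhds_zero.comp h1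
    simpa using (h2.div_const (2 * q)).neg
  have hpos : ∀ t ∈ Set.Ioi t0, 0 ≤ t * Real.exp (-(t ^ 2 * q)) := fun t ht => by
    have : 0 < t := lt_of_le_of_lt h0 ht
    positivity
  have hint := integrableOn_Ioi_deriv_of_nonneg' hd hpos hlim
  have hval := integral_Ioi_of_hasDerivAt_of_nonneg' hd hpos hlim
  rw [← ofReal_integral_eq_lintegral_ofReal hint
    ((ae_restrict_iff' measurableSet_Ioi).2 (Filter.Eventually.of_forall hpos)), hval]
  congr 1; ring

lemma ray_lemma (q l D : ℝ) (hl : 0 < l) (h1 : l ≤ q) (h2 : q ≤ 4 * l) (Φ : ℝ≥0∞) (G : ℝ → ℝ≥0∞)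
    (hG : ∀ t, 0 < t → G t ≠ 0 → l / 4 ≤ t ^ 2 * q ∧ t ^ 2 * q ≤ 4 * l ∧
      1 < ENNReal.ofReal (Real.exp (t ^ 2 * q)) * Φ)
    (hG2 : ∀ t, 0 < t → G t ≤ ENNReal.ofReal (Real.exp (-(t ^ 2 * q)))) :
    ∫⁻ t in Set.Ioi (0:ℝ), G t * ENNReal.ofReal (t ^ (D - 1)) ≤
      ENNReal.ofReal (4 ^ |D - 2| / (2 * l)) * Φ := by
  have hq : 0 < q := by linarith
  by_cases hΦ : Φ = ∞
  · rw [hΦ, ENNReal.mul_top (by simp; positivity)]; exact le_top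
  set φ := Φ.toReal with hφ
  have hΦφ : Φ = ENNReal.ofReal φ := (ENNReal.ofReal_toReal hΦ).symm
  have hc : ∀ t, 0 < t → G t ≠ 0 → Real.exp (-(t ^ 2 * q)) < φ := by
    intro t ht hGt
    obtain ⟨-, -, h⟩ := hG t ht hGt
    rw [hΦφ, ← ENNReal.ofReal_mul (Real.exp_pos _).le, ← ENNReal.ofReal_one,
      ENNReal.ofReal_lt_ofReal_iff_of_nonneg zero_le_one] at h
    rw [Real.exp_neg, inv_lt_iff_one_lt_mul₀ (Real.exp_pos _)]
    linarith
  by_cases hφ0 : φ ≤ 0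
  · have : ∫⁻ t in Set.Ioi (0:ℝ), G t * ENNReal.ofReal (t ^ (D - 1)) = 0 := by
      rw [setLIntegral_congr_fun (g := fun _ => 0) measurableSet_Ioi]
      · simp
      · intro t ht
        have : G t = 0 := by
          by_contra hne
          have := hc t ht hne
          linarith [Real.exp_pos (-(t ^ 2 * q))]
        simp [this]
    rw [this]; exact zero_le
  push Not at hφ0
  set t0 := Real.sqrt (max 0 (-Real.log φ) / q) with ht0
  have ht00 : 0 ≤ t0 := Real.sqrt_nonneg _
  have ht02 : t0 ^ 2 * q = max 0 (-Real.log φ) := by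
    rw [ht0, Real.sq_sqrt (by positivity)]; field_simp
  calc _ ≤ ∫⁻ t in Set.Ioi (0:ℝ), (Set.Ioi t0).indicator (fun t => ENNReal.ofReal (4 ^ |D - 2|) * ENNReal.ofReal (t * Real.exp (-(t ^ 2 * q)))) t := by
        refine setLIntegral_mono' measurableSet_Ioi fun t ht => ?_
        have ht : 0 < t := ht
        by_cases hGt : G t = 0
        · simp [hGt]
        obtain ⟨c1, c2, -⟩ := hG t ht hGt
        have c3 := hc t ht hGt
        have hmem : t ∈ Set.Ioi t0 := by
          have : max 0 (-Real.log φ) < t ^ 2 * q := by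
            apply max_lt (by positivity)
            have := (Real.lt_log_iff_exp_lt hφ0).2 c3
            linarith
          rw [← ht02] at this
          exact lt_of_pow_lt_pow_left₀ 2 ht.le (lt_of_mul_lt_mul_right this hq.le)
        rw [Set.indicator_of_mem hmem, ← ENNReal.ofReal_mul (by positivity)]
        refine (mul_le_mul' (hG2 t ht) le_rfl).trans ?_
        rw [← ENNReal.ofReal_mul (Real.exp_pos _).le]
        apply ENNReal.ofReal_le_ofReal
        have b1 : (1:ℝ) ≤ 4 * t := by
          have : (1/4:ℝ) ^ 2 ≤ t ^ 2 := by
            have : l / 4 ≤ t ^ 2 * (4 * l) := by nlinarith [sq_nonneg t]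
            by_contra hcon
            nlinarith
          have := le_of_sq_le_sq this ht.le
          linarith
        have b2 : t ≤ 4 * 1 := by
          have : t ^ 2 ≤ 2 ^ 2 := by
            have : t ^ 2 * l ≤ 4 * l := by nlinarith [sq_nonneg t]
            nlinarith
          have := le_of_sq_le_sq this (by norm_num)
          linarith
        have := rpow_cmp t 1 4 (D - 2) ht one_pos (by norm_num) b2 b1
        rw [Real.one_rpow, mul_one] at this
        have e : t ^ (D - 1) = t * t ^ (D - 2) := by
          rw [show D - 1 = 1 + (D - 2) by ring, Real.rpow_add ht, Real.rpow_one]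
        rw [e]
        calc Real.exp (-(t ^ 2 * q)) * (t * t ^ (D - 2)) ≤ Real.exp (-(t ^ 2 * q)) * (t * 4 ^ |D - 2|) := by gcongr
          _ = _ := by ring
    _ ≤ ∫⁻ t, (Set.Ioi t0).indicator (fun t => ENNReal.ofReal (4 ^ |D - 2|) * ENNReal.ofReal (t * Real.exp (-(t ^ 2 * q)))) t :=
        setLIntegral_le_lintegral _ _
    _ = ENNReal.ofReal (4 ^ |D - 2|) * ENNReal.ofReal (Real.exp (-(t0 ^ 2 * q)) / (2 * q)) := by
        rw [lintegral_indicator measurableSet_Ioi, lintegral_const_mul _ (by fun_prop), exp_int q t0 hq ht00]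
    _ ≤ _ := by
        rw [hΦφ, ← ENNReal.ofReal_mul (by positivity), ← ENNReal.ofReal_mul (by positivity)]
        apply ENNReal.ofReal_le_ofReal
        have : Real.exp (-(t0 ^ 2 * q)) ≤ φ := by
          rw [ht02]
          calc Real.exp (-max 0 (-Real.log φ)) ≤ Real.exp (Real.log φ) :=
                Real.exp_le_exp.2 (by linarith [le_max_right 0 (-Real.log φ)])
            _ = φ := Real.exp_log hφ0
        calc 4 ^ |D - 2| * (Real.exp (-(t0 ^ 2 * q)) / (2 * q)) ≤ 4 ^ |D - 2| * (φ / (2 * l)) := by gcongr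
          _ = _ := by ring

end helpers


section helpers
open scoped ENNReal NNReal

noncomputable def glob {d : ℕ} (a : Fin d → ℝ) (c P : ℝ) (g : (Fin d → ℝ) → ℝ≥0∞) (x : Fin d → ℝ) :
    ℝ≥0∞ :=
  ∑' k : ℕ, if (2:ℝ) ^ k ≤ P then ENNReal.ofReal (vV a x ((2:ℝ) ^ k)⁻¹)⁻¹ *
    ∫⁻ y, sS c ((2:ℝ) ^ k)⁻¹ x y * (g y * wW a y) else 0

noncomputable def nM {d : ℕ} (a : Fin d → ℝ) : Measure (Fin d → ℝ) :=
  volume.withDensity fun x => ENNReal.ofReal (Real.exp (-qQ x)) * wW a x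

lemma measurable_gH {d : ℕ} (a : Fin d → ℝ) (c τ : ℝ) (g : (Fin d → ℝ) → ℝ≥0∞) (hg : Measurable g) :
    Measurable fun x => ∫⁻ y, sS c τ x y * (g y * wW a y) := by
  have mw := measurable_wW a
  have ms := measurable_sS (d := d) c τ
  apply Measurable.lintegral_prod_right' (f := fun p : (Fin d → ℝ) × (Fin d → ℝ) => sS c τ p.1 p.2 * (g p.2 * wW a p.2))
  fun_prop

lemma measurable_glob {d : ℕ} (a : Fin d → ℝ) (c : ℝ) (P : (Fin d → ℝ) → ℝ) (hP : Measurable P)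
    (g : (Fin d → ℝ) → ℝ≥0∞) (hg : Measurable g) :
    Measurable fun x => glob a c (P x) g x := by
  unfold glob
  refine Measurable.ennreal_tsum fun k => ?_
  refine Measurable.ite (measurableSet_le measurable_const hP) ?_ measurable_const
  have := measurable_gH a c ((2:ℝ) ^ k)⁻¹ g hg
  have := measurable_vV a ((2:ℝ) ^ k)⁻¹
  fun_prop

lemma glob_small {d : ℕ} (a : Fin d → ℝ) (c : ℝ) (hc : 0 ≤ c) (g : (Fin d → ℝ) → ℝ≥0∞)
    (x : Fin d → ℝ) (hx : ∀ i, 0 < x i) (P : ℝ) (hP : P = 4 * (1 + ‖x‖)) :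
    glob a c P g x ≤ ENNReal.ofReal (P ^ nN a * (2 * P)) * ∫⁻ y, g y * wW a y := by
  have hP1 : 1 ≤ P := by rw [hP]; linarith [norm_nonneg x]
  have hP0 : 0 < P := by linarith
  set I := ∫⁻ y, g y * wW a y
  calc glob a c P g x ≤ ∑' k : ℕ, (ENNReal.ofReal (P ^ nN a) * I) * (if (2:ℝ) ^ k ≤ P then ENNReal.ofReal ((2:ℝ) ^ k) else 0) := by
        refine ENNReal.tsum_le_tsum fun k => ?_
        split_ifs with hk
        swap
        · simp
        have h2k : (1:ℝ) ≤ 2 ^ k := one_le_pow₀ (by norm_num)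
        have i1 : ((2:ℝ) ^ k)⁻¹ ≤ 1 := inv_le_one_of_one_le₀ h2k
        have i2 : 1 ≤ P * ((2:ℝ) ^ k)⁻¹ := by rw [← div_eq_mul_inv, le_div_iff₀ (by positivity)]; linarith
        have h1 : (vV a x ((2:ℝ) ^ k)⁻¹)⁻¹ ≤ P ^ nN a := by
          have := vV_inv_cmp a 0 x 1 ((2:ℝ) ^ k)⁻¹ P (by simp) (fun i => (hx i).le) one_pos (by positivity)
            hP1 i2 (fun i => by
              have := hx i
              simp only [Pi.zero_apply, zero_add]; nlinarith) (fun i => by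
              have := norm_le_pi_norm x i
              rw [Real.norm_eq_abs, abs_of_pos (hx i)] at this
              simp only [Pi.zero_apply, zero_add]
              linarith [norm_nonneg x])
          simpa [vV] using this
        have h2 : ∫⁻ y, sS c ((2:ℝ) ^ k)⁻¹ x y * (g y * wW a y) ≤ I := by
          refine lintegral_mono fun y => ?_
          calc _ ≤ 1 * (g y * wW a y) := by gcongr; exact sS_le_one _ _ hc _ _
            _ = _ := one_mul _
        calc _ ≤ ENNReal.ofReal (P ^ nN a) * I := by gcongr
          _ ≤ _ := le_mul_of_one_le_right' (ENNReal.one_le_ofReal.2 h2k)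
    _ ≤ (ENNReal.ofReal (P ^ nN a) * I) * ENNReal.ofReal (2 * P) := by
        rw [ENNReal.tsum_mul_left]; gcongr; exact pow2_sum P hP1
    _ = _ := by rw [ENNReal.ofReal_mul (p := P ^ nN a) (by positivity)]; ring

lemma glob_dil {d : ℕ} (a : Fin d → ℝ) (g : (Fin d → ℝ) → ℝ≥0∞)
    (x : Fin d → ℝ) (hx : ∀ i, 0 < x i) (t P P' : ℝ) (ht1 : 1 / 4 ≤ t) (ht2 : t ≤ 2)
    (hP : P' ≤ P) :
    glob a (1/64) P' g (t • x) ≤ ENNReal.ofReal (4 ^ nN a) * glob a (1/1024) P g x := by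
  have ht : 0 < t := by linarith
  unfold glob
  rw [← ENNReal.tsum_mul_left]
  refine ENNReal.tsum_le_tsum fun k => ?_
  split_ifs with h1 h2
  · have e1 : (vV a (t • x) ((2:ℝ) ^ k)⁻¹)⁻¹ ≤ 4 ^ nN a * (vV a x ((2:ℝ) ^ k)⁻¹)⁻¹ := by
      have hp : 0 < ((2:ℝ) ^ k)⁻¹ := by positivity
      refine vV_inv_cmp a x (t • x) _ _ 4 (fun i => (hx i).le) (fun i => ?_) hp hp (by norm_num) (by linarith)
        (fun i => ?_) (fun i => ?_)
      · have := hx i; simp; positivity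
      · have := hx i; simp only [Pi.smul_apply, smul_eq_mul]; nlinarith
      · have := hx i; simp only [Pi.smul_apply, smul_eq_mul]; nlinarith
    have e2 : ∀ y, sS (1/64) ((2:ℝ) ^ k)⁻¹ (t • x) y ≤ sS (1/1024) ((2:ℝ) ^ k)⁻¹ x y := by
      intro y
      refine iSup_le fun u => ?_
      refine le_trans ?_ (le_iSup _ (u / Real.toNNReal t))
      apply ENNReal.ofReal_le_ofReal
      apply Real.exp_le_exp.2
      rw [neg_le_neg_iff]
      gcongr ?_ / _
      have e : t • x - (u:ℝ) • y = t • (x - ((u / Real.toNNReal t : ℝ≥0) : ℝ) • y) := by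
        rw [smul_sub, smul_smul, NNReal.coe_div, Real.coe_toNNReal t ht.le, mul_div_cancel₀ _ ht.ne']
      rw [e, norm_smul, Real.norm_eq_abs, abs_of_pos ht, mul_pow]
      have : (1/4:ℝ) ^ 2 ≤ t ^ 2 := pow_le_pow_left₀ (by norm_num) ht1 2
      nlinarith [sq_nonneg ‖x - ((u / Real.toNNReal t : ℝ≥0) : ℝ) • y‖]
    rw [← mul_assoc, ← ENNReal.ofReal_mul (by positivity)]
    gcongr
    exact e2 _
  · exact absurd (h1.trans hP) h2
  · simp
  · simp

lemma glob_int_k {d : ℕ} (a : Fin d → ℝ) (c : ℝ) (C : ℝ≥0∞) (M : ℝ) (hM : 0 ≤ M)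
    (hCb : ∀ (y : Fin d → ℝ) (τ M : ℝ), 0 < τ → 0 ≤ M →
      ∫⁻ x in {x | ‖x‖ ≤ M}, wW a x * ENNReal.ofReal (vV a x τ)⁻¹ * sS c τ x y
        ≤ C * ENNReal.ofReal (M / τ + 1))
    (g : (Fin d → ℝ) → ℝ≥0∞) (hg : Measurable g) (τ : ℝ) (hτ0 : 0 < τ) :
    ∫⁻ x in {x | ‖x‖ ≤ M}, (ENNReal.ofReal (vV a x τ)⁻¹ * ∫⁻ y, sS c τ x y * (g y * wW a y)) * wW a x
      ≤ (C * ENNReal.ofReal (M / τ + 1)) * ∫⁻ y, g y * wW a y := by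
  have mw := measurable_wW a
  have mv := measurable_vV a τ
  have ms := measurable_sS (d := d) c τ
  have mgw : Measurable fun y => g y * wW a y := hg.mul mw
  calc _ = ∫⁻ x in {x | ‖x‖ ≤ M}, ∫⁻ y, (wW a x * ENNReal.ofReal (vV a x τ)⁻¹ * sS c τ x y) * (g y * wW a y) := by
        refine lintegral_congr fun x => ?_
        have ms' : Measurable fun y => sS c τ x y := by
          have h := ms.comp (measurable_prodMk_left (x := x))
          exact h
        have h := lintegral_const_mul (μ := volume) (wW a x * ENNReal.ofReal (vV a x τ)⁻¹) (ms'.mul mgw)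
        simp only [Pi.mul_apply] at h
        calc _ = (wW a x * ENNReal.ofReal (vV a x τ)⁻¹) * ∫⁻ y, sS c τ x y * (g y * wW a y) := by ring
          _ = _ := by rw [← h]; refine lintegral_congr fun y => ?_; rw [mul_assoc _ (sS c τ x y)]
    _ = ∫⁻ y, ∫⁻ x in {x | ‖x‖ ≤ M}, (wW a x * ENNReal.ofReal (vV a x τ)⁻¹ * sS c τ x y) * (g y * wW a y) := by
        rw [lintegral_lintegral_swap]
        apply Measurable.aemeasurable
        change Measurable fun p : (Fin d → ℝ) × (Fin d → ℝ) => (wW a p.1 * ENNReal.ofReal (vV a p.1 τ)⁻¹ * sS c τ p.1 p.2) * (g p.2 * wW a p.2)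
        have mv' : Measurable fun p : (Fin d → ℝ) × (Fin d → ℝ) => vV a p.1 τ := mv.comp measurable_fst
        exact (((mw.comp measurable_fst).mul mv'.inv.ennreal_ofReal).mul ms).mul (mgw.comp measurable_snd)
    _ ≤ ∫⁻ y, (C * ENNReal.ofReal (M / τ + 1)) * (g y * wW a y) := by
        refine lintegral_mono fun y => ?_
        have ms' : Measurable fun x => sS c τ x y := by
          have h := ms.comp (measurable_prodMk_right (y := y))
          exact h
        have h := lintegral_mul_const (μ := volume.restrict {x | ‖x‖ ≤ M}) (g y * wW a y) ((mw.mul mv.inv.ennreal_ofReal).mul ms')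
        simp only [Pi.mul_apply, Pi.inv_apply] at h
        rw [h]
        gcongr
        exact hCb y τ M hτ0 hM
    _ = (C * ENNReal.ofReal (M / τ + 1)) * ∫⁻ y, g y * wW a y := lintegral_const_mul _ mgw

lemma glob_int {d : ℕ} (a : Fin d → ℝ) (ha : ∀ i, -1 < a i) (c : ℝ) (hc : 0 < c) :
    ∃ C : ℝ≥0∞, C < ∞ ∧ ∀ (g : (Fin d → ℝ) → ℝ≥0∞), Measurable g → ∀ M P : ℝ, 0 ≤ M → 1 ≤ P →
      ∫⁻ x in {x | ‖x‖ ≤ M}, glob a c P g x * wW a x ≤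
        C * ENNReal.ofReal ((M + 1) * (2 * P)) * ∫⁻ y, g y * wW a y := by
  obtain ⟨C, hC, hCb⟩ := ray_int a ha c hc
  refine ⟨C, hC, fun g hg M P hM hP => ?_⟩
  have mw := measurable_wW a
  set I := ∫⁻ y, g y * wW a y
  unfold glob
  simp_rw [← ENNReal.tsum_mul_right]
  rw [lintegral_tsum]
  swap
  · intro k
    have := measurable_gH a c ((2:ℝ) ^ k)⁻¹ g hg
    have := measurable_vV a ((2:ℝ) ^ k)⁻¹
    split_ifs
    · exact Measurable.aemeasurable (by fun_prop)
    · exact Measurable.aemeasurable (by fun_prop)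
  calc _ ≤ ∑' k : ℕ, (C * ENNReal.ofReal (M + 1) * I) * (if (2:ℝ) ^ k ≤ P then ENNReal.ofReal ((2:ℝ) ^ k) else 0) := by
        refine ENNReal.tsum_le_tsum fun k => ?_
        split_ifs with hk
        swap
        · simp
        have h2k : (1:ℝ) ≤ 2 ^ k := one_le_pow₀ (by norm_num)
        have hτ0 : 0 < ((2:ℝ) ^ k)⁻¹ := by positivity
        refine (glob_int_k a c C M hM hCb g hg _ hτ0).trans ?_
        calc _ ≤ (C * (ENNReal.ofReal (M + 1) * ENNReal.ofReal ((2:ℝ) ^ k))) * I := by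
              rw [← ENNReal.ofReal_mul (by positivity)]
              gcongr
              rw [div_inv_eq_mul]; nlinarith
          _ = _ := by ring
    _ ≤ (C * ENNReal.ofReal (M + 1) * I) * ENNReal.ofReal (2 * P) := by
        rw [ENNReal.tsum_mul_left]; gcongr; exact pow2_sum P hP
    _ = _ := by rw [ENNReal.ofReal_mul (p := M + 1) (by positivity)]; ring

lemma exists_l0 (B K : ℝ) : ∃ l0 : ℝ, 1 ≤ l0 ∧ ∀ l, l0 ≤ l →
    B * (Real.exp (l / 4) * ((8 * l) ^ K * (2 * (8 * l)) * Real.exp (-l))) ≤ 1 := by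
  have h := tendsto_rpow_mul_exp_neg_mul_atTop_nhds_zero (K + 1) (3/4) (by norm_num)
  have h2 := (h.const_mul (B * (8 ^ K * 16))).eventually_le_const (u := 1) (by rw [mul_zero]; norm_num)
  rw [Filter.eventually_atTop] at h2
  obtain ⟨l0, hl0⟩ := h2
  refine ⟨max 1 l0, le_max_left _ _, fun l hl => ?_⟩
  have hl1 : 1 ≤ l := (le_max_left _ _).trans hl
  have := hl0 l ((le_max_right _ _).trans hl)
  refine le_trans (le_of_eq ?_) this
  rw [Real.mul_rpow (by norm_num) (by linarith), Real.rpow_add (by linarith), Real.rpow_one,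
    show -(3/4) * l = l / 4 + (-l) by ring, Real.exp_add]
  ring

lemma global_lemma {d : ℕ} (hd : 1 ≤ d) (a : Fin d → ℝ) (ha : ∀ i, -1 < a i) (B : ℝ) (hB : 0 < B) :
    ∃ C : ℝ≥0∞, C < ∞ ∧ ∀ (g : (Fin d → ℝ) → ℝ≥0∞), Measurable g →
      nM a {x | (∀ i, 0 < x i) ∧ 1 < ENNReal.ofReal B * (ENNReal.ofReal (Real.exp (qQ x)) *
        glob a (1/64) (4 * (1 + ‖x‖)) g x)} ≤ C * ∫⁻ y, g y * wW a y := by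
  have mw := measurable_wW a
  have mq := measurable_qQ (d := d)
  set C0 := ∫⁻ x, ENNReal.ofReal (Real.exp (-(qQ x / 2))) * wW a x with hC0
  have hC0f : C0 < ∞ := gauss_fin a ha
  have hqn : ∀ x : Fin d → ℝ, 0 ≤ qQ x := fun x => Finset.sum_nonneg fun i _ => sq_nonneg _
  obtain ⟨l0, hl01, hl0⟩ := exists_l0 B (nN a)
  obtain ⟨C1, hC1, hC1b⟩ := glob_int a ha (1/1024) (by norm_num)
  set D : ℝ := (d:ℝ) + ∑ i, a i with hD
  set C2 : ℝ≥0∞ := (ENNReal.ofReal (Real.log 2))⁻¹ * (ENNReal.ofReal (4 ^ |D - 2| * 36 * B * 4 ^ nN a) * C1) with hC2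
  have hlog : ENNReal.ofReal (Real.log 2) ≠ 0 := by simpa using Real.log_pos one_lt_two
  have hC2f : C2 < ∞ := ENNReal.mul_lt_top (by simpa using Real.log_pos one_lt_two)
    (ENNReal.mul_lt_top (by simp) hC1)
  refine ⟨C0 * ENNReal.ofReal (Real.exp l0) + C0 + C2, by
    simp only [ENNReal.add_lt_top]; exact ⟨⟨ENNReal.mul_lt_top hC0f (by simp), hC0f⟩, hC2f⟩, fun g hg => ?_⟩
  set I := ∫⁻ y, g y * wW a y with hI
  set E := {x : Fin d → ℝ | (∀ i, 0 < x i) ∧ 1 < ENNReal.ofReal B * (ENNReal.ofReal (Real.exp (qQ x)) *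
        glob a (1/64) (4 * (1 + ‖x‖)) g x)} with hE
  by_cases hI1 : ENNReal.ofReal (Real.exp (-l0)) ≤ I
  · calc nM a E ≤ nM a Set.univ := measure_mono (Set.subset_univ _)
      _ ≤ C0 := by
        rw [nM, withDensity_apply _ MeasurableSet.univ, setLIntegral_univ]
        refine lintegral_mono fun x => ?_
        gcongr
        have := hqn x; linarith
      _ = C0 * ENNReal.ofReal (Real.exp l0) * ENNReal.ofReal (Real.exp (-l0)) := by
        rw [mul_assoc, ← ENNReal.ofReal_mul (Real.exp_pos _).le, ← Real.exp_add]; simp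
      _ ≤ _ := by gcongr; rw [add_assoc]; exact le_self_add
  push Not at hI1
  have hIf : I ≠ ∞ := (hI1.trans (by simp)).ne
  by_cases hI0 : I = 0
  · have : E = ∅ := by
      ext x
      simp only [hE, Set.mem_ofPred_eq, Set.mem_empty_iff_false, iff_false, not_and, not_lt]
      intro hx
      have := glob_small a (1/64) (by norm_num) g x hx _ rfl
      rw [← hI, hI0, mul_zero] at this
      rw [le_antisymm this zero_le]; simp
    rw [this]; simp
  have hIpos : 0 < I.toReal := ENNReal.toReal_pos hI0 hIf
  set l := -Real.log I.toReal with hl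
  have hIl : I = ENNReal.ofReal (Real.exp (-l)) := by
    rw [hl, neg_neg, Real.exp_log hIpos, ENNReal.ofReal_toReal hIf]
  have hll0 : l0 ≤ l := by
    rw [hIl, ENNReal.ofReal_lt_ofReal_iff (Real.exp_pos _), Real.exp_lt_exp] at hI1
    linarith
  have hl1 : 1 ≤ l := hl01.trans hll0
  have hlpos : 0 < l := by linarith
  have hsq : Real.sqrt l ^ 2 = l := Real.sq_sqrt hlpos.le
  have hsq1 : 1 ≤ Real.sqrt l := Real.one_le_sqrt.2 hl1
  -- the three parts
  set E1 := E ∩ {x | l / 4 ≤ qQ x ∧ qQ x ≤ 4 * l} with hE1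
  set E2 := {x : Fin d → ℝ | 4 * l < qQ x} with hE2
  have hsub : E ⊆ E2 ∪ E1 := by
    intro x hx
    by_cases h1 : 4 * l < qQ x
    · exact Or.inl h1
    · right
      refine ⟨hx, ?_, not_lt.1 h1⟩
      by_contra h2
      push Not at h2
      obtain ⟨hx0, hx1⟩ := hx
      apply absurd hx1
      rw [not_lt]
      have hn : ‖x‖ ^ 2 ≤ qQ x := norm_sq_le_sum x
      have hn2 : ‖x‖ ≤ l := by
        apply le_of_sq_le_sq _ hlpos.le; nlinarith
      set P := 4 * (1 + ‖x‖) with hP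
      have hPl : P ≤ 8 * l := by linarith
      have hP0 : 0 < P := by positivity
      calc _ ≤ ENNReal.ofReal B * (ENNReal.ofReal (Real.exp (l / 4)) * (ENNReal.ofReal ((8 * l) ^ nN a * (2 * (8 * l))) * I)) := by
            gcongr
            refine (glob_small a (1/64) (by norm_num) g x hx0 P hP).trans ?_
            gcongr
            exact nN_nonneg a
        _ ≤ 1 := by
            rw [hIl, ← ENNReal.ofReal_mul (by positivity), ← ENNReal.ofReal_mul (by positivity),
              ← ENNReal.ofReal_mul (by positivity), ← ENNReal.ofReal_one]
            exact ENNReal.ofReal_le_ofReal (hl0 l hll0)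
  have hpart2 : nM a E2 ≤ C0 * I := by
    have mE2 : MeasurableSet E2 := measurableSet_lt measurable_const mq
    rw [nM, withDensity_apply _ mE2]
    calc _ ≤ ∫⁻ x in E2, I * (ENNReal.ofReal (Real.exp (-(qQ x / 2))) * wW a x) := by
          refine setLIntegral_mono' mE2 fun x hx => ?_
          have hx : 4 * l < qQ x := hx
          rw [hIl, ← mul_assoc, ← ENNReal.ofReal_mul (by positivity), ← Real.exp_add]
          gcongr
          linarith
      _ ≤ ∫⁻ x, I * (ENNReal.ofReal (Real.exp (-(qQ x / 2))) * wW a x) := setLIntegral_le_lintegral _ _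
      _ = _ := by rw [lintegral_const_mul _ (by fun_prop), mul_comm]
  have mE : MeasurableSet E := by
    have := measurable_glob a (1/64) (fun x => 4 * (1 + ‖x‖)) (by fun_prop) g hg
    have hm : Measurable fun x => ENNReal.ofReal B * (ENNReal.ofReal (Real.exp (qQ x)) *
        glob a (1/64) (4 * (1 + ‖x‖)) g x) := by fun_prop
    refine MeasurableSet.inter ?_ (measurableSet_lt measurable_const hm)
    have : {x : Fin d → ℝ | ∀ i, 0 < x i} = ⋂ i, {x | 0 < x i} := by ext; simp
    change MeasurableSet {x : Fin d → ℝ | ∀ i, 0 < x i}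
    rw [this]
    exact MeasurableSet.iInter fun i => measurableSet_lt measurable_const (measurable_pi_apply i)
  have mE1 : MeasurableSet E1 := mE.inter
    ((measurableSet_le measurable_const mq).inter (measurableSet_le mq measurable_const))
  set S : Set (Fin d → ℝ) := {x | l ≤ qQ x ∧ qQ x ≤ 4 * l} with hS
  have mS : MeasurableSet S := (measurableSet_le measurable_const mq).inter (measurableSet_le mq measurable_const)
  set M := 2 * Real.sqrt l with hM
  have mg := measurable_glob a (1/1024) (fun _ => 4 * (1 + M)) measurable_const g hg
  have hpart1 : nM a E1 ≤ C2 * I := by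
    rw [nM, withDensity_apply _ mE1, ← lintegral_indicator mE1]
    set F : (Fin d → ℝ) → ℝ≥0∞ := E1.indicator fun x => ENNReal.ofReal (Real.exp (-qQ x)) with hF
    have mF : Measurable F := Measurable.indicator (by fun_prop) mE1
    have e : ∀ x, E1.indicator (fun x => ENNReal.ofReal (Real.exp (-qQ x)) * wW a x) x = F x * wW a x := by
      intro x
      by_cases hx : x ∈ E1 <;> simp [hF, hx]
    simp_rw [e]
    have key : ∀ X Y : ℝ≥0∞, ENNReal.ofReal (Real.log 2) * X ≤ Y → X ≤ (ENNReal.ofReal (Real.log 2))⁻¹ * Y := by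
      intro X Y h
      calc X = (ENNReal.ofReal (Real.log 2))⁻¹ * (ENNReal.ofReal (Real.log 2) * X) := by
            rw [← mul_assoc, ENNReal.inv_mul_cancel hlog (by simp), one_mul]
        _ ≤ _ := by gcongr
    rw [hC2, mul_assoc]
    apply key
    refine (dil_fubini hd a F mF l hlpos).trans ?_
    calc _ ≤ ∫⁻ x in S, ENNReal.ofReal (4 ^ |D - 2| / (2 * l)) * (ENNReal.ofReal (B * 4 ^ nN a) * glob a (1/1024) (4 * (1 + M)) g x) * wW a x := by
          refine setLIntegral_mono' mS fun x hx => ?_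
          gcongr
          refine ray_lemma (qQ x) l D hlpos hx.1 hx.2 _ (fun t => F (t • x)) (fun t ht hGt => ?_) (fun t ht => ?_)
          · have hmem : t • x ∈ E1 := by
              by_contra h; exact hGt (by simp only [hF]; rw [Set.indicator_of_notMem h])
            obtain ⟨⟨h1, h2⟩, h3, h4⟩ := hmem
            have hx0 : ∀ i, 0 < x i := fun i => by
              have := h1 i
              simpa [mul_pos_iff_of_pos_left ht] using this
            have hn : ‖t • x‖ ^ 2 ≤ qQ (t • x) := norm_sq_le_sum _
            have hn2 : ‖t • x‖ ≤ M := by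
              apply le_of_sq_le_sq _ (by positivity); rw [hM]; nlinarith
            rw [qQ_smul] at h2 h3 h4
            refine ⟨h3, h4, h2.trans_le ?_⟩
            obtain ⟨hx1, hx2⟩ := hx
            have t1 : 1 / 4 ≤ t := by
              have : (1/4:ℝ) ^ 2 ≤ t ^ 2 := by
                have : l / 4 ≤ t ^ 2 * (4 * l) := by nlinarith [sq_nonneg t]
                by_contra hcon
                nlinarith
              exact le_of_sq_le_sq this ht.le
            have t2 : t ≤ 2 := by
              have : t ^ 2 ≤ 2 ^ 2 := by
                have : t ^ 2 * l ≤ 4 * l := by nlinarith [sq_nonneg t]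
                nlinarith
              exact le_of_sq_le_sq this (by norm_num)
            calc _ ≤ ENNReal.ofReal B * (ENNReal.ofReal (Real.exp (t ^ 2 * qQ x)) * (ENNReal.ofReal (4 ^ nN a) * glob a (1/1024) (4 * (1 + M)) g x)) := by
                  gcongr
                  exact glob_dil a g x hx0 t _ _ t1 t2 (by linarith)
              _ = _ := by rw [ENNReal.ofReal_mul hB.le]; ring
          · simp only [hF]
            rw [← qQ_smul]
            exact Set.indicator_le_self _ _ _
      _ = ENNReal.ofReal (4 ^ |D - 2| / (2 * l)) * ENNReal.ofReal (B * 4 ^ nN a) * ∫⁻ x in S, glob a (1/1024) (4 * (1 + M)) g x * wW a x := by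
          rw [← lintegral_const_mul _ (by fun_prop)]
          refine lintegral_congr fun x => ?_
          ring
      _ ≤ ENNReal.ofReal (4 ^ |D - 2| / (2 * l)) * ENNReal.ofReal (B * 4 ^ nN a) * ∫⁻ x in {x | ‖x‖ ≤ M}, glob a (1/1024) (4 * (1 + M)) g x * wW a x := by
          gcongr
          intro x hx
          have hn : ‖x‖ ^ 2 ≤ qQ x := norm_sq_le_sum _
          have := hx.2
          change ‖x‖ ≤ M
          apply le_of_sq_le_sq _ (by positivity); rw [hM]; nlinarith
      _ ≤ ENNReal.ofReal (4 ^ |D - 2| / (2 * l)) * ENNReal.ofReal (B * 4 ^ nN a) * (C1 * ENNReal.ofReal (72 * l) * I) := by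
          gcongr
          refine (hC1b g hg M (4 * (1 + M)) (by positivity) (by linarith)).trans ?_
          gcongr C1 * ?_ * I
          apply ENNReal.ofReal_le_ofReal
          rw [hM]; nlinarith
      _ = _ := by
          have : 4 ^ |D - 2| * 36 * B * 4 ^ nN a = (4 ^ |D - 2| / (2 * l)) * (B * 4 ^ nN a) * (72 * l) := by
            field_simp; ring
          rw [this, ENNReal.ofReal_mul (q := 72 * l) (by positivity), ENNReal.ofReal_mul (p := 4 ^ |D - 2| / (2 * l)) (by positivity)]
          ring
  calc nM a E ≤ nM a E2 + nM a E1 := (measure_mono hsub).trans (measure_union_le _ _)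
    _ ≤ C0 * I + C2 * I := add_le_add hpart2 hpart1
    _ ≤ _ := by
      rw [← add_mul]; gcongr; exact le_add_self

end helpers


section helpers
open scoped ENNReal NNReal

lemma ball_ub {d : ℕ} (a : Fin d → ℝ) (ha : ∀ i, -1 < a i) :
    ∃ C : ℝ≥0∞, C < ∞ ∧ ∀ (x : Fin d → ℝ) (ρ : ℝ), (∀ i, 0 < x i) → 0 < ρ → ρ * (1 + ‖x‖) ≤ 1 →
      nM a (Metric.closedBall x (5 * ρ)) ≤ C * ENNReal.ofReal (Real.exp (-qQ x) * vV a x ρ) := by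
  obtain ⟨C, hC, hCb⟩ := multi_dim a ha 1 one_pos
  refine ⟨ENNReal.ofReal (Real.exp (35 * d) * 6 ^ nN a * Real.exp 25) * C,
    ENNReal.mul_lt_top (by simp) hC, fun x ρ hx hρ hρx => ?_⟩
  have mw := measurable_wW a
  have mv := measurable_vV a ρ
  have hvx := vV_pos a x ρ (fun i => (hx i).le) hρ
  rw [nM, withDensity_apply _ Metric.isClosed_closedBall.measurableSet]
  calc _ ≤ ∫⁻ z in Metric.closedBall x (5 * ρ),
        ENNReal.ofReal (Real.exp (35 * d) * 6 ^ nN a * Real.exp 25 * (Real.exp (-qQ x) * vV a x ρ)) *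
        (wW a z * ENNReal.ofReal ((vV a z ρ)⁻¹ * Real.exp (-(1 * ‖z - x‖ ^ 2 / ρ ^ 2)))) := by
        refine setLIntegral_mono' Metric.isClosed_closedBall.measurableSet fun z hz => ?_
        by_cases hz0 : ∀ i, 0 < z i
        swap
        · simp [wW_zero a z hz0]
        rw [mem_closedBall_iff_norm] at hz
        have hvz := vV_pos a z ρ (fun i => (hz0 i).le) hρ
        have hzi : ∀ i, |z i - x i| ≤ 5 * ρ := fun i => (norm_le_pi_norm (z - x) i).trans hz
        have hn0 := norm_nonneg x
        have h1 : qQ x - qQ z ≤ 35 * d := by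
          unfold qQ
          rw [← Finset.sum_sub_distrib]
          calc _ ≤ ∑ i : Fin d, (35:ℝ) := by
                refine Finset.sum_le_sum fun i _ => ?_
                have h := abs_le.1 (hzi i)
                have hxi := norm_le_pi_norm x i
                rw [Real.norm_eq_abs, abs_of_pos (hx i)] at hxi
                have := hx i
                have := hz0 i
                have e1 : ρ * x i ≤ 1 := by nlinarith
                have e2 : ρ ≤ 1 := by nlinarith
                by_cases hc : x i ≤ z i
                · nlinarith
                · push Not at hc
                  nlinarith
            _ = _ := by simp [mul_comm]
        have h2 : vV a z ρ ≤ 6 ^ nN a * vV a x ρ := by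
          refine vV_cmp a z x ρ ρ 6 (fun i => (hz0 i).le) (fun i => (hx i).le) hρ hρ (by norm_num)
            (by linarith) (fun i => ?_) (fun i => ?_)
          · have h := abs_le.1 (hzi i); have := hx i; linarith
          · have h := abs_le.1 (hzi i); have := hz0 i; linarith
        have h3 : 1 * ‖z - x‖ ^ 2 / ρ ^ 2 ≤ 25 := by
          rw [div_le_iff₀ (by positivity)]
          nlinarith [norm_nonneg (z - x)]
        rw [mul_comm (wW a z), ← mul_assoc, ← ENNReal.ofReal_mul (by positivity)]
        gcongr
        calc Real.exp (-qQ z) = Real.exp (-qQ z) * 1 * 1 := by ring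
          _ ≤ Real.exp (35 * d + -qQ x) * (6 ^ nN a * vV a x ρ * (vV a z ρ)⁻¹) *
              Real.exp (25 + -(1 * ‖z - x‖ ^ 2 / ρ ^ 2)) := by
              gcongr
              · linarith
              · rw [← div_eq_mul_inv, le_div_iff₀ hvz]; linarith
              · apply Real.one_le_exp; linarith
          _ = _ := by rw [Real.exp_add, Real.exp_add]; ring
    _ ≤ ∫⁻ z, ENNReal.ofReal (Real.exp (35 * d) * 6 ^ nN a * Real.exp 25 * (Real.exp (-qQ x) * vV a x ρ)) *
        (wW a z * ENNReal.ofReal ((vV a z ρ)⁻¹ * Real.exp (-(1 * ‖z - x‖ ^ 2 / ρ ^ 2)))) :=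
        setLIntegral_le_lintegral _ _
    _ ≤ ENNReal.ofReal (Real.exp (35 * d) * 6 ^ nN a * Real.exp 25 * (Real.exp (-qQ x) * vV a x ρ)) * C := by
        rw [lintegral_const_mul _ (by fun_prop)]
        gcongr
        exact hCb x ρ hρ
    _ = _ := by rw [ENNReal.ofReal_mul (q := Real.exp (-qQ x) * vV a x ρ) (by positivity)]; ring

lemma local_lemma {d : ℕ} (a : Fin d → ℝ) (ha : ∀ i, -1 < a i) (θ : ℝ) (hθ : 0 < θ) :
    ∃ C : ℝ≥0∞, C < ∞ ∧ ∀ (g : (Fin d → ℝ) → ℝ≥0∞), Measurable g →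
      nM a {x | (∀ i, 0 < x i) ∧ ∃ ρ : ℝ, 0 < ρ ∧ ρ * (1 + ‖x‖) ≤ 1 ∧
        ENNReal.ofReal (θ * (Real.exp (-qQ x) * vV a x ρ)) ≤
          ∫⁻ y in Metric.closedBall x ρ, g y * wW a y} ≤ C * ∫⁻ y, g y * wW a y := by
  obtain ⟨C, hC, hCb⟩ := ball_ub a ha
  refine ⟨C * ENNReal.ofReal θ⁻¹, ENNReal.mul_lt_top hC (by simp), fun g hg => ?_⟩
  set E := {x : Fin d → ℝ | (∀ i, 0 < x i) ∧ ∃ ρ : ℝ, 0 < ρ ∧ ρ * (1 + ‖x‖) ≤ 1 ∧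
        ENNReal.ofReal (θ * (Real.exp (-qQ x) * vV a x ρ)) ≤
          ∫⁻ y in Metric.closedBall x ρ, g y * wW a y} with hE
  have hch : ∀ x : Fin d → ℝ, ∃ ρ : ℝ, x ∈ E → (0 < ρ ∧ ρ * (1 + ‖x‖) ≤ 1 ∧
        ENNReal.ofReal (θ * (Real.exp (-qQ x) * vV a x ρ)) ≤
          ∫⁻ y in Metric.closedBall x ρ, g y * wW a y) := by
    intro x
    by_cases hx : x ∈ E
    · obtain ⟨ρ, h⟩ := hx.2; exact ⟨ρ, fun _ => h⟩
    · exact ⟨0, fun h => absurd h hx⟩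
  choose ρ hρ using hch
  obtain ⟨u, hu, hdisj, hcov⟩ := Vitali.exists_disjoint_subfamily_covering_enlargement_closedBall
    E id ρ 1 (fun x hx => by
      obtain ⟨h1, h2, -⟩ := hρ x hx
      nlinarith [norm_nonneg x]) 5 (by norm_num)
  simp only [id] at hdisj hcov
  have hcount : u.Countable := by
    refine hdisj.countable_of_nonempty_interior fun x hx => ?_
    refine ⟨x, Metric.ball_subset_interior_closedBall ?_⟩
    exact Metric.mem_ball_self (hρ x (hu hx)).1
  have hsub : E ⊆ ⋃ x ∈ u, Metric.closedBall x (5 * ρ x) := by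
    intro x hx
    obtain ⟨b, hb, hb2⟩ := hcov x hx
    simp only [Set.mem_iUnion]
    exact ⟨b, hb, hb2 (Metric.mem_closedBall_self (hρ x hx).1.le)⟩
  calc nM a E ≤ ∑' x : u, nM a (Metric.closedBall (x : Fin d → ℝ) (5 * ρ x)) :=
        (measure_mono hsub).trans (measure_biUnion_le _ hcount _)
    _ ≤ ∑' x : u, C * ENNReal.ofReal θ⁻¹ * ∫⁻ y in Metric.closedBall (x : Fin d → ℝ) (ρ x), g y * wW a y := by
        refine ENNReal.tsum_le_tsum fun x => ?_
        have hx := hu x.2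
        obtain ⟨h1, h2, h3⟩ := hρ x hx
        have hvx := vV_pos a x (ρ x) (fun i => (hx.1 i).le) h1
        calc _ ≤ C * ENNReal.ofReal (Real.exp (-qQ (x : Fin d → ℝ)) * vV a x (ρ x)) := hCb x (ρ x) hx.1 h1 h2
          _ = C * ENNReal.ofReal θ⁻¹ * ENNReal.ofReal (θ * (Real.exp (-qQ (x : Fin d → ℝ)) * vV a x (ρ x))) := by
              rw [mul_assoc, ← ENNReal.ofReal_mul (by positivity), inv_mul_cancel_left₀ hθ.ne']
          _ ≤ _ := by gcongr
    _ = C * ENNReal.ofReal θ⁻¹ * ∫⁻ y in ⋃ x ∈ u, Metric.closedBall x (ρ x), g y * wW a y := by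
        rw [ENNReal.tsum_mul_left, lintegral_biUnion hcount (fun x _ => Metric.isClosed_closedBall.measurableSet) hdisj]
    _ ≤ _ := by gcongr; exact Measure.restrict_le_self

end helpers


section helpers
open scoped ENNReal NNReal

noncomputable def sSum {d : ℕ} (s : ℝ) (x y : Fin d → ℝ) : ℝ :=
  ∑ i, ((1 + s) * x i - (1 - s) * y i) ^ 2

lemma vV_inv_scale {d : ℕ} (a x : Fin d → ℝ) (σ p : ℝ) (hx : ∀ i, 0 < x i) (hσ : 0 < σ) (hp : 1 ≤ p) :
    (vV a x σ)⁻¹ ≤ p ^ nN a * (vV a x (p * σ))⁻¹ := by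
  have h : 0 < p * σ := by positivity
  refine vV_inv_cmp a x x (p * σ) σ p (fun i => (hx i).le) (fun i => (hx i).le) h hσ hp le_rfl
    (fun i => ?_) (fun i => ?_)
  · have := hx i; nlinarith
  · have := hx i; nlinarith [mul_le_mul_of_nonneg_right hp hσ.le]

lemma sSum_ge {d : ℕ} (s : ℝ) (x y : Fin d → ℝ) :
    ‖(1 + s) • x - (1 - s) • y‖ ^ 2 ≤ sSum s x y := by
  have := norm_sq_le_sum ((1 + s) • x - (1 - s) • y)
  simpa [sSum] using this

lemma caseA {d : ℕ} (a x y : Fin d → ℝ) (hx : ∀ i, 0 < x i) (σ : ℝ) (hσ : 0 < σ) (hσ1 : σ < 1)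
    (h : 1 ≤ 2 * σ * (1 + ‖x‖)) :
    ∃ k : ℕ, (2:ℝ) ^ k ≤ 4 * (1 + ‖x‖) ∧
      ENNReal.ofReal ((vV a x σ)⁻¹ * Real.exp (-(sSum (σ ^ 2) x y / (8 * σ ^ 2)))) ≤
        ENNReal.ofReal (2 ^ nN a) * (ENNReal.ofReal (vV a x ((2:ℝ) ^ k)⁻¹)⁻¹ * sS (1/64) ((2:ℝ) ^ k)⁻¹ x y) := by
  have hn := norm_nonneg x
  obtain ⟨k, hk1, hk2⟩ := exists_nat_pow_near (one_le_inv_iff₀.2 ⟨hσ, hσ1.le⟩) (one_lt_two (α := ℝ))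
  have hk0 : (0:ℝ) < 2 ^ k := by positivity
  rw [pow_succ] at hk2
  refine ⟨k, ?_, ?_⟩
  · have : σ⁻¹ ≤ 2 * (1 + ‖x‖) := by rw [inv_le_iff_one_le_mul₀ hσ]; linarith
    linarith
  set τ := ((2:ℝ) ^ k)⁻¹ with hτ
  have hτ0 : 0 < τ := by positivity
  have h1 : σ ≤ τ := by rw [hτ, le_inv_comm₀ hσ hk0]; exact hk1
  have h2 : τ ≤ 2 * σ := by
    rw [hτ, inv_le_iff_one_le_mul₀ hk0]
    rw [inv_lt_iff_one_lt_mul₀ hσ] at hk2; linarith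
  have hp : 1 ≤ τ / σ := by rw [le_div_iff₀ hσ]; linarith
  have hp2 : τ / σ ≤ 2 := by rw [div_le_iff₀ hσ]; linarith
  have e1 := vV_inv_scale a x σ (τ / σ) hx hσ hp
  rw [div_mul_cancel₀ _ hσ.ne'] at e1
  have hv := vV_pos a x τ (fun i => (hx i).le) hτ0
  have hvs := vV_pos a x σ (fun i => (hx i).le) hσ
  have e2 : (vV a x σ)⁻¹ ≤ 2 ^ nN a * (vV a x τ)⁻¹ := by
    refine e1.trans ?_
    gcongr
    exact nN_nonneg a
  have hs1 : σ ^ 2 < 1 := by nlinarith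
  set u : ℝ := (1 - σ ^ 2) / (1 + σ ^ 2) with hu
  have hu0 : 0 ≤ u := by apply div_nonneg; linarith; positivity
  rw [← mul_assoc, ← ENNReal.ofReal_mul (p := 2 ^ nN a) (by positivity), ENNReal.ofReal_mul (p := (vV a x σ)⁻¹) (by positivity)]
  refine mul_le_mul' (ENNReal.ofReal_le_ofReal e2) ?_
  refine le_trans ?_ (le_iSup _ (Real.toNNReal u))
  apply ENNReal.ofReal_le_ofReal
  apply Real.exp_le_exp.2
  rw [Real.coe_toNNReal u hu0, neg_le_neg_iff]
  have e3 := sSum_ge (σ ^ 2) x y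
  have e4 : (1 + σ ^ 2) • x - (1 - σ ^ 2) • y = (1 + σ ^ 2) • (x - u • y) := by
    rw [smul_sub, smul_smul, hu, mul_div_cancel₀]; positivity
  rw [e4, norm_smul, Real.norm_eq_abs, abs_of_pos (by positivity), mul_pow] at e3
  set N := ‖x - u • y‖ ^ 2
  have hN : 0 ≤ N := sq_nonneg _
  have e5 : N ≤ sSum (σ ^ 2) x y := by
    refine le_trans ?_ e3
    nlinarith [sq_nonneg σ, mul_nonneg (sq_nonneg σ) hN, mul_nonneg (sq_nonneg (σ^2)) hN]
  calc 1 / 64 * N / τ ^ 2 ≤ N / (8 * σ ^ 2) := by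
        rw [div_le_div_iff₀ (by positivity) (by positivity)]
        have : σ ^ 2 ≤ τ ^ 2 := by gcongr
        nlinarith [mul_le_mul_of_nonneg_left this hN, mul_nonneg hN (sq_nonneg τ)]
    _ ≤ _ := by gcongr

lemma caseB_exp {d : ℕ} (x y : Fin d → ℝ) (σ : ℝ) (hσ : 0 < σ)
    (h : 2 * σ * (1 + ‖x‖) < 1) :
    Real.exp (-(sSum (σ ^ 2) x y / (8 * σ ^ 2))) ≤
      Real.exp (1 / 8) * Real.exp (-(‖x - y‖ ^ 2 / (32 * σ ^ 2))) := by
  have hn := norm_nonneg x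
  rw [← Real.exp_add]
  apply Real.exp_le_exp.2
  set D := ‖x - y‖ with hD
  have hD0 : 0 ≤ D := norm_nonneg _
  have e3 := sSum_ge (σ ^ 2) x y
  set Z := ‖(1 + σ ^ 2) • x - (1 - σ ^ 2) • y‖ with hZ
  have hZ0 : 0 ≤ Z := norm_nonneg _
  have hσn : σ * ‖x‖ ≤ 1 / 2 := by nlinarith
  have hσ2 : σ ≤ 1 / 2 := by nlinarith [mul_nonneg hσ.le hn]
  have hs : σ ^ 2 ≤ 1 / 4 := by nlinarith
  have e1 : (1 - σ ^ 2) * D ≤ Z + 2 * σ ^ 2 * ‖x‖ := by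
    have e : (1 - σ ^ 2) • (x - y) = ((1 + σ ^ 2) • x - (1 - σ ^ 2) • y) - (2 * σ ^ 2) • x := by
      module
    have := norm_sub_le ((1 + σ ^ 2) • x - (1 - σ ^ 2) • y) ((2 * σ ^ 2) • x)
    rw [← e, norm_smul, norm_smul, Real.norm_eq_abs, Real.norm_eq_abs, abs_of_pos (by linarith),
      abs_of_pos (by positivity)] at this
    exact this
  have e2 : 3 / 4 * D - σ ≤ Z := by nlinarith [mul_le_mul_of_nonneg_right hs hD0]
  have e4 : D ^ 2 / 4 - σ ^ 2 ≤ Z ^ 2 := by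
    by_cases hc : 3 / 4 * D ≤ σ
    · nlinarith [sq_nonneg Z]
    · push Not at hc
      have : (3 / 4 * D - σ) ^ 2 ≤ Z ^ 2 := pow_le_pow_left₀ (by linarith) e2 2
      nlinarith [sq_nonneg (5 / 4 * D - 3 * σ), sq_nonneg σ, sq_nonneg (D - 12/5 * σ)]
  have e5 : D ^ 2 / 4 - σ ^ 2 ≤ sSum (σ ^ 2) x y := e4.trans e3
  have : (D ^ 2 / 4 - σ ^ 2) / (8 * σ ^ 2) ≤ sSum (σ ^ 2) x y / (8 * σ ^ 2) := by gcongr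
  have e6 : (D ^ 2 / 4 - σ ^ 2) / (8 * σ ^ 2) = D ^ 2 / (32 * σ ^ 2) - 1 / 8 := by
    field_simp; ring
  linarith

lemma caseTail {d : ℕ} (a x y : Fin d → ℝ) (hx : ∀ i, 0 < x i) (σ : ℝ) (hσ : 0 < σ)
    (h : 2 * σ * (1 + ‖x‖) < 1) (h' : 1 < 2 * ‖x - y‖ * (1 + ‖x‖)) (Cp : ℝ)
    (hCp : ∀ p : ℝ, 1 ≤ p → p ^ nN a * Real.exp (-(1 / 256 * p ^ 2)) ≤ Cp) :
    ∃ k : ℕ, (2:ℝ) ^ k ≤ 4 * (1 + ‖x‖) ∧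
      ENNReal.ofReal ((vV a x σ)⁻¹ * Real.exp (-(sSum (σ ^ 2) x y / (8 * σ ^ 2)))) ≤
        ENNReal.ofReal (Real.exp (1 / 8) * Cp) * (ENNReal.ofReal (vV a x ((2:ℝ) ^ k)⁻¹)⁻¹ * sS (1/64) ((2:ℝ) ^ k)⁻¹ x y) := by
  have hn := norm_nonneg x
  have hB := caseB_exp x y σ hσ h
  obtain ⟨k, hk1, hk2⟩ := exists_nat_pow_near (show (1:ℝ) ≤ 2 * (1 + ‖x‖) by linarith) (one_lt_two (α := ℝ))
  have hk0 : (0:ℝ) < 2 ^ k := by positivity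
  rw [pow_succ] at hk2
  refine ⟨k, by linarith, ?_⟩
  set τ := ((2:ℝ) ^ k)⁻¹ with hτ
  have hτ0 : 0 < τ := by positivity
  have hkτ : (2:ℝ) ^ k * τ = 1 := mul_inv_cancel₀ hk0.ne'
  set D := ‖x - y‖ with hD
  have hD0 : 0 ≤ D := norm_nonneg _
  set R := 1 + ‖x‖ with hR
  have hR0 : 1 ≤ R := by linarith
  have h1 : σ ≤ τ := by
    have : σ * 2 ^ k < 1 := by nlinarith
    rw [hτ, ← one_div, le_div_iff₀ hk0]; linarith
  have h2 : τ ≤ 2 * D := by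
    have : 1 < 2 * D * 2 ^ k := by nlinarith
    rw [hτ, ← one_div, div_le_iff₀ hk0]; linarith
  have hp : 1 ≤ τ / σ := by rw [le_div_iff₀ hσ]; linarith
  have e1 := vV_inv_scale a x σ (τ / σ) hx hσ hp
  rw [div_mul_cancel₀ _ hσ.ne'] at e1
  have hv := vV_pos a x τ (fun i => (hx i).le) hτ0
  have hvs := vV_pos a x σ (fun i => (hx i).le) hσ
  have hCp0 : 0 ≤ Cp := le_trans (by positivity) (hCp 1 le_rfl)
  have hcp := hCp (τ / σ) hp
  have e3 : Real.exp (-(D ^ 2 / (32 * σ ^ 2))) ≤ Real.exp (-(1 / 256 * (τ / σ) ^ 2)) * Real.exp (-(1 / 64 * D ^ 2 / τ ^ 2)) := by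
    rw [← Real.exp_add]
    apply Real.exp_le_exp.2
    have f1 : 1 / 256 * (τ / σ) ^ 2 ≤ D ^ 2 / (64 * σ ^ 2) := by
      rw [div_pow, ← mul_div_assoc, div_le_div_iff₀ (by positivity) (by positivity)]
      have : τ ^ 2 ≤ (2 * D) ^ 2 := by gcongr
      nlinarith [mul_le_mul_of_nonneg_right this (sq_nonneg σ)]
    have f2 : 1 / 64 * D ^ 2 / τ ^ 2 ≤ D ^ 2 / (64 * σ ^ 2) := by
      rw [div_le_div_iff₀ (by positivity) (by positivity)]
      have : σ ^ 2 ≤ τ ^ 2 := by gcongr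
      nlinarith [mul_le_mul_of_nonneg_right this (sq_nonneg D)]
    have f3 : D ^ 2 / (32 * σ ^ 2) = D ^ 2 / (64 * σ ^ 2) + D ^ 2 / (64 * σ ^ 2) := by
      field_simp; ring
    linarith
  have e4 : ENNReal.ofReal (Real.exp (-(1 / 64 * D ^ 2 / τ ^ 2))) ≤ sS (1/64) τ x y := by
    refine le_trans (le_of_eq ?_) (le_iSup _ 1)
    simp [hD]
  calc _ ≤ ENNReal.ofReal (Real.exp (1 / 8) * Cp * ((vV a x τ)⁻¹ * Real.exp (-(1 / 64 * D ^ 2 / τ ^ 2)))) := by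
        apply ENNReal.ofReal_le_ofReal
        calc _ ≤ ((τ / σ) ^ nN a * (vV a x τ)⁻¹) * (Real.exp (1 / 8) * (Real.exp (-(1 / 256 * (τ / σ) ^ 2)) * Real.exp (-(1 / 64 * D ^ 2 / τ ^ 2)))) := by
              gcongr
              exact hB.trans (by gcongr)
          _ = Real.exp (1 / 8) * ((τ / σ) ^ nN a * Real.exp (-(1 / 256 * (τ / σ) ^ 2))) * ((vV a x τ)⁻¹ * Real.exp (-(1 / 64 * D ^ 2 / τ ^ 2))) := by ring
          _ ≤ _ := by gcongr
    _ ≤ _ := by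
        rw [ENNReal.ofReal_mul (by positivity), ENNReal.ofReal_mul (q := Real.exp (-(1 / 64 * D ^ 2 / τ ^ 2))) (by positivity)]
        gcongr

lemma caseLoc {d : ℕ} (a x y : Fin d → ℝ) (hx : ∀ i, 0 < x i) (σ : ℝ) (hσ : 0 < σ)
    (h : 2 * σ * (1 + ‖x‖) < 1) (h' : 2 * ‖x - y‖ * (1 + ‖x‖) ≤ 1) (Cq : ℝ)
    (hCq : ∀ p : ℝ, 1 ≤ p → p ^ (nN a + 1) * Real.exp (-(1 / 128 * p ^ 2)) ≤ Cq) :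
    ∃ m : ℕ, (2:ℝ) ^ m * σ * (1 + ‖x‖) ≤ 1 ∧ ‖x - y‖ ≤ 2 ^ m * σ ∧
      (vV a x σ)⁻¹ * Real.exp (-(sSum (σ ^ 2) x y / (8 * σ ^ 2))) ≤
        Real.exp 1 * Cq * (1 / 2) ^ m * (vV a x (2 ^ m * σ))⁻¹ := by
  have hn := norm_nonneg x
  have hB := caseB_exp x y σ hσ h
  set D := ‖x - y‖ with hD
  have hD0 : 0 ≤ D := norm_nonneg _
  have hm : ∃ m : ℕ, (2:ℝ) ^ m * σ * (1 + ‖x‖) ≤ 1 ∧ D ≤ 2 ^ m * σ ∧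
      1 / 128 * ((2:ℝ) ^ m) ^ 2 ≤ D ^ 2 / (32 * σ ^ 2) + 1 / 128 := by
    by_cases hc : D ≤ σ
    · refine ⟨0, ?_, ?_, ?_⟩
      · nlinarith
      · simpa using hc
      · have : 0 ≤ D ^ 2 / (32 * σ ^ 2) := by positivity
        norm_num; linarith
    · push Not at hc
      have h1 : 1 ≤ D / σ := by rw [le_div_iff₀ hσ]; linarith
      obtain ⟨n, hn1, hn2⟩ := exists_nat_pow_near h1 (one_lt_two (α := ℝ))
      have hn1' := hn1
      rw [le_div_iff₀ hσ] at hn1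
      rw [div_lt_iff₀ hσ] at hn2
      refine ⟨n + 1, ?_, hn2.le, ?_⟩
      · rw [pow_succ]; nlinarith
      · have : ((2:ℝ) ^ n) ^ 2 ≤ (D / σ) ^ 2 := by gcongr
        have e : D ^ 2 / (32 * σ ^ 2) = 1 / 32 * (D / σ) ^ 2 := by field_simp
        rw [e, pow_succ 2 n, mul_pow]; linarith
  obtain ⟨m, hm1, hm2, hm3⟩ := hm
  refine ⟨m, hm1, hm2, ?_⟩
  have hp : (1:ℝ) ≤ 2 ^ m := one_le_pow₀ (by norm_num)
  have e1 := vV_inv_scale a x σ (2 ^ m) hx hσ hp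
  have hv := vV_pos a x (2 ^ m * σ) (fun i => (hx i).le) (by positivity)
  have hvs := vV_pos a x σ (fun i => (hx i).le) hσ
  have hcq := hCq (2 ^ m) hp
  rw [Real.rpow_add (by positivity), Real.rpow_one] at hcq
  have e2 : ((2:ℝ) ^ m) ^ nN a * Real.exp (-(1 / 128 * ((2:ℝ) ^ m) ^ 2)) ≤ Cq * (1 / 2) ^ m := by
    rw [one_div_pow, ← div_eq_mul_one_div, le_div_iff₀ (by positivity)]; linarith
  have e3 : Real.exp (-(sSum (σ ^ 2) x y / (8 * σ ^ 2))) ≤ Real.exp 1 * Real.exp (-(1 / 128 * ((2:ℝ) ^ m) ^ 2)) := by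
    refine hB.trans ?_
    rw [← Real.exp_add, ← Real.exp_add]
    apply Real.exp_le_exp.2; linarith
  calc _ ≤ (((2:ℝ) ^ m) ^ nN a * (vV a x (2 ^ m * σ))⁻¹) * (Real.exp 1 * Real.exp (-(1 / 128 * ((2:ℝ) ^ m) ^ 2))) := by
        gcongr
    _ = Real.exp 1 * (((2:ℝ) ^ m) ^ nN a * Real.exp (-(1 / 128 * ((2:ℝ) ^ m) ^ 2))) * (vV a x (2 ^ m * σ))⁻¹ := by ring
    _ ≤ Real.exp 1 * (Cq * (1 / 2) ^ m) * (vV a x (2 ^ m * σ))⁻¹ := by gcongr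
    _ = _ := by ring

end helpers


section helpers
open scoped ENNReal NNReal

lemma pointwise {d : ℕ} (a : Fin d → ℝ) :
    ∃ C1 : ℝ, 0 < C1 ∧ ∀ (x y : Fin d → ℝ) (σ : ℝ), (∀ i, 0 < x i) → 0 < σ → σ < 1 →
      ENNReal.ofReal ((vV a x σ)⁻¹ * Real.exp (-(sSum (σ ^ 2) x y / (8 * σ ^ 2)))) ≤
        ENNReal.ofReal C1 * (∑' k : ℕ, if (2:ℝ) ^ k ≤ 4 * (1 + ‖x‖) then
          ENNReal.ofReal (vV a x ((2:ℝ) ^ k)⁻¹)⁻¹ * sS (1/64) ((2:ℝ) ^ k)⁻¹ x y else 0) +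
        ENNReal.ofReal C1 * (∑' m : ℕ, (if (2:ℝ) ^ m * σ * (1 + ‖x‖) ≤ 1 then
          ENNReal.ofReal ((1 / 2) ^ m * (vV a x (2 ^ m * σ))⁻¹) else 0) *
            (Metric.closedBall x (2 ^ m * σ)).indicator 1 y) := by
  obtain ⟨Cp, hCp0, hCp⟩ := pow_exp_bound (nN a) (1 / 256) (by norm_num)
  obtain ⟨Cq, hCq0, hCq⟩ := pow_exp_bound (nN a + 1) (1 / 128) (by norm_num)
  refine ⟨2 ^ nN a + Real.exp (1 / 8) * Cp + Real.exp 1 * Cq, by positivity, fun x y σ hx hσ hσ1 => ?_⟩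
  set C1 := 2 ^ nN a + Real.exp (1 / 8) * Cp + Real.exp 1 * Cq with hC1
  have p1 : 0 < (2:ℝ) ^ nN a := by positivity
  have p2 : 0 < Real.exp (1 / 8) * Cp := by positivity
  have p3 : 0 < Real.exp 1 * Cq := by positivity
  by_cases hA : 1 ≤ 2 * σ * (1 + ‖x‖)
  · obtain ⟨k, hk, hb⟩ := caseA a x y hx σ hσ hσ1 hA
    refine (hb.trans ?_).trans le_self_add
    refine mul_le_mul' (ENNReal.ofReal_le_ofReal (by linarith)) ?_
    refine le_trans (le_of_eq ?_) (ENNReal.le_tsum k)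
    rw [if_pos hk]
  push Not at hA
  by_cases hT : 1 < 2 * ‖x - y‖ * (1 + ‖x‖)
  · obtain ⟨k, hk, hb⟩ := caseTail a x y hx σ hσ hA hT Cp hCp
    refine (hb.trans ?_).trans le_self_add
    refine mul_le_mul' (ENNReal.ofReal_le_ofReal (by linarith)) ?_
    refine le_trans (le_of_eq ?_) (ENNReal.le_tsum k)
    rw [if_pos hk]
  push Not at hT
  obtain ⟨m, hm1, hm2, hm3⟩ := caseLoc a x y hx σ hσ hA hT Cq hCq
  refine le_trans ?_ le_add_self
  refine (ENNReal.ofReal_le_ofReal hm3).trans ?_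
  rw [mul_assoc, ENNReal.ofReal_mul (p := Real.exp 1 * Cq) (by positivity)]
  refine mul_le_mul' (ENNReal.ofReal_le_ofReal (by linarith)) ?_
  refine le_trans (le_of_eq ?_) (ENNReal.le_tsum m)
  rw [if_pos hm1, Set.indicator_of_mem]
  · simp
  · rw [mem_closedBall_iff_norm, norm_sub_rev]; exact hm2

lemma main_lemma {d : ℕ} (hd : 1 ≤ d) (a : Fin d → ℝ) (ha : ∀ i, -1 < a i) :
    ∃ C : ℝ≥0∞, C < ∞ ∧ ∀ (g : (Fin d → ℝ) → ℝ≥0∞), Measurable g →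
      nM a {x | (∀ i, 0 < x i) ∧ ∃ σ : ℝ, 0 < σ ∧ σ < 1 ∧
        1 < ENNReal.ofReal (Real.exp (qQ x)) *
          ∫⁻ y, ENNReal.ofReal ((vV a x σ)⁻¹ * Real.exp (-(sSum (σ ^ 2) x y / (8 * σ ^ 2)))) *
            (g y * wW a y)} ≤ C * ∫⁻ y, g y * wW a y := by
  obtain ⟨C1, hC10, hpt⟩ := pointwise a
  obtain ⟨CG, hCG, hG⟩ := global_lemma hd a ha (2 * C1) (by positivity)
  obtain ⟨CL, hCL, hL⟩ := local_lemma a ha (1 / (4 * C1)) (by positivity)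
  refine ⟨CG + CL, ENNReal.add_lt_top.2 ⟨hCG, hCL⟩, fun g hg => ?_⟩
  rw [add_mul]
  refine le_trans ((measure_mono ?_).trans (measure_union_le _ _)) (add_le_add (hG g hg) (hL g hg))
  rintro x ⟨hx, σ, hσ, hσ1, hint⟩
  by_contra hcon
  rw [Set.mem_union, not_or] at hcon
  obtain ⟨hc1, hc2⟩ := hcon
  simp only [Set.mem_ofPred_eq, not_and, not_lt, not_exists, not_le] at hc1 hc2
  have hc1 := hc1 hx
  have hc2 := hc2 hx
  apply absurd hint
  rw [not_lt]
  have mw := measurable_wW a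
  have mgw : Measurable fun y => g y * wW a y := hg.mul mw
  have msy : ∀ τ, Measurable fun y => sS (1/64) τ x y := fun τ => by
    have h := (measurable_sS (d := d) (1/64) τ).comp (measurable_prodMk_left (x := x))
    exact h
  -- the two pieces
  set A : ℝ≥0∞ := glob a (1/64) (4 * (1 + ‖x‖)) g x with hA
  set L : ℝ≥0∞ := ∑' m : ℕ, (if (2:ℝ) ^ m * σ * (1 + ‖x‖) ≤ 1 then
          ENNReal.ofReal ((1 / 2) ^ m * (vV a x (2 ^ m * σ))⁻¹) else 0) *
            ∫⁻ y in Metric.closedBall x (2 ^ m * σ), g y * wW a y with hLdef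
  have hsplit : ∫⁻ y, ENNReal.ofReal ((vV a x σ)⁻¹ * Real.exp (-(sSum (σ ^ 2) x y / (8 * σ ^ 2)))) *
            (g y * wW a y) ≤ ENNReal.ofReal C1 * A + ENNReal.ofReal C1 * L := by
    have m1 : ∀ k : ℕ, Measurable fun y => (if (2:ℝ) ^ k ≤ 4 * (1 + ‖x‖) then
          ENNReal.ofReal (vV a x ((2:ℝ) ^ k)⁻¹)⁻¹ * (sS (1/64) ((2:ℝ) ^ k)⁻¹ x y * (g y * wW a y)) else 0) := by
      intro k
      split_ifs
      · exact ((msy _).mul mgw).const_mul _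
      · exact measurable_const
    have m2 : ∀ m : ℕ, Measurable fun y => (if (2:ℝ) ^ m * σ * (1 + ‖x‖) ≤ 1 then
          ENNReal.ofReal ((1 / 2) ^ m * (vV a x (2 ^ m * σ))⁻¹) else 0) *
            (Metric.closedBall x (2 ^ m * σ)).indicator (fun y => g y * wW a y) y := by
      intro m
      exact (mgw.indicator Metric.isClosed_closedBall.measurableSet).const_mul _
    calc _ ≤ ∫⁻ y, (ENNReal.ofReal C1 * (∑' k : ℕ, if (2:ℝ) ^ k ≤ 4 * (1 + ‖x‖) then
          ENNReal.ofReal (vV a x ((2:ℝ) ^ k)⁻¹)⁻¹ * (sS (1/64) ((2:ℝ) ^ k)⁻¹ x y * (g y * wW a y)) else 0) +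
        ENNReal.ofReal C1 * (∑' m : ℕ, (if (2:ℝ) ^ m * σ * (1 + ‖x‖) ≤ 1 then
          ENNReal.ofReal ((1 / 2) ^ m * (vV a x (2 ^ m * σ))⁻¹) else 0) *
            (Metric.closedBall x (2 ^ m * σ)).indicator (fun y => g y * wW a y) y)) := by
          refine lintegral_mono fun y => ?_
          refine (mul_le_mul' (hpt x y σ hx hσ hσ1) le_rfl).trans (le_of_eq ?_)
          rw [add_mul, mul_assoc, mul_assoc, ← ENNReal.tsum_mul_right, ← ENNReal.tsum_mul_right]
          congr 3
          · ext k; split_ifs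
            · rw [mul_assoc]
            · rw [zero_mul]
          · ext m
            rw [mul_assoc]
            congr 1
            by_cases hy : y ∈ Metric.closedBall x (2 ^ m * σ)
            · rw [Set.indicator_of_mem hy, Set.indicator_of_mem hy]; simp
            · rw [Set.indicator_of_notMem hy, Set.indicator_of_notMem hy]; simp
      _ = _ := by
          rw [lintegral_add_left ((Measurable.ennreal_tsum m1).const_mul _),
            lintegral_const_mul _ (Measurable.ennreal_tsum m1),
            lintegral_const_mul _ (Measurable.ennreal_tsum m2),
            lintegral_tsum (fun k => (m1 k).aemeasurable), lintegral_tsum (fun k => (m2 k).aemeasurable)]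
          congr 3
          · ext k
            split_ifs
            · have mm : Measurable fun y => sS (1/64) ((2:ℝ) ^ k)⁻¹ x y * (g y * wW a y) := (msy _).mul mgw
              rw [lintegral_const_mul _ mm]
            · simp
          · ext m
            rw [lintegral_const_mul _ (mgw.indicator Metric.isClosed_closedBall.measurableSet),
              lintegral_indicator Metric.isClosed_closedBall.measurableSet]
  have hLb : ENNReal.ofReal (Real.exp (qQ x)) * (ENNReal.ofReal C1 * L) ≤ 2⁻¹ := by
    rw [hLdef, ← mul_assoc, ← ENNReal.tsum_mul_left]
    calc _ ≤ ∑' m : ℕ, (2⁻¹ : ℝ≥0∞) ^ (m + 2) := by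
          refine ENNReal.tsum_le_tsum fun m => ?_
          split_ifs with hm
          swap
          · simp
          have hv := vV_pos a x (2 ^ m * σ) (fun i => (hx i).le) (by positivity)
          have := (hc2 (2 ^ m * σ) (by positivity) hm).le
          calc _ ≤ ENNReal.ofReal (Real.exp (qQ x)) * ENNReal.ofReal C1 *
              (ENNReal.ofReal ((1 / 2) ^ m * (vV a x (2 ^ m * σ))⁻¹) *
                ENNReal.ofReal (1 / (4 * C1) * (Real.exp (-qQ x) * vV a x (2 ^ m * σ)))) := by gcongr
            _ = ENNReal.ofReal ((1 / 2) ^ (m + 2)) := by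
              rw [← ENNReal.ofReal_mul (by positivity), ← ENNReal.ofReal_mul (by positivity),
                ← ENNReal.ofReal_mul (by positivity)]
              congr 1
              rw [Real.exp_neg]
              have := Real.exp_pos (qQ x)
              field_simp
              ring
            _ = _ := by
              rw [ENNReal.ofReal_pow (by positivity)]
              congr 1
              rw [one_div, ENNReal.ofReal_inv_of_pos (by norm_num)]; simp
      _ = 2⁻¹ := by
          simp_rw [pow_add]
          rw [ENNReal.tsum_mul_right, ENNReal.tsum_geometric, ENNReal.one_sub_inv_two, inv_inv, pow_two,
            ← mul_assoc, ENNReal.mul_inv_cancel (by simp) (by simp), one_mul]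
  have hAb : ENNReal.ofReal (Real.exp (qQ x)) * (ENNReal.ofReal C1 * A) ≤ 2⁻¹ := by
    rw [ENNReal.ofReal_mul (by norm_num)] at hc1
    calc _ = 2⁻¹ * (2 * (ENNReal.ofReal (Real.exp (qQ x)) * (ENNReal.ofReal C1 * A))) := by
          rw [← mul_assoc 2⁻¹, ENNReal.inv_mul_cancel (by simp) (by simp), one_mul]
      _ = 2⁻¹ * (ENNReal.ofReal 2 * ENNReal.ofReal C1 * (ENNReal.ofReal (Real.exp (qQ x)) * A)) := by
          rw [show ENNReal.ofReal 2 = 2 by simp]; ring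
      _ ≤ 2⁻¹ * 1 := by gcongr
      _ = _ := mul_one _
  calc _ ≤ ENNReal.ofReal (Real.exp (qQ x)) * (ENNReal.ofReal C1 * A + ENNReal.ofReal C1 * L) := by gcongr
    _ ≤ 2⁻¹ + 2⁻¹ := by rw [mul_add]; exact add_le_add hAb hLb
    _ = 1 := ENNReal.inv_two_add_inv_two

end helpers


section helpers
open scoped ENNReal NNReal

lemma split_prod {M : Type*} [CommMonoid M] (d e k : ℕ) (h : e + k = d) (F : Fin d → M) :
    ∏ i, F i = (∏ i : Fin e, F ⟨i, by omega⟩) * ∏ i : Fin k, F ⟨e + i, by omega⟩ := by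
  subst h
  rw [Fin.prod_univ_add]
  rfl

lemma split_sum {M : Type*} [AddCommMonoid M] (d e k : ℕ) (h : e + k = d) (F : Fin d → M) :
    ∑ i, F i = (∑ i : Fin e, F ⟨i, by omega⟩) + ∑ i : Fin k, F ⟨e + i, by omega⟩ := by
  subst h
  rw [Fin.sum_univ_add]
  rfl

noncomputable def aA {d : ℕ} (e : ℕ) (α : Fin d → ℝ) (i : Fin d) : ℝ :=
  if (i : ℕ) < e then 0 else 2 * α i + 1

lemma coord_bound (α x y σ : ℝ) (hα : α ≤ -1) (hx : 0 < x) (hy : 0 < y) (hσ : 0 < σ) (h : y ≤ 2 * x) :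
    (x * y) ^ (-2 * α) * (x + σ) ^ (-(2 * (-α) + 1)) * y ^ (2 * α + 1) ≤ 2 := by
  have h1 : (x + σ) ^ (-(2 * (-α) + 1)) ≤ x ^ (-(2 * (-α) + 1)) :=
    Real.rpow_le_rpow_of_nonpos hx (by linarith) (by linarith)
  calc _ ≤ (x * y) ^ (-2 * α) * x ^ (-(2 * (-α) + 1)) * y ^ (2 * α + 1) := by gcongr
    _ = (x ^ (-2 * α) * x ^ (-(2 * (-α) + 1))) * (y ^ (-2 * α) * y ^ (2 * α + 1)) := by
        rw [Real.mul_rpow hx.le hy.le]; ring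
    _ = x⁻¹ * y := by
        rw [← Real.rpow_add hx, ← Real.rpow_add hy, show -2 * α + -(2 * -α + 1) = -1 by ring,
          show -2 * α + (2 * α + 1) = 1 by ring, Real.rpow_neg_one, Real.rpow_one]
    _ ≤ 2 := by rw [inv_mul_le_iff₀ hx]; linarith

lemma s_pow (n : ℕ) (s : ℝ) (hs : 0 < s) : s ^ (-(n : ℝ) / 2) = ∏ _i : Fin n, (Real.sqrt s)⁻¹ := by
  rw [Finset.prod_const, Finset.card_univ, Fintype.card_fin, Real.sqrt_eq_rpow, ← Real.rpow_neg hs.le,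
    ← Real.rpow_natCast, ← Real.rpow_mul hs.le]
  congr 1; ring

lemma KK_bound (d e : ℕ) (hed : e ≤ d) (α : Fin d → ℝ)
    (hα : ∀ i : Fin d, ((i : ℕ) < e → α i ≤ -1) ∧ (e ≤ (i : ℕ) → -1 < α i))
    (s : ℝ) (hs : 0 < s) (hs1 : s < 1) (x y : Fin d → ℝ) (hx : ∀ i, 0 < x i) (hy : ∀ i, 0 < y i)
    (hxy : ∀ i : Fin d, (i : ℕ) < e → y i ≤ 2 * x i) :
    0 ≤ KK d e hed α s x y ∧
    KK d e hed α s x y * ∏ i, y i ^ (2 * α i + 1) ≤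
      2 ^ e * (Real.exp (qQ x) * ((vV (aA e α) x (Real.sqrt s))⁻¹ *
        Real.exp (-(sSum s x y / (8 * s))))) * ∏ i, y i ^ (aA e α i) := by
  have hk : e + (d - e) = d := by omega
  have hσ : 0 < Real.sqrt s := Real.sqrt_pos.2 hs
  set σ := Real.sqrt s with hσd
  unfold KK Kker
  rw [s_pow _ _ hs, s_pow _ _ hs, ← hσd]
  set x' : Fin e → ℝ := fun i => x (Fin.castLE hed i) with hx'
  set y' : Fin e → ℝ := fun i => y (Fin.castLE hed i) with hy'
  set α' : Fin e → ℝ := fun i => α (Fin.castLE hed i) with hα'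
  set x'' : Fin (d - e) → ℝ := fun i => x ⟨e + (i : ℕ), by omega⟩ with hx''
  set y'' : Fin (d - e) → ℝ := fun i => y ⟨e + (i : ℕ), by omega⟩ with hy''
  set α'' : Fin (d - e) → ℝ := fun i => α ⟨e + (i : ℕ), by omega⟩ with hα''
  have px' : ∀ i, 0 < x' i := fun i => hx _
  have py' : ∀ i, 0 < y' i := fun i => hy _
  have px'' : ∀ i, 0 < x'' i := fun i => hx _
  have py'' : ∀ i, 0 < y'' i := fun i => hy _
  have s1 : (1 - s) ^ (-2 * ∑ i, α' i) ≤ 1 := by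
    apply Real.rpow_le_one (by linarith) (by linarith)
    have : ∑ i, α' i ≤ 0 := Finset.sum_nonpos fun i _ => by
      have := (hα (Fin.castLE hed i)).1 (by simp)
      change α (Fin.castLE hed i) ≤ 0
      linarith
    linarith
  have s0 : 0 ≤ (1 - s) ^ (-2 * ∑ i, α' i) := by apply Real.rpow_nonneg; linarith
  have P1 : 0 ≤ ∏ i, (x' i * y' i) ^ (-2 * α' i) := Finset.prod_nonneg fun i _ => by
    have := px' i; have := py' i; positivity
  have P2 : 0 ≤ ∏ i, (x' i + σ) ^ (-(2 * (-α' i) + 1)) := Finset.prod_nonneg fun i _ => by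
    have := px' i; positivity
  have P3 : 0 ≤ ∏ i, (x'' i + σ) ^ (-(2 * α'' i + 1)) := Finset.prod_nonneg fun i _ => by
    have := px'' i; positivity
  have P4 : 0 ≤ ∏ _i : Fin e, σ⁻¹ := by positivity
  have P5 : 0 ≤ ∏ _i : Fin (d - e), σ⁻¹ := by positivity
  have P6 : 0 ≤ ∏ i, y'' i ^ (2 * α'' i + 1) := Finset.prod_nonneg fun i _ => by
    have := py'' i; positivity
  refine ⟨by positivity, ?_⟩
  have eq1 : ∏ i, y i ^ (2 * α i + 1) = (∏ i, y' i ^ (2 * α' i + 1)) * ∏ i, y'' i ^ (2 * α'' i + 1) :=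
    split_prod d e (d - e) hk (fun i => y i ^ (2 * α i + 1))
  have eq2 : ∏ i, y i ^ (aA e α i) = ∏ i, y'' i ^ (2 * α'' i + 1) := by
    rw [split_prod d e (d - e) hk (fun i => y i ^ (aA e α i))]
    simp [aA, hy'', hα'']
  have eq3 : (vV (aA e α) x σ)⁻¹ = (∏ _i : Fin e, σ⁻¹) * ((∏ _i : Fin (d - e), σ⁻¹) * ∏ i, (x'' i + σ) ^ (-(2 * α'' i + 1))) := by
    unfold vV
    rw [split_prod d e (d - e) hk, mul_inv, ← Finset.prod_inv_distrib, ← Finset.prod_inv_distrib, ← Finset.prod_mul_distrib]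
    congr 1
    · simp [aA]
    · refine Finset.prod_congr rfl fun i _ => ?_
      rw [Real.rpow_neg (by have := px'' i; positivity), mul_inv]
      simp [aA, hx'', hα'']
  have eq4 : Real.exp (qQ x) * Real.exp (-(sSum s x y / (8 * s))) =
      Real.exp ((∑ i, x' i ^ 2) - (∑ i, ((1 + s) * x' i - (1 - s) * y' i) ^ 2) / (8 * s)) *
      Real.exp ((∑ i, x'' i ^ 2) - (∑ i, ((1 + s) * x'' i - (1 - s) * y'' i) ^ 2) / (8 * s)) := by
    have e1 : qQ x = (∑ i, x' i ^ 2) + ∑ i, x'' i ^ 2 := split_sum d e (d - e) hk (fun i => x i ^ 2)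
    have e2 : sSum s x y = (∑ i, ((1 + s) * x' i - (1 - s) * y' i) ^ 2) + ∑ i, ((1 + s) * x'' i - (1 - s) * y'' i) ^ 2 :=
      split_sum d e (d - e) hk (fun i => ((1 + s) * x i - (1 - s) * y i) ^ 2)
    rw [e1, e2, ← Real.exp_add, ← Real.exp_add]
    congr 1; ring
  have key : (∏ i, (x' i * y' i) ^ (-2 * α' i)) * (∏ i, (x' i + σ) ^ (-(2 * (-α' i) + 1))) *
      (∏ i, y' i ^ (2 * α' i + 1)) ≤ 2 ^ e := by
    rw [← Finset.prod_mul_distrib, ← Finset.prod_mul_distrib]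
    calc _ ≤ ∏ _i : Fin e, (2:ℝ) := by
          refine Finset.prod_le_prod (fun i _ => ?_) (fun i _ => ?_)
          · have := px' i; have := py' i; positivity
          · exact coord_bound _ _ _ _ ((hα (Fin.castLE hed i)).1 (by simp)) (px' i) (py' i) hσ
              (hxy (Fin.castLE hed i) (by simp))
      _ = 2 ^ e := by simp
  rw [eq1, eq2]
  set E1 := Real.exp ((∑ i, x' i ^ 2) - (∑ i, ((1 + s) * x' i - (1 - s) * y' i) ^ 2) / (8 * s))
  set E2 := Real.exp ((∑ i, x'' i ^ 2) - (∑ i, ((1 + s) * x'' i - (1 - s) * y'' i) ^ 2) / (8 * s))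
  have pE1 : 0 < E1 := Real.exp_pos _
  have pE2 : 0 < E2 := Real.exp_pos _
  have P7 : 0 ≤ ∏ i, y' i ^ (2 * α' i + 1) := Finset.prod_nonneg fun i _ => by
    have := py' i; positivity
  calc _ = (1 - s) ^ (-2 * ∑ i, α' i) * ((∏ i, (x' i * y' i) ^ (-2 * α' i)) * (∏ i, (x' i + σ) ^ (-(2 * (-α' i) + 1))) *
      (∏ i, y' i ^ (2 * α' i + 1))) * ((E1 * E2) * ((∏ _i : Fin e, σ⁻¹) * ((∏ _i : Fin (d - e), σ⁻¹) * ∏ i, (x'' i + σ) ^ (-(2 * α'' i + 1))))) *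
      ∏ i, y'' i ^ (2 * α'' i + 1) := by ring
    _ ≤ 1 * 2 ^ e * ((E1 * E2) * ((∏ _i : Fin e, σ⁻¹) * ((∏ _i : Fin (d - e), σ⁻¹) * ∏ i, (x'' i + σ) ^ (-(2 * α'' i + 1))))) *
      ∏ i, y'' i ^ (2 * α'' i + 1) := by gcongr
    _ = _ := by rw [← eq3, ← eq4]; ring

end helpers


section helpers
open scoped ENNReal NNReal

lemma wW_pos_eq {d : ℕ} (a x : Fin d → ℝ) (hx : ∀ i, 0 < x i) :
    wW a x = ENNReal.ofReal (∏ i, x i ^ a i) := by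
  unfold wW w1
  rw [ENNReal.ofReal_prod_of_nonneg fun i _ => (Real.rpow_pos_of_pos (hx i) _).le]
  exact Finset.prod_congr rfl fun i _ => by simp [hx i]

lemma measurableSet_orth {d : ℕ} : MeasurableSet {x : Fin d → ℝ | ∀ i, 0 < x i} := by
  have : {x : Fin d → ℝ | ∀ i, 0 < x i} = ⋂ i, {x | 0 < x i} := by ext; simp
  rw [this]
  exact MeasurableSet.iInter fun i => measurableSet_lt measurable_const (measurable_pi_apply i)

lemma nu_eq {d : ℕ} (α : Fin d → ℝ) : nu d α = nM (fun i => 2 * α i + 1) := by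
  unfold nu nM
  rw [restrict_withDensity measurableSet_orth, ← withDensity_indicator measurableSet_orth]
  congr 1
  funext x
  by_cases hx : ∀ i, 0 < x i
  · rw [Set.indicator_of_mem (show x ∈ {x : Fin d → ℝ | ∀ i, 0 < x i} from hx), wW_pos_eq _ _ hx, ENNReal.ofReal_mul
      (Finset.prod_nonneg fun i _ => (Real.rpow_pos_of_pos (hx i) _).le), mul_comm]
    rfl
  · rw [Set.indicator_of_notMem (show x ∉ {x : Fin d → ℝ | ∀ i, 0 < x i} from hx), wW_zero _ _ hx, mul_zero]

noncomputable def kF {d : ℕ} (e : ℕ) (x : Fin d → ℝ) (i : Fin d) : ℤ :=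
  if (i : ℕ) < e then ⌊Real.logb 2 (x i)⌋ else 0

lemma measurable_kF {d : ℕ} (e : ℕ) : Measurable (kF (d := d) e) := by
  refine measurable_pi_lambda _ fun i => ?_
  unfold kF
  split_ifs
  · exact ((Real.measurable_log.comp (measurable_pi_apply i)).div_const _).floor
  · exact measurable_const

noncomputable def cF {d : ℕ} (e : ℕ) (b : Fin d → ℝ) (k : Fin d → ℤ) (i : Fin d) : ℝ :=
  if (i : ℕ) < e then ((2:ℝ) ^ (k i : ℝ)) ^ b i else 1

lemma cF_pos {d : ℕ} (e : ℕ) (b : Fin d → ℝ) (k : Fin d → ℤ) (i : Fin d) : 0 < cF e b k i := by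
  unfold cF; split_ifs <;> positivity

lemma logb_near (x y : ℝ) (hx : 0 < x) (h1 : x / 2 ≤ y) (h2 : y ≤ 2 * x) :
    ⌊Real.logb 2 x⌋ - 1 ≤ ⌊Real.logb 2 y⌋ ∧ ⌊Real.logb 2 y⌋ ≤ ⌊Real.logb 2 x⌋ + 1 := by
  have hy : 0 < y := by linarith
  have e1 : Real.logb 2 y ≤ Real.logb 2 x + 1 := by
    calc _ ≤ Real.logb 2 (2 * x) := Real.logb_le_logb_of_le (by norm_num) hy h2
      _ = _ := by rw [Real.logb_mul (by norm_num) hx.ne', Real.logb_self_eq_one (by norm_num)]; ring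
  have e2 : Real.logb 2 x ≤ Real.logb 2 y + 1 := by
    calc _ ≤ Real.logb 2 (2 * y) := Real.logb_le_logb_of_le (by norm_num) hx (by linarith)
      _ = _ := by rw [Real.logb_mul (by norm_num) hy.ne', Real.logb_self_eq_one (by norm_num)]; ring
  constructor
  · rw [sub_le_iff_le_add, ← Int.floor_add_one]
    exact Int.floor_le_floor e2
  · rw [← Int.floor_add_one]
    exact Int.floor_le_floor e1

lemma cF_up {d : ℕ} (e : ℕ) (α : Fin d → ℝ) (hα : ∀ i : Fin d, (i : ℕ) < e → α i ≤ -1)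
    (x : Fin d → ℝ) (hx : ∀ i, 0 < x i) :
    wW (fun i => 2 * α i + 1) x ≤
      ENNReal.ofReal (∏ i, cF e (fun i => 2 * α i + 1) (kF e x) i) * wW (aA e α) x := by
  rw [wW_pos_eq _ _ hx, wW_pos_eq _ _ hx, ← ENNReal.ofReal_mul (Finset.prod_nonneg fun i _ => (cF_pos _ _ _ i).le),
    ← Finset.prod_mul_distrib]
  refine ENNReal.ofReal_le_ofReal (Finset.prod_le_prod (fun i _ => (Real.rpow_pos_of_pos (hx i) _).le) fun i _ => ?_)
  unfold cF aA kF
  split_ifs with h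
  · rw [Real.rpow_zero, mul_one]
    refine Real.rpow_le_rpow_of_nonpos (by positivity) ?_ (by linarith [hα i h])
    rw [← Real.le_logb_iff_rpow_le (by norm_num) (hx i)]
    exact Int.floor_le _
  · simp

lemma cF_down {d : ℕ} (e : ℕ) (α : Fin d → ℝ) (hα : ∀ i : Fin d, (i : ℕ) < e → α i ≤ -1)
    (y : Fin d → ℝ) (k : Fin d → ℤ) (hk : kF e y ∈ Finset.Icc (k - 1) (k + 1)) :
      ENNReal.ofReal (∏ i, cF e (fun i => 2 * α i + 1) k i) * wW (aA e α) y ≤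
      ENNReal.ofReal (∏ i, (4:ℝ) ^ |2 * α i + 1|) * wW (fun i => 2 * α i + 1) y := by
  by_cases hy : ∀ i, 0 < y i
  swap
  · simp [wW_zero _ y hy]
  rw [wW_pos_eq _ _ hy, wW_pos_eq _ _ hy, ← ENNReal.ofReal_mul (Finset.prod_nonneg fun i _ => (cF_pos _ _ _ i).le),
    ← Finset.prod_mul_distrib, ← ENNReal.ofReal_mul (Finset.prod_nonneg fun i _ => by positivity),
    ← Finset.prod_mul_distrib]
  refine ENNReal.ofReal_le_ofReal (Finset.prod_le_prod (fun i _ => mul_nonneg (cF_pos _ _ _ i).le (Real.rpow_pos_of_pos (hy i) _).le) fun i _ => ?_)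
  rw [Finset.mem_Icc] at hk
  have hk2 := hk.2 i
  unfold cF aA
  unfold kF at hk2
  have hyi := hy i
  split_ifs with h
  · simp only [h, if_true, Pi.add_apply, Pi.one_apply] at hk2
    rw [Real.rpow_zero, mul_one, abs_of_neg (by linarith [hα i h])]
    have e1 : y i ≤ 4 * 2 ^ (k i : ℝ) := by
      have : Real.logb 2 (y i) ≤ 2 + k i := by
        have h1 := Int.lt_floor_add_one (Real.logb 2 (y i))
        have h2 : ((⌊Real.logb 2 (y i)⌋ : ℤ) : ℝ) ≤ ((k i + 1 : ℤ) : ℝ) := by exact_mod_cast hk2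
        push_cast at h2
        linarith
      rw [Real.logb_le_iff_le_rpow (by norm_num) hyi, Real.rpow_add (by norm_num)] at this
      rw [show ((2:ℝ) ^ (2:ℝ)) = 4 by norm_num] at this; exact this
    have e2 := Real.rpow_le_rpow_of_nonpos hyi e1 (show 2 * α i + 1 ≤ 0 by linarith [hα i h])
    rw [Real.mul_rpow (by norm_num) (by positivity)] at e2
    rw [Real.rpow_neg (by norm_num), le_inv_mul_iff₀ (by positivity)]
    exact e2
  · rw [one_mul]
    exact le_mul_of_one_le_left (Real.rpow_pos_of_pos hyi _).le (Real.one_le_rpow (by norm_num) (abs_nonneg _))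

lemma kint_bound (d e : ℕ) (hed : e ≤ d) (α : Fin d → ℝ)
    (hα : ∀ i : Fin d, ((i : ℕ) < e → α i ≤ -1) ∧ (e ≤ (i : ℕ) → -1 < α i))
    (F : (Fin d → ℝ) → ℝ≥0∞) (s : ℝ) (hs : 0 < s) (hs1 : s < 1) (x : Fin d → ℝ) (hx : ∀ i, 0 < x i) :
    ∫⁻ y in {y : Fin d → ℝ | ∀ i : Fin d, (i : ℕ) < e → x i / 2 ≤ y i ∧ y i ≤ 2 * x i},
      ENNReal.ofReal (KK d e hed α s x y) * F y ∂(nu d α) ≤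
    ENNReal.ofReal (Real.exp (qQ x)) * ∫⁻ y, ENNReal.ofReal ((vV (aA e α) x (Real.sqrt s))⁻¹ *
        Real.exp (-(sSum (Real.sqrt s ^ 2) x y / (8 * Real.sqrt s ^ 2)))) *
      ((2 ^ e * (ENNReal.ofReal (Real.exp (-qQ y)) * F y) *
        {y : Fin d → ℝ | kF e y ∈ Finset.Icc (kF e x - 1) (kF e x + 1)}.indicator 1 y) * wW (aA e α) y) := by
  have hS : MeasurableSet {y : Fin d → ℝ | ∀ i : Fin d, (i : ℕ) < e → x i / 2 ≤ y i ∧ y i ≤ 2 * x i} := by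
    have : {y : Fin d → ℝ | ∀ i : Fin d, (i : ℕ) < e → x i / 2 ≤ y i ∧ y i ≤ 2 * x i} =
      ⋂ i : Fin d, ⋂ _ : (i : ℕ) < e, {y | x i / 2 ≤ y i ∧ y i ≤ 2 * x i} := by ext; simp
    rw [this]
    refine MeasurableSet.iInter fun i => MeasurableSet.iInter fun _ => MeasurableSet.inter ?_ ?_
    · exact measurableSet_le measurable_const (measurable_pi_apply i)
    · exact measurableSet_le (measurable_pi_apply i) measurable_const
  rw [Real.sq_sqrt hs.le, nu_eq, nM, restrict_withDensity hS]
  have mw := measurable_wW (fun i => 2 * α i + 1)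
  have mq := measurable_qQ (d := d)
  have md : Measurable fun x => ENNReal.ofReal (Real.exp (-qQ x)) * wW (fun i => 2 * α i + 1) x := by
    fun_prop
  refine (lintegral_withDensity_le_lintegral_mul _ md _).trans ?_
  rw [← lintegral_const_mul' _ _ ENNReal.ofReal_ne_top, ← lintegral_indicator hS]
  refine lintegral_mono fun y => ?_
  rw [Set.indicator_apply]
  split_ifs with hyS
  swap
  · exact zero_le
  rw [Set.mem_ofPred_eq] at hyS
  simp only [Pi.mul_apply]
  by_cases hy : ∀ i, 0 < y i
  swap
  · simp [wW_zero _ y hy]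
  have hmem : y ∈ {y : Fin d → ℝ | kF e y ∈ Finset.Icc (kF e x - 1) (kF e x + 1)} := by
    rw [Set.mem_ofPred_eq, Finset.mem_Icc]
    have key : ∀ i, (kF e x - 1) i ≤ kF e y i ∧ kF e y i ≤ (kF e x + 1) i := by
      intro i
      simp only [Pi.sub_apply, Pi.add_apply, Pi.one_apply, kF]
      split_ifs with h
      · exact logb_near _ _ (hx i) (hyS i h).1 (hyS i h).2
      · simp
    exact ⟨fun i => (key i).1, fun i => (key i).2⟩
  rw [Set.indicator_of_mem hmem, Pi.one_apply, mul_one]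
  obtain ⟨h0, hb⟩ := KK_bound d e hed α hα s hs hs1 x y hx hy fun i hi => (hyS i hi).2
  have hb' := ENNReal.ofReal_le_ofReal hb
  have hv := vV_pos (aA e α) x (Real.sqrt s) (fun i => (hx i).le) (Real.sqrt_pos.2 hs)
  rw [ENNReal.ofReal_mul h0, ENNReal.ofReal_mul (by positivity), ENNReal.ofReal_mul (by positivity),
    ENNReal.ofReal_mul (by positivity), ← wW_pos_eq _ _ hy, ← wW_pos_eq _ _ hy,
    ENNReal.ofReal_pow (by norm_num), ENNReal.ofReal_ofNat] at hb'
  calc _ = (ENNReal.ofReal (KK d e hed α s x y) * wW (fun i => 2 * α i + 1) y) *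
        (ENNReal.ofReal (Real.exp (-qQ y)) * F y) := by ring
    _ ≤ _ * (ENNReal.ofReal (Real.exp (-qQ y)) * F y) := mul_le_mul' hb' le_rfl
    _ = _ := by ring

lemma red1 (d e : ℕ) (hd : 1 ≤ d) (hed : e ≤ d) (α : Fin d → ℝ)
    (hα : ∀ i : Fin d, ((i : ℕ) < e → α i ≤ -1) ∧ (e ≤ (i : ℕ) → -1 < α i)) :
    ∃ C : ℝ≥0∞, C < ∞ ∧ ∀ F : (Fin d → ℝ) → ℝ≥0∞, Measurable F →
      nu d α {x | 1 < ⨆ s ∈ Set.Ioo (0 : ℝ) 1,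
            ∫⁻ y in {y : Fin d → ℝ | ∀ i : Fin d, (i : ℕ) < e →
                x i / 2 ≤ y i ∧ y i ≤ 2 * x i},
              ENNReal.ofReal (KK d e hed α s x y) * F y ∂(nu d α)} ≤ C * ∫⁻ y, F y ∂(nu d α) := by
  have ha : ∀ i, -1 < aA e α i := by
    intro i; unfold aA; split_ifs with h
    · norm_num
    · have := (hα i).2 (by omega); linarith
  obtain ⟨C, hC, hmain⟩ := main_lemma hd (aA e α) ha
  set b : Fin d → ℝ := fun i => 2 * α i + 1 with hbdef
  set B : ℝ≥0∞ := ENNReal.ofReal (∏ i, (4:ℝ) ^ |2 * α i + 1|) with hB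
  have hα1 : ∀ i : Fin d, (i : ℕ) < e → α i ≤ -1 := fun i => (hα i).1
  have mw := measurable_wW b
  have mwa := measurable_wW (aA e α)
  have mq := measurable_qQ (d := d)
  have mk := measurable_kF (d := d) e
  refine ⟨C * B * 2 ^ e * 3 ^ d, ?_, fun F hF => ?_⟩
  · refine ENNReal.mul_lt_top (ENNReal.mul_lt_top (ENNReal.mul_lt_top hC ENNReal.ofReal_lt_top) ?_) ?_
    · exact ENNReal.pow_lt_top (by simp)
    · exact ENNReal.pow_lt_top (by simp)
  set E := {x | 1 < ⨆ s ∈ Set.Ioo (0 : ℝ) 1,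
            ∫⁻ y in {y : Fin d → ℝ | ∀ i : Fin d, (i : ℕ) < e →
                x i / 2 ≤ y i ∧ y i ≤ 2 * x i},
              ENNReal.ofReal (KK d e hed α s x y) * F y ∂(nu d α)} with hE
  let T : (Fin d → ℤ) → Set (Fin d → ℝ) := fun k => {y | kF e y ∈ Finset.Icc (k - 1) (k + 1)}
  have hT : ∀ k, MeasurableSet (T k) := fun k => mk (Finset.measurableSet (Finset.Icc (k - 1) (k + 1)))
  let g : (Fin d → ℤ) → (Fin d → ℝ) → ℝ≥0∞ := fun k y =>
    2 ^ e * (ENNReal.ofReal (Real.exp (-qQ y)) * F y) * (T k).indicator 1 y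
  have mI : ∀ k, Measurable ((T k).indicator (1 : (Fin d → ℝ) → ℝ≥0∞)) := fun k => measurable_one.indicator (hT k)
  have mg : ∀ k, Measurable (g k) := fun k => by
    have := mI k
    have h1 : Measurable fun y : Fin d → ℝ => 2 ^ e * (ENNReal.ofReal (Real.exp (-qQ y)) * F y) := by fun_prop
    exact h1.mul this
  let M : (Fin d → ℤ) → Set (Fin d → ℝ) := fun k =>
    {x | (∀ i, 0 < x i) ∧ ∃ σ, 0 < σ ∧ σ < 1 ∧ 1 < ENNReal.ofReal (Real.exp (qQ x)) *
      ∫⁻ y, ENNReal.ofReal ((vV (aA e α) x σ)⁻¹ * Real.exp (-(sSum (σ^2) x y/(8*σ^2)))) * (g k y * wW (aA e α) y)}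
  have hM : ∀ k, nM (aA e α) (M k) ≤ C * ∫⁻ y, g k y * wW (aA e α) y := fun k => hmain _ (mg k)
  let c : (Fin d → ℤ) → ℝ≥0∞ := fun k => ENNReal.ofReal (∏ i, cF e b k i)
  let L : (Fin d → ℤ) → Set (Fin d → ℝ) := fun k => {x | (∀ i, 0 < x i) ∧ kF e x = k}
  have hL : ∀ k, MeasurableSet (L k) := fun k =>
    measurableSet_orth.inter (mk (measurableSet_singleton k))
  have hsub : ∀ k, E ∩ L k ⊆ M k := by
    rintro k x ⟨hxE, hx, hxk⟩
    refine ⟨hx, ?_⟩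
    rw [hE, Set.mem_ofPred_eq, lt_iSup_iff] at hxE
    obtain ⟨s, hs⟩ := hxE
    rw [lt_iSup_iff] at hs
    obtain ⟨hs, hlt⟩ := hs
    refine ⟨Real.sqrt s, Real.sqrt_pos.2 hs.1, ?_, ?_⟩
    · rw [Real.sqrt_lt' one_pos]; simpa using hs.2
    · have h := hlt.trans_le (kint_bound d e hed α hα F s hs.1 hs.2 x hx)
      rw [hxk] at h
      exact h
  have hcov : nu d α E ≤ ∑' k, nu d α (E ∩ L k) := by
    have h1 : nu d α E = nu d α (E ∩ {x | ∀ i, 0 < x i}) := by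
      unfold nu
      rw [Measure.restrict_apply' measurableSet_orth, Measure.restrict_apply' measurableSet_orth,
        Set.inter_assoc, Set.inter_self]
    rw [h1]
    refine (measure_mono ?_).trans (measure_iUnion_le _)
    rintro x ⟨hxE, hx⟩
    exact Set.mem_iUnion.2 ⟨kF e x, hxE, hx, rfl⟩
  have hk1 : ∀ k, nu d α (E ∩ L k) ≤ c k * nM (aA e α) (M k) := by
    intro k
    have h2 : nu d α (E ∩ L k) ≤ c k * nM (aA e α) (E ∩ L k) := by
      have h3 : (nu d α).restrict (L k) ≤ c k • (nM (aA e α)).restrict (L k) := by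
        refine Measure.le_iff.2 fun A hA => ?_
        rw [Measure.smul_apply, Measure.restrict_apply hA, Measure.restrict_apply hA, nu_eq, nM, nM,
          withDensity_apply _ (hA.inter (hL k)), withDensity_apply _ (hA.inter (hL k)), smul_eq_mul,
          ← lintegral_const_mul' _ _ ENNReal.ofReal_ne_top]
        refine setLIntegral_mono' (hA.inter (hL k)) fun x hx => ?_
        have h := cF_up e α hα1 x hx.2.1
        rw [hx.2.2] at h
        calc _ ≤ ENNReal.ofReal (Real.exp (-qQ x)) * (c k * wW (aA e α) x) := mul_le_mul' le_rfl h
          _ = _ := by ring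
      have h4 := h3 (E ∩ L k)
      rwa [Measure.smul_apply, Measure.restrict_apply' (hL k), Measure.restrict_apply' (hL k),
        Set.inter_assoc, Set.inter_self, smul_eq_mul] at h4
    exact h2.trans (mul_le_mul' le_rfl (measure_mono (hsub k)))
  let ρ : (Fin d → ℝ) → ℝ≥0∞ := fun y => ENNReal.ofReal (Real.exp (-qQ y)) * wW b y
  have mρ : Measurable ρ := by
    change Measurable fun y => ENNReal.ofReal (Real.exp (-qQ y)) * wW b y
    fun_prop
  have hk2 : ∀ k, c k * ∫⁻ y, g k y * wW (aA e α) y ≤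
      B * 2 ^ e * ∫⁻ y, (ρ y * F y) * (T k).indicator 1 y := by
    intro k
    rw [← lintegral_const_mul' _ _ ENNReal.ofReal_ne_top, ← lintegral_const_mul' _ _ (by
      exact (ENNReal.mul_lt_top ENNReal.ofReal_lt_top (ENNReal.pow_lt_top (by simp))).ne)]
    refine lintegral_mono fun y => ?_
    by_cases hy : y ∈ T k
    · simp only [g, ρ, Set.indicator_of_mem hy, Pi.one_apply, mul_one]
      calc _ = (c k * wW (aA e α) y) * (2 ^ e * (ENNReal.ofReal (Real.exp (-qQ y)) * F y)) := by ring
        _ ≤ (B * wW b y) * (2 ^ e * (ENNReal.ofReal (Real.exp (-qQ y)) * F y)) :=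
          mul_le_mul' (cF_down e α hα1 y k hy) le_rfl
        _ = _ := by ring
    · simp [g, Set.indicator_of_notMem hy]
  have hcount : ∀ y, ∑' k, (T k).indicator (1 : (Fin d → ℝ) → ℝ≥0∞) y = 3 ^ d := by
    intro y
    have h1 : ∀ k, (T k).indicator (1 : (Fin d → ℝ) → ℝ≥0∞) y =
        if k ∈ Finset.Icc (kF e y - 1) (kF e y + 1) then 1 else 0 := by
      intro k
      rw [Set.indicator_apply]
      refine if_congr ?_ rfl rfl
      change kF e y ∈ Finset.Icc (k - 1) (k + 1) ↔ _
      rw [Finset.mem_Icc, Finset.mem_Icc, sub_le_iff_le_add, sub_le_iff_le_add, and_comm]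
    simp_rw [h1]
    rw [tsum_eq_sum (s := Finset.Icc (kF e y - 1) (kF e y + 1)) (fun k hk => by simp [hk]),
      Finset.sum_congr rfl (g := fun _ => (1:ℝ≥0∞)) (fun k hk => by rw [if_pos hk]), Finset.sum_const, Pi.card_Icc]
    simp only [Pi.sub_apply, Pi.add_apply, Pi.one_apply, Int.card_Icc]
    rw [Finset.prod_congr rfl (g := fun _ => 3) (fun i _ => by omega)]
    simp
  calc nu d α E ≤ ∑' k, nu d α (E ∩ L k) := hcov
    _ ≤ ∑' k, C * (B * 2 ^ e * ∫⁻ y, (ρ y * F y) * (T k).indicator 1 y) := by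
        refine ENNReal.tsum_le_tsum fun k => ?_
        calc _ ≤ _ := hk1 k
          _ ≤ c k * (C * ∫⁻ y, g k y * wW (aA e α) y) := mul_le_mul' le_rfl (hM k)
          _ = C * (c k * ∫⁻ y, g k y * wW (aA e α) y) := by ring
          _ ≤ _ := mul_le_mul' le_rfl (hk2 k)
    _ = C * (B * 2 ^ e * ∫⁻ y, ∑' k, (ρ y * F y) * (T k).indicator 1 y) := by
        rw [ENNReal.tsum_mul_left, ENNReal.tsum_mul_left, lintegral_tsum]
        intro k
        exact ((mρ.mul hF).mul (mI k)).aemeasurable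
    _ = C * (B * 2 ^ e * ∫⁻ y, (ρ y * F y) * 3 ^ d) := by
        simp_rw [ENNReal.tsum_mul_left, hcount]
    _ = _ := by
        have mm : Measurable fun y => ρ y * F y := mρ.mul hF
        rw [lintegral_mul_const _ mm, nu_eq, nM, lintegral_withDensity_eq_lintegral_mul _ mρ hF]
        simp only [Pi.mul_apply]
        ring

end helpers

/-- For `d ≥ 1`, `1 ≤ e ≤ d` and `α ∈ (−∞,−1]^e × (−1,∞)^{d−e}`, the
maximal operator
`𝕂_{*,1}^α f(x) = sup_{0<s<1} ∫ χ_{{x_i/2 ≤ y_i ≤ 2x_i, i=1,…,e}} 𝕂_s^α(x,y) f(y) dν_α(y)`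
is of weak type `(1,1)` with respect to `ν_α`. -/
theorem stmt10 (d e : ℕ) (hd : 1 ≤ d) (he : 1 ≤ e) (hed : e ≤ d) (α : Fin d → ℝ)
    (hα : ∀ i : Fin d, ((i : ℕ) < e → α i ≤ -1) ∧ (e ≤ (i : ℕ) → -1 < α i)) :
    ∃ C : ℝ, 0 < C ∧ ∀ f : (Fin d → ℝ) → ℝ, (∀ x, 0 ≤ f x) →
      Integrable f (nu d α) → ∀ lam : ℝ, 0 < lam →
      nu d α {x | ENNReal.ofReal lam <
          ⨆ s ∈ Set.Ioo (0 : ℝ) 1,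
            ∫⁻ y in {y : Fin d → ℝ | ∀ i : Fin d, (i : ℕ) < e →
                x i / 2 ≤ y i ∧ y i ≤ 2 * x i},
              ENNReal.ofReal (KK d e hed α s x y * f y) ∂(nu d α)} ≤
        ENNReal.ofReal (C / lam * ∫ x, f x ∂(nu d α)) := by
  obtain ⟨C, hC, h⟩ := red1 d e hd hed α hα
  refine ⟨C.toReal + 1, by positivity, fun f hf0 hf lam hlam => ?_⟩
  set f' := hf.1.mk f with hf'
  have mf' : Measurable f' := hf.1.stronglyMeasurable_mk.measurable
  have hae : f =ᵐ[nu d α] f' := hf.1.ae_eq_mk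
  set l : ENNReal := ENNReal.ofReal lam with hl
  have hl0 : l ≠ 0 := by simp [hl, hlam]
  have hlt : l ≠ ⊤ := ENNReal.ofReal_ne_top
  have hlin : l⁻¹ ≠ ⊤ := ENNReal.inv_ne_top.2 hl0
  have mF : Measurable fun y => l⁻¹ * ENNReal.ofReal (f' y) := by fun_prop
  have hm := h _ mF
  have hset : {x | l < ⨆ s ∈ Set.Ioo (0 : ℝ) 1,
            ∫⁻ y in {y : Fin d → ℝ | ∀ i : Fin d, (i : ℕ) < e →
                x i / 2 ≤ y i ∧ y i ≤ 2 * x i},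
              ENNReal.ofReal (KK d e hed α s x y * f y) ∂(nu d α)} =
      {x | 1 < ⨆ s ∈ Set.Ioo (0 : ℝ) 1,
            ∫⁻ y in {y : Fin d → ℝ | ∀ i : Fin d, (i : ℕ) < e →
                x i / 2 ≤ y i ∧ y i ≤ 2 * x i},
              ENNReal.ofReal (KK d e hed α s x y) * (l⁻¹ * ENNReal.ofReal (f' y)) ∂(nu d α)} := by
    ext x
    rw [Set.mem_ofPred_eq, Set.mem_ofPred_eq]
    have h1 : ∀ s, ∫⁻ y in {y : Fin d → ℝ | ∀ i : Fin d, (i : ℕ) < e →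
                x i / 2 ≤ y i ∧ y i ≤ 2 * x i},
              ENNReal.ofReal (KK d e hed α s x y) * (l⁻¹ * ENNReal.ofReal (f' y)) ∂(nu d α) =
        l⁻¹ * ∫⁻ y in {y : Fin d → ℝ | ∀ i : Fin d, (i : ℕ) < e →
                x i / 2 ≤ y i ∧ y i ≤ 2 * x i},
              ENNReal.ofReal (KK d e hed α s x y * f y) ∂(nu d α) := by
      intro s
      rw [← lintegral_const_mul' _ _ hlin]
      refine lintegral_congr_ae (ae_restrict_of_ae ?_)
      filter_upwards [hae] with y hy
      rw [ENNReal.ofReal_mul' (hf0 y), hy]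
      ring
    simp_rw [h1, ← ENNReal.mul_iSup]
    rw [mul_comm, ← div_eq_mul_inv, ENNReal.lt_div_iff_mul_lt (Or.inl hl0) (Or.inl hlt), one_mul]
  rw [hset]
  refine hm.trans ?_
  have h2 : ∫⁻ y, l⁻¹ * ENNReal.ofReal (f' y) ∂(nu d α) = l⁻¹ * ENNReal.ofReal (∫ y, f y ∂(nu d α)) := by
    rw [lintegral_const_mul' _ _ hlin, ofReal_integral_eq_lintegral_ofReal hf (Filter.Eventually.of_forall hf0)]
    congr 1
    refine lintegral_congr_ae ?_
    filter_upwards [hae] with y hy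
    rw [hy]
  rw [h2, ENNReal.ofReal_mul (by positivity), div_eq_mul_inv, ENNReal.ofReal_mul (by positivity),
    ENNReal.ofReal_inv_of_pos hlam, mul_assoc]
  refine mul_le_mul' ?_ le_rfl
  calc C = ENNReal.ofReal C.toReal := (ENNReal.ofReal_toReal hC.ne).symm
    _ ≤ _ := ENNReal.ofReal_le_ofReal (by linarith)
end

section
/- Let d ≥ 1, 1 ≤ e ≤ d and α ∈ (−∞,−1]^e × (−1,∞)^{d−e}. Define, for measurable f ≥ 0, 𝕂_{*,2}^α f(x) = χ_{[1,∞)^d}(x) ∫_{(0,∞)^d} [ sup_{1/4<s<1} 𝕂_s^α(x,y) ] f(y) dν_α(y). Then there is a constant C such that ν_α{x ∈ (0,∞)^d : 𝕂_{*,2}^α f(x) > λ} ≤ (C/λ) ∫_{(0,∞)^d} f dν_α for every λ > 0 and every 0 ≤ f ∈ L¹(dν_α). -/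
open MeasureTheory

lemma gauss_absorb (β b : ℝ) (hβ : 0 ≤ β) (hb : 0 < b) :
    ∃ C : ℝ, 0 < C ∧ ∀ v : ℝ, 0 ≤ v → (1 + v) ^ β * Real.exp (-b * v ^ 2) ≤ C := by
  refine ⟨Real.exp (β ^ 2 / (4 * b)), Real.exp_pos _, fun v hv => ?_⟩
  have h1 : (1 + v) ^ β ≤ Real.exp (β * v) := by
    rw [Real.rpow_def_of_pos (by linarith)]
    apply Real.exp_le_exp.2
    have := Real.log_le_sub_one_of_pos (show 0 < 1 + v by linarith)
    nlinarith
  calc _ ≤ Real.exp (β * v) * Real.exp (-b * v ^ 2) := by gcongr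
    _ = Real.exp (β * v + -b * v ^ 2) := by rw [Real.exp_add]
    _ ≤ _ := by
      apply Real.exp_le_exp.2
      rw [le_div_iff₀ (by positivity)]
      nlinarith [sq_nonneg (β - 2 * b * v)]

lemma coordA (a : ℝ) (ha : a ≤ -1) : ∃ C : ℝ, 0 < C ∧ ∀ x y s : ℝ, 1 ≤ x → 0 < y →
    1 / 4 < s → s < 1 →
    (1 - s) ^ (-2 * a) * (x * y) ^ (-2 * a) * (x + √s) ^ (-(2 * -a + 1)) *
      Real.exp (-((1 + s) * x - (1 - s) * y) ^ 2 / 8) ≤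
    C * (x ^ (-(2 * a + 1)) * Real.exp (-((1 + s) * x - (1 - s) * y) ^ 2 / 16)) := by
  obtain ⟨C, hC, h⟩ := gauss_absorb (-2 * a) (1 / 16) (by linarith) (by norm_num)
  refine ⟨2 ^ (-2 * a) * C, by positivity, fun x y s hx hy hs1 hs2 => ?_⟩
  set u := (1 + s) * x - (1 - s) * y with hu
  have hx0 : 0 < x := by linarith
  have h1 : (1 - s) * y ≤ 2 * x * (1 + |u|) := by
    have : -u ≤ |u| := neg_le_abs u
    have : (0:ℝ) ≤ |u| := abs_nonneg u
    nlinarith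
  have h2 : (1 - s) ^ (-2 * a) * (x * y) ^ (-2 * a) ≤ x ^ (-2 * a) * (2 ^ (-2 * a) * x ^ (-2 * a) * (1 + |u|) ^ (-2 * a)) := by
    rw [← Real.mul_rpow (by linarith) (by positivity), ← Real.mul_rpow (by norm_num) (by positivity),
      ← Real.mul_rpow (by positivity) (by positivity), ← Real.mul_rpow (by positivity) (by positivity)]
    apply Real.rpow_le_rpow
    · have : 0 < 1 - s := by linarith
      positivity
    · nlinarith
    · linarith
  have h3 : (x + √s) ^ (-(2 * -a + 1)) ≤ x ^ (-(2 * -a + 1)) := by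
    apply Real.rpow_le_rpow_of_nonpos hx0
    · linarith [Real.sqrt_nonneg s]
    · linarith
  have h4 := h |u| (abs_nonneg u)
  rw [sq_abs] at h4
  have h5 : Real.exp (-u ^ 2 / 8) = Real.exp (-(1/16) * u ^ 2) * Real.exp (-u ^ 2 / 16) := by
    rw [← Real.exp_add]; congr 1; ring
  have h6 : x ^ (-(2 * a + 1)) = x ^ (-2 * a) * x ^ (-2 * a) * x ^ (-(2 * -a + 1)) := by
    rw [← Real.rpow_add hx0, ← Real.rpow_add hx0]; congr 1; ring
  rw [h5, h6]
  calc _ ≤ (x ^ (-2 * a) * (2 ^ (-2 * a) * x ^ (-2 * a) * (1 + |u|) ^ (-2 * a))) * x ^ (-(2 * -a + 1)) * (Real.exp (-(1/16) * u ^ 2) * Real.exp (-u ^ 2 / 16)) := by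
        gcongr
    _ = 2 ^ (-2 * a) * (x ^ (-2 * a) * x ^ (-2 * a) * x ^ (-(2 * -a + 1))) * Real.exp (-u ^ 2 / 16) * ((1 + |u|) ^ (-2 * a) * Real.exp (-(1/16) * u ^ 2)) := by ring
    _ ≤ 2 ^ (-2 * a) * (x ^ (-2 * a) * x ^ (-2 * a) * x ^ (-(2 * -a + 1))) * Real.exp (-u ^ 2 / 16) * C := by gcongr
    _ = _ := by ring

lemma coordB (a : ℝ) : ∃ C : ℝ, 0 < C ∧ ∀ x y s : ℝ, 1 ≤ x → 0 < y →
    1 / 4 < s → s < 1 →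
    (x + √s) ^ (-(2 * a + 1)) *
      Real.exp (-((1 + s) * x - (1 - s) * y) ^ 2 / 8) ≤
    C * (x ^ (-(2 * a + 1)) * Real.exp (-((1 + s) * x - (1 - s) * y) ^ 2 / 16)) := by
  refine ⟨2 ^ |-(2 * a + 1)|, by positivity, fun x y s hx hy hs1 hs2 => ?_⟩
  set p := -(2 * a + 1)
  have hx0 : 0 < x := by linarith
  have hs : √s ≤ 1 := by exact Real.sqrt_le_one.2 hs2.le
  have hs0 := Real.sqrt_nonneg s
  rw [← mul_assoc]
  gcongr ?_ * ?_
  · have h1 : (x + √s) = x * (1 + √s / x) := by field_simp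
    have h3 : 0 ≤ √s / x := by positivity
    have h4 : √s / x ≤ 1 := by rw [div_le_one hx0]; linarith
    rw [h1, Real.mul_rpow hx0.le (by positivity), mul_comm]
    gcongr
    calc (1 + √s / x) ^ p ≤ (1 + √s / x) ^ |p| := Real.rpow_le_rpow_of_exponent_le (by linarith) (le_abs_self p)
      _ ≤ _ := Real.rpow_le_rpow (by linarith) (by linarith) (abs_nonneg _)
  · apply Real.exp_le_exp.2
    nlinarith [sq_nonneg ((1 + s) * x - (1 - s) * y)]

lemma prod_split {d e : ℕ} (hed : e ≤ d) (f : Fin d → ℝ) :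
    (∏ i : Fin e, f (Fin.castLE hed i)) *
      ∏ i : Fin (d - e), f ⟨e + (i : ℕ), by have h := i.isLt; omega⟩ = ∏ i, f i := by
  have key : ∀ m (hm : d = e + m), (∏ i : Fin e, f (Fin.castLE hed i)) *
      ∏ i : Fin m, f ⟨e + (i : ℕ), by have h := i.isLt; omega⟩ = ∏ i, f i := by
    rintro m rfl
    rw [Fin.prod_univ_add]
    rfl
  exact key _ (by omega)

lemma ray (b : ℝ) : ∃ C : ENNReal, C ≠ ⊤ ∧ ∀ (P κ : ℝ) (A : ENNReal), 0 ≤ P → 1 ≤ κ →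
    ∫⁻ t in {t : ℝ | 1 ≤ t ∧ ENNReal.ofReal (P * t ^ b * Real.exp (-κ * t ^ 2)) ≤ A},
      ENNReal.ofReal (P * t ^ b * Real.exp (-κ * t ^ 2) * t) ≤ C * A := by
  obtain ⟨C, hC, h⟩ := gauss_absorb (2 * |b|) (1 / 2) (by positivity) (by norm_num)
  refine ⟨ENNReal.ofReal C, by simp, fun P κ A hP hκ => ?_⟩
  set h₀ : ℝ → ℝ := fun t => P * t ^ b * Real.exp (-κ * t ^ 2) with hh₀
  set S := {t : ℝ | 1 ≤ t ∧ ENNReal.ofReal (h₀ t) ≤ A} with hS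
  have hcont : ContinuousOn (fun t => ENNReal.ofReal (h₀ t)) (Set.Ici 1) := by
    apply ENNReal.continuous_ofReal.comp_continuousOn
    apply ContinuousOn.mul
    · apply ContinuousOn.mul continuousOn_const
      apply ContinuousOn.rpow_const continuousOn_id
      intro x hx; left; have : (1:ℝ) ≤ x := hx
      simp only [id]; linarith
    · fun_prop
  have hclosed : IsClosed S := by
    have := hcont.preimage_isClosed_of_isClosed isClosed_Ici (isClosed_Iic (a := A))
    exact this
  rcases S.eq_empty_or_nonempty with he | hne
  · rw [he]; simp
  have hbdd : BddBelow S := ⟨1, fun t ht => ht.1⟩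
  have hm := hclosed.csInf_mem hne hbdd
  set t0 := sInf S with ht0
  have hsub : S ⊆ Set.Ici t0 := fun t ht => csInf_le hbdd ht
  have ht1 : 1 ≤ t0 := hm.1
  have hbound : ∀ t, t0 ≤ t → h₀ t ≤ C * h₀ t0 * Real.exp (-(t ^ 2 - t0 ^ 2) / 2) := by
    intro t ht
    set u := t ^ 2 - t0 ^ 2 with hu
    have hu0 : 0 ≤ u := by nlinarith
    have e1 : (t / t0) ^ b ≤ (1 + √u) ^ (2 * |b|) := by
      have hle : 1 ≤ t / t0 := by rw [le_div_iff₀ (by linarith)]; linarith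
      have h2 : t / t0 ≤ (1 + √u) ^ (2:ℝ) := by
        rw [div_le_iff₀ (by linarith)]
        have := Real.sq_sqrt hu0
        have := Real.sqrt_nonneg u
        norm_cast
        nlinarith
      calc (t / t0) ^ b ≤ (t / t0) ^ |b| := Real.rpow_le_rpow_of_exponent_le hle (le_abs_self b)
        _ ≤ ((1 + √u) ^ (2:ℝ)) ^ |b| := Real.rpow_le_rpow (by linarith) h2 (abs_nonneg _)
        _ = _ := by rw [← Real.rpow_mul (by positivity)]
    have e2 := h (√u) (Real.sqrt_nonneg _)
    rw [Real.sq_sqrt hu0] at e2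
    have e3 : t ^ b = t0 ^ b * (t / t0) ^ b := by
      rw [← Real.mul_rpow (by linarith) (by apply div_nonneg <;> linarith)]
      congr 1
      field_simp
    have e4 : Real.exp (-κ * t ^ 2) ≤ Real.exp (-κ * t0 ^ 2) * (Real.exp (-(1/2) * u) * Real.exp (-u / 2)) := by
      rw [← Real.exp_add, ← Real.exp_add]
      apply Real.exp_le_exp.2
      nlinarith
    have ht0b : 0 ≤ t0 ^ b := Real.rpow_nonneg (by linarith) _
    calc h₀ t = P * (t0 ^ b * (t / t0) ^ b) * Real.exp (-κ * t ^ 2) := by rw [← e3]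
      _ ≤ P * (t0 ^ b * (1 + √u) ^ (2 * |b|)) * (Real.exp (-κ * t0 ^ 2) * (Real.exp (-(1/2) * u) * Real.exp (-u / 2))) := by
        gcongr
      _ = ((1 + √u) ^ (2 * |b|) * Real.exp (-(1/2) * u)) * h₀ t0 * Real.exp (-u / 2) := by
        simp only [hh₀]; ring
      _ ≤ _ := by
        have : 0 ≤ h₀ t0 := by simp only [hh₀]; positivity
        gcongr
  have hderiv : ∀ t ∈ Set.Ici t0, HasDerivAt (fun t : ℝ => -Real.exp (-(t ^ 2 - t0 ^ 2) / 2))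
      (Real.exp (-(t ^ 2 - t0 ^ 2) / 2) * t) t := by
    intro t _
    have := ((((hasDerivAt_pow 2 t).sub_const (t0 ^ 2)).neg.div_const 2).exp).neg
    refine this.congr_deriv ?_
    simp; ring
  have hlim : Filter.Tendsto (fun t : ℝ => -Real.exp (-(t ^ 2 - t0 ^ 2) / 2)) Filter.atTop (nhds 0) := by
    rw [← neg_zero]
    apply Filter.Tendsto.neg
    apply Real.tendsto_exp_atBot.comp
    apply Filter.Tendsto.atBot_div_const (by norm_num)
    apply Filter.tendsto_neg_atTop_atBot.comp
    apply Filter.tendsto_atTop_add_const_right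
    exact Filter.tendsto_pow_atTop (by norm_num)
  have hpos : ∀ t ∈ Set.Ioi t0, 0 ≤ Real.exp (-(t ^ 2 - t0 ^ 2) / 2) * t := by
    intro t ht
    have : t0 < t := ht
    have : 0 ≤ t := by linarith
    positivity
  have hint := integrableOn_Ioi_deriv_of_nonneg' hderiv hpos hlim
  have hval := integral_Ioi_of_hasDerivAt_of_nonneg' hderiv hpos hlim
  have hl : ∫⁻ t in Set.Ioi t0, ENNReal.ofReal (Real.exp (-(t ^ 2 - t0 ^ 2) / 2) * t) = 1 := by
    rw [← ofReal_integral_eq_lintegral_ofReal hint, hval]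
    · simp
    · filter_upwards [ae_restrict_mem measurableSet_Ioi] with t ht using hpos t ht
  have h00 : 0 ≤ h₀ t0 := by
    have ht0b : 0 ≤ t0 ^ b := Real.rpow_nonneg (by linarith) _
    simp only [hh₀]; positivity
  calc ∫⁻ t in S, ENNReal.ofReal (h₀ t * t) ≤ ∫⁻ t in Set.Ici t0, ENNReal.ofReal (h₀ t * t) :=
        lintegral_mono_set hsub
    _ = ∫⁻ t in Set.Ioi t0, ENNReal.ofReal (h₀ t * t) := by
        rw [Measure.restrict_congr_set Ioi_ae_eq_Ici]
    _ ≤ ∫⁻ t in Set.Ioi t0, ENNReal.ofReal (C * h₀ t0) * ENNReal.ofReal (Real.exp (-(t ^ 2 - t0 ^ 2) / 2) * t) := by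
        apply setLIntegral_mono' measurableSet_Ioi
        intro t ht
        have ht' : t0 < t := ht
        rw [← ENNReal.ofReal_mul (by positivity)]
        apply ENNReal.ofReal_le_ofReal
        rw [← mul_assoc]
        have := hbound t ht'.le
        gcongr
        linarith
    _ = ENNReal.ofReal (C * h₀ t0) := by
        rw [lintegral_const_mul' _ _ (by simp), hl, mul_one]
    _ ≤ _ := by
        rw [ENNReal.ofReal_mul hC.le]
        gcongr
        exact hm.2

noncomputable def phi (γ c : ℝ) (v : ℝ) : ENNReal :=
  if v = 0 then ⊤ else ENNReal.ofReal (|v| ^ (-γ) * Real.exp (-c * |v| ^ 2))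

lemma phi_meas (γ c : ℝ) : Measurable (phi γ c) := by
  unfold phi
  refine Measurable.ite (measurableSet_singleton 0) measurable_const ?_
  fun_prop

lemma phi_int (γ c : ℝ) (hγ : γ < 1) (hc : 0 < c) : ∫⁻ v, phi γ c v ≠ ⊤ := by
  have h1 : IntegrableOn (fun v : ℝ => |v| ^ (-γ) * Real.exp (-c * |v| ^ 2)) (Set.Ioi 0) := by
    refine (integrableOn_rpow_mul_exp_neg_mul_sq hc (s := -γ) (by linarith)).congr_fun ?_ measurableSet_Ioi
    intro v hv
    have : 0 < v := hv
    simp [abs_of_pos this]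
  have h2 : ∫⁻ v in Set.Ioi 0, phi γ c v ≠ ⊤ := by
    have : ∫⁻ v in Set.Ioi 0, phi γ c v = ∫⁻ v in Set.Ioi 0, ENNReal.ofReal (|v| ^ (-γ) * Real.exp (-c * |v| ^ 2)) := by
      apply setLIntegral_congr_fun measurableSet_Ioi
      intro v hv
      have : v ≠ 0 := ne_of_gt hv
      simp [phi, this]
    rw [this]
    exact h1.lintegral_lt_top.ne
  have h3 : ∫⁻ v in Set.Iio 0, phi γ c v = ∫⁻ v in Set.Ioi 0, phi γ c v := by
    have hp := (Measure.measurePreserving_neg (volume : Measure ℝ)).setLIntegral_comp_preimage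
      (measurableSet_Iio (a := (0:ℝ))) (phi_meas γ c)
    rw [← hp]
    simp [phi]
  rw [← lintegral_add_compl _ (measurableSet_Ioi (a := (0:ℝ))), Set.compl_Ioi,
    Measure.restrict_congr_set Iio_ae_eq_Iic.symm, h3]
  exact ENNReal.add_ne_top.2 ⟨h2, h2⟩

lemma phi_bound (γ c : ℝ) (hγ : 0 ≤ γ) (hc : 0 < c) : ∃ C : ℝ, 0 < C ∧ ∀ t v : ℝ, 1 ≤ t →
    ENNReal.ofReal (Real.exp (-c * (t * v) ^ 2)) ≤ ENNReal.ofReal (C * t ^ (-γ)) * phi γ (c / 2) v := by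
  obtain ⟨C, hC, h⟩ := gauss_absorb γ (c / 2) hγ (by linarith)
  refine ⟨C, hC, fun t v ht => ?_⟩
  have ht0 : 0 < t := by linarith
  unfold phi
  split_ifs with hv
  · rw [ENNReal.mul_top]
    · simp
    · have : 0 < C * t ^ (-γ) := by positivity
      simpa using this
  · rw [← ENNReal.ofReal_mul (by positivity)]
    apply ENNReal.ofReal_le_ofReal
    have hv0 : 0 < |v| := abs_pos.2 hv
    have e1 := h (t * |v|) (by positivity)
    have e2 : (t * |v|) ^ γ ≤ (1 + t * |v|) ^ γ := Real.rpow_le_rpow (by positivity) (by linarith) hγ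
    have e3 : Real.exp (-(c / 2) * (t * |v|) ^ 2) ≤ C * (t * |v|) ^ (-γ) := by
      rw [Real.rpow_neg (by positivity), ← div_eq_mul_inv, le_div_iff₀ (by positivity), mul_comm]
      refine le_trans ?_ e1
      gcongr
    have e4 : Real.exp (-c * (t * v) ^ 2) ≤ Real.exp (-(c / 2) * (t * |v|) ^ 2) * Real.exp (-(c / 2) * |v| ^ 2) := by
      rw [← Real.exp_add]
      apply Real.exp_le_exp.2
      rw [mul_pow, mul_pow, sq_abs]
      have : 1 ≤ t ^ 2 := by nlinarith
      have : v ^ 2 ≤ t ^ 2 * v ^ 2 := by nlinarith [sq_nonneg v]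
      nlinarith
    calc _ ≤ _ := e4
      _ ≤ C * (t * |v|) ^ (-γ) * Real.exp (-(c / 2) * |v| ^ 2) := by gcongr
      _ = _ := by rw [Real.mul_rpow ht0.le hv0.le]; ring

lemma slice {n : ℕ} (k : Fin (n + 1)) (G : (Fin (n + 1) → ℝ) → ENNReal) (hG : Measurable G) :
    ∫⁻ x, G x = ∫⁻ t : ℝ, ∫⁻ z : Fin n → ℝ, G (k.insertNth t z) := by
  have h := (volume_preserving_piFinSuccAbove (fun _ : Fin (n + 1) => ℝ) k).symm
  rw [← h.lintegral_comp hG, Measure.volume_eq_prod, lintegral_prod]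
  · rfl
  · exact (hG.comp (MeasurableEquiv.measurable _)).aemeasurable

lemma scale {n : ℕ} (H : (Fin n → ℝ) → ENNReal) (hH : Measurable H) (t : ℝ) (ht : 0 < t) :
    ∫⁻ z, H z = ENNReal.ofReal (t ^ n) * ∫⁻ z, H (t • z) := by
  have h := Measure.map_addHaar_smul (volume : Measure (Fin n → ℝ)) ht.ne'
  have h2 : ∫⁻ z, H (t • z) = ∫⁻ z, H z ∂(Measure.map (fun x => t • x) volume) := by
    rw [lintegral_map hH (by fun_prop)]
  rw [h2, h, lintegral_smul_measure, smul_eq_mul, ← mul_assoc, ← ENNReal.ofReal_mul (by positivity)]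
  have : t ^ n * |(t ^ Module.finrank ℝ (Fin n → ℝ))⁻¹| = 1 := by
    rw [abs_of_pos (by positivity)]
    simp
    field_simp
  rw [this]; simp

lemma lint_prod_s13 (n : ℕ) (F : Fin n → ℝ → ENNReal) (hF : ∀ j, Measurable (F j)) :
    ∫⁻ z : Fin n → ℝ, ∏ j, F j (z j) = ∏ j, ∫⁻ v, F j v := by
  induction n with
  | zero => simp [volume_pi]
  | succ n ih =>
    rw [slice 0 _ (by fun_prop)]
    simp only [Fin.prod_univ_succ]
    simp only [Fin.insertNth_zero, Fin.cons_zero, Fin.cons_succ]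
    have e : ∀ t : ℝ, ∫⁻ z : Fin n → ℝ, F 0 t * ∏ j, F j.succ (z j) = F 0 t * ∏ j : Fin n, ∫⁻ v, F j.succ v := by
      intro t
      rw [lintegral_const_mul _ (by fun_prop), ih _ (fun j => hF _)]
    exact (lintegral_congr e).trans (lintegral_mul_const _ (hF 0))

noncomputable def wt {d : ℕ} (α : Fin d → ℝ) (x : Fin d → ℝ) : ℝ :=
  (∏ i, x i ^ (2 * α i + 1)) * Real.exp (-∑ i, x i ^ 2)

lemma wt_meas {d : ℕ} (α : Fin d → ℝ) : Measurable (wt α) := by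
  unfold wt; fun_prop

lemma wt_pos {d : ℕ} (α : Fin d → ℝ) (x : Fin d → ℝ) (hx : ∀ i, 0 < x i) : 0 < wt α x := by
  unfold wt
  have : 0 < ∏ i, x i ^ (2 * α i + 1) := Finset.prod_pos fun i _ => Real.rpow_pos_of_pos (hx i) _
  positivity

lemma ins_meas {n : ℕ} (k : Fin (n + 1)) :
    Measurable (fun p : ℝ × (Fin n → ℝ) => (k.insertNth p.1 p.2 : Fin (n + 1) → ℝ)) :=
  (MeasurableEquiv.piFinSuccAbove (fun _ : Fin (n + 1) => ℝ) k).symm.measurable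

lemma wt_ins {n : ℕ} (k : Fin (n + 1)) (α : Fin (n + 1) → ℝ) (t : ℝ) (ζ : Fin n → ℝ)
    (ht : 0 < t) (hζ : ∀ j, 0 < ζ j) :
    wt α (k.insertNth t (t • ζ)) = |∏ j, ζ j ^ (2 * α (k.succAbove j) + 1)| *
      t ^ (∑ i, (2 * α i + 1)) * Real.exp (-(1 + ∑ j, ζ j ^ 2) * t ^ 2) := by
  have hp : 0 < ∏ j, ζ j ^ (2 * α (k.succAbove j) + 1) :=
    Finset.prod_pos fun i _ => Real.rpow_pos_of_pos (hζ i) _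
  rw [abs_of_pos hp]
  unfold wt
  rw [Real.rpow_sum_of_pos ht]
  simp only [Fin.prod_univ_succAbove _ k, Fin.sum_univ_succAbove _ k, Fin.insertNth_apply_same,
    Fin.insertNth_apply_succAbove, Pi.smul_apply, smul_eq_mul]
  have : ∀ j, (t * ζ j) ^ (2 * α (k.succAbove j) + 1) = t ^ (2 * α (k.succAbove j) + 1) * ζ j ^ (2 * α (k.succAbove j) + 1) :=
    fun j => Real.mul_rpow ht.le (hζ j).le
  simp only [this, Finset.prod_mul_distrib, mul_pow, ← Finset.mul_sum]
  have e : -(t ^ 2 + t ^ 2 * ∑ j, ζ j ^ 2) = -(1 + ∑ j, ζ j ^ 2) * t ^ 2 := by ring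
  rw [e]; ring

lemma core (n : ℕ) (k : Fin (n + 1)) (α : Fin (n + 1) → ℝ) (c : ℝ) (hc : 0 < c) :
    ∃ C : ENNReal, C ≠ ⊤ ∧ ∀ (μ : Measure (Fin (n + 1) → ℝ)) [SFinite μ]
      (g : (Fin (n + 1) → ℝ) → ENNReal) (η : (Fin (n + 1) → ℝ) → Fin n → ℝ),
      Measurable g → Measurable η →
      ∃ E' : Set (Fin (n + 1) → ℝ), MeasurableSet E' ∧
      {x | (∀ i, 1 ≤ x i) ∧ ENNReal.ofReal (wt α x) ≤
        ∫⁻ y, (∏ j, ENNReal.ofReal (Real.exp (-c * (x (k.succAbove j) - η y j * x k) ^ 2))) * g y ∂μ} ⊆ E' ∧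
      ∫⁻ x in E', ENNReal.ofReal (wt α x) ≤ C * ∫⁻ y, g y ∂μ := by
  set γ : ℝ := n / (n + 1) with hγ
  have hγ0 : 0 ≤ γ := by positivity
  have hγ1 : γ < 1 := by rw [hγ, div_lt_one (by positivity)]; linarith
  set q : ℝ := n * γ with hq
  have hnq : (n : ℝ) ≤ q + 1 := by
    rw [hq, hγ]; field_simp; nlinarith
  obtain ⟨C₀, hC₀, hphi⟩ := phi_bound γ c hγ0 hc
  obtain ⟨Cr, hCr, hray⟩ := ray (∑ i, (2 * α i + 1) + q)
  set I := ∫⁻ v, phi γ (c / 2) v with hI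
  have hItop : I ≠ ⊤ := phi_int γ (c / 2) hγ1 (by linarith)
  refine ⟨Cr * ENNReal.ofReal (C₀ ^ n) * I ^ n, ENNReal.mul_ne_top (ENNReal.mul_ne_top hCr (by simp)) (by simp [hItop]), ?_⟩
  intro μ _ g η hg hη
  have hphim := phi_meas γ (c / 2)
  have hηj : ∀ j, Measurable fun y => η y j := fun j => (measurable_pi_apply j).comp hη
  set Φ : (Fin n → ℝ) → (Fin (n + 1) → ℝ) → ENNReal := fun ζ y => (∏ j, phi γ (c / 2) (ζ j - η y j)) * g y with hΦ
  have hΦm : Measurable (Function.uncurry Φ) := by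
    have : ∀ j, Measurable fun p : (Fin n → ℝ) × (Fin (n + 1) → ℝ) => phi γ (c / 2) (p.1 j - η p.2 j) := by
      intro j
      apply hphim.comp
      have h1 : Measurable fun p : (Fin n → ℝ) × (Fin (n + 1) → ℝ) => η p.2 j := (hηj j).comp measurable_snd
      have h2 : Measurable fun p : (Fin n → ℝ) × (Fin (n + 1) → ℝ) => p.1 j :=
        (measurable_pi_apply j).comp measurable_fst
      exact h2.sub h1
    exact (Finset.measurable_fun_prod _ fun j _ => this j).mul (hg.comp measurable_snd)
  set m : (Fin n → ℝ) → ENNReal := fun ζ => ∫⁻ y, Φ ζ y ∂μ with hm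
  have hmm : Measurable m := hΦm.lintegral_prod_right'
  set Z : (Fin (n + 1) → ℝ) → (Fin n → ℝ) := fun x j => x (k.succAbove j) / x k with hZ
  have hZm : Measurable Z := by
    apply measurable_pi_lambda; intro j; fun_prop
  set E' : Set (Fin (n + 1) → ℝ) := {x | (∀ i, 1 ≤ x i) ∧
    ENNReal.ofReal (wt α x * x k ^ q) ≤ ENNReal.ofReal (C₀ ^ n) * m (Z x)} with hE'
  have hE'm : MeasurableSet E' := by
    have h1 : MeasurableSet {x : Fin (n + 1) → ℝ | ∀ i, 1 ≤ x i} := by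
      have : {x : Fin (n + 1) → ℝ | ∀ i, 1 ≤ x i} = ⋂ i, {x | 1 ≤ x i} := by ext; simp
      rw [this]
      exact MeasurableSet.iInter fun i => measurableSet_le measurable_const (measurable_pi_apply i)
    have h2 : MeasurableSet {x : Fin (n + 1) → ℝ | ENNReal.ofReal (wt α x * x k ^ q) ≤ ENNReal.ofReal (C₀ ^ n) * m (Z x)} := by
      apply measurableSet_le
      · have := wt_meas α
        fun_prop
      · exact (hmm.comp hZm).const_mul _
    exact h1.inter h2
  refine ⟨E', hE'm, ?_, ?_⟩
  · rintro x ⟨hx1, hx2⟩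
    refine ⟨hx1, ?_⟩
    have ht : 1 ≤ x k := hx1 k
    have ht0 : 0 < x k := by linarith
    have e1 : ∫⁻ y, (∏ j, ENNReal.ofReal (Real.exp (-c * (x (k.succAbove j) - η y j * x k) ^ 2))) * g y ∂μ
        ≤ ∫⁻ y, ENNReal.ofReal ((C₀ * x k ^ (-γ)) ^ n) * Φ (Z x) y ∂μ := by
      apply lintegral_mono
      intro y
      have : ∏ j, ENNReal.ofReal (Real.exp (-c * (x (k.succAbove j) - η y j * x k) ^ 2)) ≤
          ∏ j : Fin n, (ENNReal.ofReal (C₀ * x k ^ (-γ)) * phi γ (c / 2) (Z x j - η y j)) := by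
        apply Finset.prod_le_prod'
        intro j _
        have h := hphi (x k) (Z x j - η y j) ht
        have e : x k * (Z x j - η y j) = x (k.succAbove j) - η y j * x k := by
          simp only [hZ]; field_simp
        rwa [e] at h
      rw [Finset.prod_mul_distrib] at this
      simp only [Finset.prod_const, Finset.card_univ, Fintype.card_fin] at this
      rw [← ENNReal.ofReal_pow (by positivity)] at this
      simp only [hΦ]
      rw [← mul_assoc]
      gcongr
    rw [lintegral_const_mul' _ _ (by simp)] at e1
    have e2 : x k ^ q * (C₀ * x k ^ (-γ)) ^ n = C₀ ^ n := by
      rw [mul_pow, ← Real.rpow_mul_natCast ht0.le, mul_left_comm, ← Real.rpow_add ht0]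
      have : q + -γ * n = 0 := by rw [hq]; ring
      rw [this]; simp
    rw [mul_comm, ENNReal.ofReal_mul (by positivity), ← e2, ENNReal.ofReal_mul (by positivity), mul_assoc]
    gcongr
    exact hx2.trans e1
  · set G : (Fin (n + 1) → ℝ) → ENNReal := E'.indicator fun x => ENNReal.ofReal (wt α x) with hG
    have hGm : Measurable G := (wt_meas α).ennreal_ofReal.indicator hE'm
    rw [← lintegral_indicator hE'm, slice k G hGm]
    set P : (Fin n → ℝ) → ℝ := fun ζ => |∏ j, ζ j ^ (2 * α (k.succAbove j) + 1)| with hP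
    set κ : (Fin n → ℝ) → ℝ := fun ζ => 1 + ∑ j, ζ j ^ 2 with hκ
    set b := ∑ i, (2 * α i + 1) + q with hb
    set S : (Fin n → ℝ) → Set ℝ := fun ζ => {t : ℝ | 1 ≤ t ∧ ENNReal.ofReal (P ζ * t ^ b * Real.exp (-κ ζ * t ^ 2)) ≤ ENNReal.ofReal (C₀ ^ n) * m ζ} with hS
    have hSm : ∀ ζ, MeasurableSet (S ζ) := by
      intro ζ
      have h2 : MeasurableSet {t : ℝ | ENNReal.ofReal (P ζ * t ^ b * Real.exp (-κ ζ * t ^ 2)) ≤ ENNReal.ofReal (C₀ ^ n) * m ζ} := by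
        apply measurableSet_le _ measurable_const
        fun_prop
      exact measurableSet_Ici.inter h2
    have s1 : ∀ t : ℝ, ∫⁻ z : Fin n → ℝ, G (k.insertNth t z) =
        ∫⁻ ζ : Fin n → ℝ, (Set.Ici (1:ℝ)).indicator (fun t => ENNReal.ofReal (t ^ n) * G (k.insertNth t (t • ζ))) t := by
      intro t
      have hGt : Measurable fun z : Fin n → ℝ => G (k.insertNth t z) :=
        hGm.comp ((ins_meas k).comp (measurable_const.prodMk measurable_id))
      by_cases ht : 1 ≤ t
      · rw [scale _ hGt t (by linarith), ← lintegral_const_mul' _ _ (by simp)]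
        simp [Set.indicator, ht]
      · have : ∀ z : Fin n → ℝ, G (k.insertNth t z) = 0 := by
          intro z
          apply Set.indicator_of_notMem
          rintro ⟨h, _⟩
          have := h k
          simp at this
          exact ht this
        simp [this, Set.indicator, ht]
    rw [lintegral_congr s1, lintegral_lintegral_swap]
    · have s2 : ∀ ζ : Fin n → ℝ, ∫⁻ t : ℝ, (Set.Ici (1:ℝ)).indicator (fun t => ENNReal.ofReal (t ^ n) * G (k.insertNth t (t • ζ))) t
          ≤ Cr * ENNReal.ofReal (C₀ ^ n) * m ζ := by
        intro ζ
        rw [mul_assoc]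
        refine le_trans ?_ (hray (P ζ) (κ ζ) (ENNReal.ofReal (C₀ ^ n) * m ζ) (abs_nonneg _) ?_)
        · change _ ≤ ∫⁻ t in S ζ, _
          rw [← lintegral_indicator (hSm ζ)]
          apply lintegral_mono
          intro t
          simp only
          by_cases ht : 1 ≤ t
          swap
          · rw [Set.indicator_of_notMem (by simpa using ht)]; exact zero_le
          rw [Set.indicator_of_mem (by simpa using ht)]
          by_cases hE : k.insertNth t (t • ζ) ∈ E'
          swap
          · simp only [hG]; rw [Set.indicator_of_notMem hE]; simp
          have ht0 : 0 < t := by linarith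
          have hζ : ∀ j, 0 < ζ j := by
            intro j
            have := hE.1 (k.succAbove j)
            simp at this
            by_contra hcon
            push Not at hcon
            nlinarith
          have hw := wt_ins k α t ζ ht0 hζ
          have hZe : Z (k.insertNth t (t • ζ)) = ζ := by
            ext j
            simp only [hZ, Fin.insertNth_apply_same, Fin.insertNth_apply_succAbove, Pi.smul_apply, smul_eq_mul]
            field_simp
          have hwq : wt α (k.insertNth t (t • ζ)) * t ^ q = P ζ * t ^ b * Real.exp (-κ ζ * t ^ 2) := by
            rw [hw, hb, Real.rpow_add ht0]; ring
          have hmem : t ∈ S ζ := by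
            refine ⟨ht, ?_⟩
            have := hE.2
            rw [hZe] at this
            simp only [Fin.insertNth_apply_same] at this
            rwa [hwq] at this
          rw [Set.indicator_of_mem hmem]
          simp only [hG]; rw [Set.indicator_of_mem hE, ← ENNReal.ofReal_mul (by positivity)]
          apply ENNReal.ofReal_le_ofReal
          rw [← hwq, mul_comm, mul_assoc]
          have hwp : 0 ≤ wt α (k.insertNth t (t • ζ)) := by
            rw [hw]; positivity
          gcongr
          calc t ^ n = t ^ (n : ℝ) := by simp
            _ ≤ t ^ (q + 1) := Real.rpow_le_rpow_of_exponent_le ht hnq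
            _ = _ := by rw [Real.rpow_add ht0]; simp
        · simp only [hκ]
          have : 0 ≤ ∑ j, ζ j ^ 2 := by positivity
          linarith
      calc _ ≤ ∫⁻ ζ, Cr * ENNReal.ofReal (C₀ ^ n) * m ζ := lintegral_mono s2
        _ = Cr * ENNReal.ofReal (C₀ ^ n) * ∫⁻ ζ, m ζ := lintegral_const_mul _ hmm
        _ = Cr * ENNReal.ofReal (C₀ ^ n) * ∫⁻ y, (∫⁻ ζ, Φ ζ y) ∂μ := by
            simp only [hm]
            rw [lintegral_lintegral_swap hΦm.aemeasurable]
        _ = Cr * ENNReal.ofReal (C₀ ^ n) * ∫⁻ y, I ^ n * g y ∂μ := by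
            congr 1
            apply lintegral_congr
            intro y
            simp only [hΦ]
            rw [lintegral_mul_const _ (by fun_prop), lint_prod_s13 n (fun j v => phi γ (c / 2) (v - η y j)) (fun j => by fun_prop)]
            simp_rw [lintegral_sub_right_eq_self (phi γ (c / 2))]
            simp [hI]
        _ = _ := by
            rw [lintegral_const_mul _ hg]; ring
    · apply Measurable.aemeasurable
      have : (Function.uncurry fun (t : ℝ) (ζ : Fin n → ℝ) => (Set.Ici (1:ℝ)).indicator (fun t => ENNReal.ofReal (t ^ n) * G (k.insertNth t (t • ζ))) t)
        = (Prod.fst ⁻¹' (Set.Ici (1:ℝ))).indicator (fun p : ℝ × (Fin n → ℝ) => ENNReal.ofReal (p.1 ^ n) * G (k.insertNth p.1 (p.1 • p.2))) := by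
        ext p; rfl
      rw [this]
      apply Measurable.indicator _ (measurable_fst measurableSet_Ici)
      apply Measurable.mul (by fun_prop)
      exact hGm.comp ((ins_meas k).comp (measurable_fst.prodMk (by fun_prop)))

lemma Kexp {m : ℕ} (s : ℝ) (hs : 1 / 4 < s) (hs1 : s < 1) (x y : Fin m → ℝ) :
    Real.exp ((∑ i, x i ^ 2) - (∑ i, ((1 + s) * x i - (1 - s) * y i) ^ 2) / (8 * s)) ≤
    (∏ i, Real.exp (x i ^ 2)) * ∏ i, Real.exp (-((1 + s) * x i - (1 - s) * y i) ^ 2 / 8) := by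
  rw [← Real.exp_sum, ← Real.exp_sum, ← Real.exp_add]
  apply Real.exp_le_exp.2
  have h0 : 0 ≤ ∑ i, ((1 + s) * x i - (1 - s) * y i) ^ 2 := by positivity
  have h1 : ∑ i, (-((1 + s) * x i - (1 - s) * y i) ^ 2 / 8) = -(∑ i, ((1 + s) * x i - (1 - s) * y i) ^ 2) / 8 := by
    rw [← Finset.sum_neg_distrib, Finset.sum_div]
  rw [h1]
  have h2 : (∑ i, ((1 + s) * x i - (1 - s) * y i) ^ 2) / 8 ≤ (∑ i, ((1 + s) * x i - (1 - s) * y i) ^ 2) / (8 * s) := by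
    apply div_le_div_of_nonneg_left h0 (by linarith) (by linarith)
  linarith [neg_div 8 (∑ i, ((1 + s) * x i - (1 - s) * y i) ^ 2)]

lemma KKer_le {m : ℕ} (α : Fin m → ℝ) (s : ℝ) (hs : 1 / 4 < s) (hs1 : s < 1) (x y : Fin m → ℝ)
    (hx : ∀ i, 1 ≤ x i) :
    Kker m α s x y ≤ (1 / 4 : ℝ) ^ (-(m : ℝ) / 2) *
      ∏ i, ((x i + √s) ^ (-(2 * α i + 1)) * Real.exp (-((1 + s) * x i - (1 - s) * y i) ^ 2 / 8) * Real.exp (x i ^ 2)) := by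
  unfold Kker
  have h0 : ∀ i, 0 < x i + √s := fun i => by linarith [hx i, Real.sqrt_nonneg s]
  have h1 : s ^ (-(m : ℝ) / 2) ≤ (1 / 4 : ℝ) ^ (-(m : ℝ) / 2) := by
    apply Real.rpow_le_rpow_of_nonpos (by norm_num) hs.le
    have : (0:ℝ) ≤ m := by positivity
    linarith
  have h2 : 0 ≤ ∏ i, (x i + √s) ^ (-(2 * α i + 1)) :=
    Finset.prod_nonneg fun i _ => Real.rpow_nonneg (h0 i).le _
  have h3 := Kexp s hs hs1 x y
  rw [Finset.prod_mul_distrib, Finset.prod_mul_distrib]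
  calc _ ≤ (1 / 4 : ℝ) ^ (-(m : ℝ) / 2) * (∏ i, (x i + √s) ^ (-(2 * α i + 1))) *
        ((∏ i, Real.exp (x i ^ 2)) * ∏ i, Real.exp (-((1 + s) * x i - (1 - s) * y i) ^ 2 / 8)) := by gcongr
    _ = _ := by ring

lemma KK_le (d e : ℕ) (hed : e ≤ d) (α : Fin d → ℝ)
    (hα : ∀ i : Fin d, (i : ℕ) < e → α i ≤ -1) :
    ∃ C : ℝ, 0 < C ∧ ∀ (x y : Fin d → ℝ) (s : ℝ), (∀ i, 1 ≤ x i) → (∀ i, 0 < y i) →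
      1 / 4 < s → s < 1 →
      KK d e hed α s x y ≤ C / wt α x * ∏ i, Real.exp (-((1 + s) * x i - (1 - s) * y i) ^ 2 / 16) := by
  have hc : ∀ i : Fin e, ∃ C : ℝ, 0 < C ∧ _ := fun i => coordA (α (Fin.castLE hed i)) (hα _ (by simp))
  choose CA hCA hA using hc
  have hc : ∀ i : Fin (d - e), ∃ C : ℝ, 0 < C ∧ _ :=
    fun i => coordB (α ⟨e + (i : ℕ), by have h := i.isLt; omega⟩)
  choose CB hCB hB using hc
  have pA : 0 < ∏ i, CA i := Finset.prod_pos fun i _ => hCA i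
  have pB : 0 < ∏ i, CB i := Finset.prod_pos fun i _ => hCB i
  refine ⟨((1 / 4 : ℝ) ^ (-(e : ℝ) / 2) * ∏ i, CA i) * ((1 / 4 : ℝ) ^ (-((d - e : ℕ) : ℝ) / 2) * ∏ i, CB i), by positivity, ?_⟩
  intro x y s hx hy hs hs1
  set F : Fin d → ℝ := fun i => x i ^ (-(2 * α i + 1)) * Real.exp (-((1 + s) * x i - (1 - s) * y i) ^ 2 / 16) * Real.exp (x i ^ 2) with hF
  have hF0 : ∀ i, 0 ≤ F i := fun i => by
    have := Real.rpow_nonneg (show 0 ≤ x i by linarith [hx i]) (-(2 * α i + 1))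
    simp only [hF]; positivity
  have hprod : ∏ i, F i = 1 / wt α x * ∏ i, Real.exp (-((1 + s) * x i - (1 - s) * y i) ^ 2 / 16) := by
    simp only [hF, Finset.prod_mul_distrib, wt, ← Real.exp_sum, Real.exp_neg]
    have : ∏ i, x i ^ (-(2 * α i + 1)) = (∏ i, x i ^ (2 * α i + 1))⁻¹ := by
      rw [← Finset.prod_inv_distrib]
      exact Finset.prod_congr rfl fun i _ => Real.rpow_neg (by linarith [hx i]) _
    rw [this]; simp; ring
  have hs' : 0 < 1 - s := by linarith
  have hrp : ∀ i : Fin d, 0 ≤ x i := fun i => by linarith [hx i]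
  have A : (1 - s) ^ (-2 * ∑ i : Fin e, α (Fin.castLE hed i)) *
    (∏ i : Fin e, (x (Fin.castLE hed i) * y (Fin.castLE hed i)) ^
      (-2 * α (Fin.castLE hed i))) *
    Kker e (fun i => -α (Fin.castLE hed i)) s
      (fun i => x (Fin.castLE hed i)) (fun i => y (Fin.castLE hed i)) ≤
      ((1 / 4 : ℝ) ^ (-(e : ℝ) / 2) * ∏ i, CA i) * ∏ i : Fin e, F (Fin.castLE hed i) := by
    rw [Finset.mul_sum, Real.rpow_sum_of_pos hs', ← Finset.prod_mul_distrib]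
    have h1 := KKer_le (fun i => -α (Fin.castLE hed i)) s hs hs1
      (fun i => x (Fin.castLE hed i)) (fun i => y (Fin.castLE hed i)) (fun i => hx _)
    have h2 : 0 ≤ ∏ i : Fin e, ((1 - s) ^ (-2 * α (Fin.castLE hed i)) * (x (Fin.castLE hed i) * y (Fin.castLE hed i)) ^
      (-2 * α (Fin.castLE hed i))) := by
      apply Finset.prod_nonneg; intro i _
      have := hrp (Fin.castLE hed i)
      have := (hy (Fin.castLE hed i)).le
      positivity
    refine (mul_le_mul_of_nonneg_left h1 h2).trans ?_
    rw [mul_left_comm, mul_assoc, ← Finset.prod_mul_distrib, ← Finset.prod_mul_distrib]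
    apply mul_le_mul_of_nonneg_left _ (by positivity)
    apply Finset.prod_le_prod
    · intro i _
      have := hrp (Fin.castLE hed i)
      have := (hy (Fin.castLE hed i)).le
      positivity
    · intro i _
      have h := hA i (x (Fin.castLE hed i)) (y (Fin.castLE hed i)) s (hx _) (hy _) hs hs1
      have h' := mul_le_mul_of_nonneg_right h (Real.exp_pos (x (Fin.castLE hed i) ^ 2)).le
      simp only [hF]
      linarith
  have B : Kker (d - e) (fun i => α ⟨e + (i : ℕ), by have h := i.isLt; omega⟩) s
      (fun i => x ⟨e + (i : ℕ), by have h := i.isLt; omega⟩)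
      (fun i => y ⟨e + (i : ℕ), by have h := i.isLt; omega⟩) ≤
      ((1 / 4 : ℝ) ^ (-((d - e : ℕ) : ℝ) / 2) * ∏ i, CB i) * ∏ i : Fin (d - e), F ⟨e + (i : ℕ), by have h := i.isLt; omega⟩ := by
    refine (KKer_le _ s hs hs1 _ _ (fun i => hx _)).trans ?_
    rw [mul_assoc, ← Finset.prod_mul_distrib]
    apply mul_le_mul_of_nonneg_left _ (by positivity)
    apply Finset.prod_le_prod
    · intro i _
      have := hrp ⟨e + (i : ℕ), by have h := i.isLt; omega⟩
      positivity
    · intro i _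
      have h := hB i (x ⟨e + (i : ℕ), by have h := i.isLt; omega⟩) (y ⟨e + (i : ℕ), by have h := i.isLt; omega⟩) s (hx _) (hy _) hs hs1
      have h' := mul_le_mul_of_nonneg_right h (Real.exp_pos (x ⟨e + (i : ℕ), by have h := i.isLt; omega⟩ ^ 2)).le
      simp only [hF]
      linarith
  have B0 : 0 ≤ Kker (d - e) (fun i => α ⟨e + (i : ℕ), by have h := i.isLt; omega⟩) s
      (fun i => x ⟨e + (i : ℕ), by have h := i.isLt; omega⟩)
      (fun i => y ⟨e + (i : ℕ), by have h := i.isLt; omega⟩) := by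
    unfold Kker
    have : 0 ≤ s := by linarith
    apply mul_nonneg (mul_nonneg (by positivity) _) (Real.exp_pos _).le
    apply Finset.prod_nonneg; intro i _
    have := hrp ⟨e + (i : ℕ), by have h := i.isLt; omega⟩
    positivity
  have A0 : 0 ≤ ((1 / 4 : ℝ) ^ (-(e : ℝ) / 2) * ∏ i, CA i) * ∏ i : Fin e, F (Fin.castLE hed i) :=
    mul_nonneg (by positivity) (Finset.prod_nonneg fun i _ => hF0 _)
  unfold KK
  refine (mul_le_mul A B B0 A0).trans (le_of_eq ?_)
  rw [mul_mul_mul_comm, prod_split hed F, hprod]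
  ring

lemma KK_le2 (n e : ℕ) (hed : e ≤ n + 1) (α : Fin (n + 1) → ℝ)
    (hα : ∀ i : Fin (n + 1), (i : ℕ) < e → α i ≤ -1) :
    ∃ C : ℝ, 0 < C ∧ ∃ c : ℝ, 0 < c ∧ ∀ (x y : Fin (n + 1) → ℝ) (k : Fin (n + 1)) (s : ℝ), (∀ i, 1 ≤ x i) → (∀ i, 0 < y i) →
      (∀ i, y i ≤ y k) → 1 / 4 < s → s < 1 →
      KK (n + 1) e hed α s x y ≤ C / wt α x * ∏ j, Real.exp (-c * (x (k.succAbove j) - y (k.succAbove j) / y k * x k) ^ 2) := by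
  obtain ⟨C, hC, h⟩ := KK_le (n + 1) e hed α hα
  refine ⟨C, hC, 1 / (32 * (n + 1)), by positivity, ?_⟩
  intro x y k s hx hy hk hs hs1
  refine (h x y s hx hy hs hs1).trans ?_
  have hw := wt_pos α x (fun i => by linarith [hx i])
  gcongr ?_ * ?_
  rw [← Real.exp_sum, ← Real.exp_sum]
  apply Real.exp_le_exp.2
  set u : Fin (n + 1) → ℝ := fun i => (1 + s) * x i - (1 - s) * y i with hu
  have h1 : ∀ j : Fin n, (x (k.succAbove j) - y (k.succAbove j) / y k * x k) ^ 2 ≤ 2 * (u (k.succAbove j) ^ 2 + u k ^ 2) := by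
    intro j
    set r := y (k.succAbove j) / y k with hr
    have hr0 : 0 ≤ r := div_nonneg (hy _).le (hy _).le
    have hr1 : r ≤ 1 := (div_le_one (hy k)).2 (hk _)
    have hry : r * y k = y (k.succAbove j) := by rw [hr]; field_simp [(hy k).ne']
    have e1 : (1 + s) * (x (k.succAbove j) - r * x k) = u (k.succAbove j) - r * u k := by
      simp only [hu]; rw [← hry]; ring
    have e2 : (x (k.succAbove j) - r * x k) ^ 2 ≤ ((1 + s) * (x (k.succAbove j) - r * x k)) ^ 2 := by
      rw [mul_pow]
      have : 1 ≤ (1 + s) ^ 2 := by nlinarith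
      exact le_mul_of_one_le_left (sq_nonneg _) this
    rw [e1] at e2
    have e3 : r ^ 2 * u k ^ 2 ≤ u k ^ 2 := by
      have : r ^ 2 ≤ 1 := by nlinarith
      nlinarith [sq_nonneg (u k)]
    nlinarith [sq_nonneg (u (k.succAbove j) + r * u k)]
  have h2 : ∑ j : Fin n, (x (k.succAbove j) - y (k.succAbove j) / y k * x k) ^ 2 ≤ 2 * (n + 1) * ∑ i, u i ^ 2 := by
    calc _ ≤ ∑ j : Fin n, 2 * (u (k.succAbove j) ^ 2 + u k ^ 2) := Finset.sum_le_sum fun j _ => h1 j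
      _ = 2 * (∑ j : Fin n, u (k.succAbove j) ^ 2) + 2 * n * u k ^ 2 := by
        rw [← Finset.mul_sum, Finset.sum_add_distrib]; simp; ring
      _ ≤ _ := by
        rw [Fin.sum_univ_succAbove _ k]
        have : 0 ≤ ∑ j : Fin n, u (k.succAbove j) ^ 2 := by positivity
        have : 0 ≤ (n:ℝ) * ∑ j : Fin n, u (k.succAbove j) ^ 2 := by positivity
        nlinarith [sq_nonneg (u k)]
  rw [← Finset.mul_sum]
  have h3 : ∑ i, -u i ^ 2 / 16 = -(∑ i, u i ^ 2) / 16 := by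
    rw [← Finset.sum_neg_distrib, Finset.sum_div]
  change ∑ i, -u i ^ 2 / 16 ≤ _
  rw [h3]
  have h4 : 1 / (32 * ((n:ℝ) + 1)) * ∑ j : Fin n, (x (k.succAbove j) - y (k.succAbove j) / y k * x k) ^ 2 ≤ (∑ i, u i ^ 2) / 16 := by
    rw [div_mul_eq_mul_div, div_le_iff₀ (by positivity)]
    nlinarith
  linarith [neg_div 16 (∑ i, u i ^ 2)]

/-- For `d ≥ 1`, `1 ≤ e ≤ d` and `α ∈ (−∞,−1]^e × (−1,∞)^{d−e}`, the
operator `𝕂_{*,2}^α f(x) = χ_{[1,∞)^d}(x) ∫ [sup_{1/4<s<1} 𝕂_s^α(x,y)] f(y) dν_α(y)`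
is of weak type `(1,1)` with respect to `ν_α`. -/
theorem stmt13 (d e : ℕ) (hd : 1 ≤ d) (he : 1 ≤ e) (hed : e ≤ d) (α : Fin d → ℝ)
    (hα : ∀ i : Fin d, ((i : ℕ) < e → α i ≤ -1) ∧ (e ≤ (i : ℕ) → -1 < α i)) :
    ∃ C : ℝ, 0 < C ∧ ∀ f : (Fin d → ℝ) → ℝ, (∀ x, 0 ≤ f x) →
      Integrable f (nu d α) → ∀ lam : ℝ, 0 < lam →
      nu d α {x | ENNReal.ofReal lam <
          Set.indicator {x : Fin d → ℝ | ∀ i, 1 ≤ x i}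
            (fun x => ∫⁻ y,
              (⨆ s ∈ Set.Ioo (1 / 4 : ℝ) 1, ENNReal.ofReal (KK d e hed α s x y)) *
                ENNReal.ofReal (f y) ∂(nu d α)) x} ≤
        ENNReal.ofReal (C / lam * ∫ x, f x ∂(nu d α)) := by
  obtain ⟨n, rfl⟩ : ∃ n, d = n + 1 := ⟨d - 1, by omega⟩
  obtain ⟨C, hC, c, hc, hK⟩ := KK_le2 n e hed α (fun i => (hα i).1)
  have hcore := fun k => core n k α c hc
  choose D hD hcore using hcore
  set Cf : ℝ := (∑ k, D k).toReal * (C * (n + 1)) + 1 with hCf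
  have hDtop : ∑ k, D k ≠ ⊤ := ENNReal.sum_ne_top.2 fun k _ => hD k
  refine ⟨Cf, by positivity, ?_⟩
  intro f hf hfi lam hlam
  set ν := nu (n + 1) α with hν
  haveI : SFinite ν := by rw [hν]; unfold nu; infer_instance
  have hfm : AEMeasurable (fun y => ENNReal.ofReal (f y)) ν := hfi.aemeasurable.ennreal_ofReal
  set g := hfm.mk _ with hg
  have hgm : Measurable g := hfm.measurable_mk
  have hgae : (fun y => ENNReal.ofReal (f y)) =ᵐ[ν] g := hfm.ae_eq_mk
  have hgint : ∫⁻ y, g y ∂ν = ENNReal.ofReal (∫ y, f y ∂ν) := by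
    rw [← lintegral_congr_ae hgae, ofReal_integral_eq_lintegral_ofReal hfi (Filter.Eventually.of_forall hf)]
  set L : ℝ := C * (n + 1) / lam with hL
  have hL0 : 0 < L := by positivity
  set Y : Fin (n + 1) → Set (Fin (n + 1) → ℝ) := fun k => {y | ∀ i, y i ≤ y k} with hY
  have hYm : ∀ k, MeasurableSet (Y k) := by
    intro k
    have : Y k = ⋂ i, {y | y i ≤ y k} := by ext; simp [hY]
    rw [this]
    exact MeasurableSet.iInter fun i => measurableSet_le (measurable_pi_apply i) (measurable_pi_apply k)
  set η : Fin (n + 1) → (Fin (n + 1) → ℝ) → Fin n → ℝ := fun k y j => y (k.succAbove j) / y k with hη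
  have hηm : ∀ k, Measurable (η k) := by
    intro k; apply measurable_pi_lambda; intro j; fun_prop
  set gk : Fin (n + 1) → (Fin (n + 1) → ℝ) → ENNReal := fun k y => ENNReal.ofReal L * (Y k).indicator g y with hgk
  have hgkm : ∀ k, Measurable (gk k) := fun k => (hgm.indicator (hYm k)).const_mul _
  have hE := fun k => hcore k ν (gk k) (η k) (hgkm k) (hηm k)
  choose E' hE'm hsub hEb using hE
  have hpos : ∀ᵐ y ∂ν, ∀ i, 0 < y i := by
    have hms : MeasurableSet {x : Fin (n + 1) → ℝ | ∀ i, 0 < x i} := by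
      have : {x : Fin (n + 1) → ℝ | ∀ i, 0 < x i} = ⋂ i, {x | 0 < x i} := by ext; simp
      rw [this]
      exact MeasurableSet.iInter fun i => measurableSet_lt measurable_const (measurable_pi_apply i)
    rw [hν]; unfold nu
    exact ae_restrict_mem hms
  set Pk : Fin (n + 1) → (Fin (n + 1) → ℝ) → (Fin (n + 1) → ℝ) → ENNReal := fun k x y =>
    ∏ j, ENNReal.ofReal (Real.exp (-c * (x (k.succAbove j) - η k y j * x k) ^ 2)) with hPk
  have hPm : ∀ k x, Measurable (Pk k x) := by
    intro k x
    apply Finset.measurable_fun_prod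
    intro j _
    have : Measurable fun y => η k y j := (measurable_pi_apply j).comp (hηm k)
    fun_prop
  have hPg : ∀ k x, Measurable (fun y => Pk k x y * (Y k).indicator g y) := fun k x =>
    (hPm k x).mul (hgm.indicator (hYm k))
  have hcover : {x | ENNReal.ofReal lam <
          Set.indicator {x : Fin (n + 1) → ℝ | ∀ i, 1 ≤ x i}
            (fun x => ∫⁻ y,
              (⨆ s ∈ Set.Ioo (1 / 4 : ℝ) 1, ENNReal.ofReal (KK (n + 1) e hed α s x y)) *
                ENNReal.ofReal (f y) ∂ν) x} ⊆ ⋃ k, E' k := by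
    intro x hx
    simp only [Set.mem_setOf_eq] at hx
    by_cases hx1 : x ∈ {x : Fin (n + 1) → ℝ | ∀ i, 1 ≤ x i}
    swap
    · rw [Set.indicator_of_notMem hx1] at hx
      simp at hx
    rw [Set.indicator_of_mem hx1] at hx
    have hw : 0 < wt α x := wt_pos α x (fun i => by linarith [hx1 i])
    have key : ∫⁻ y, (⨆ s ∈ Set.Ioo (1 / 4 : ℝ) 1, ENNReal.ofReal (KK (n + 1) e hed α s x y)) *
                ENNReal.ofReal (f y) ∂ν ≤
        ∑ k, ENNReal.ofReal (C / wt α x) * ∫⁻ y, Pk k x y * (Y k).indicator g y ∂ν := by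
      have e1 : ∀ k, ENNReal.ofReal (C / wt α x) * ∫⁻ y, Pk k x y * (Y k).indicator g y ∂ν =
          ∫⁻ y, ENNReal.ofReal (C / wt α x) * (Pk k x y * (Y k).indicator g y) ∂ν := fun k =>
        (lintegral_const_mul _ (hPg k x)).symm
      simp_rw [e1]
      rw [← lintegral_finsetSum (f := fun k y => ENNReal.ofReal (C / wt α x) * (Pk k x y * (Y k).indicator g y)) _ (fun k _ => (hPg k x).const_mul _)]
      apply lintegral_mono_ae
      filter_upwards [hgae, hpos] with y hy1 hy2
      obtain ⟨k, -, hk⟩ := Finset.exists_max_image Finset.univ y Finset.univ_nonempty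
      have hyk : y ∈ Y k := fun i => hk i (Finset.mem_univ i)
      refine le_trans ?_ (Finset.single_le_sum (f := fun k => ENNReal.ofReal (C / wt α x) * (Pk k x y * (Y k).indicator g y)) (fun _ _ => zero_le) (Finset.mem_univ k))
      rw [Set.indicator_of_mem hyk, hy1, ← mul_assoc]
      gcongr
      apply iSup₂_le
      intro s hs
      have h := hK x y k s hx1 hy2 hyk hs.1 hs.2
      refine (ENNReal.ofReal_le_ofReal h).trans ?_
      rw [ENNReal.ofReal_mul (by positivity), ENNReal.ofReal_prod_of_nonneg (fun _ _ => (Real.exp_pos _).le)]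
    have hlt := hx.trans_le key
    obtain ⟨k, hk⟩ : ∃ k, ENNReal.ofReal (lam / (n + 1)) ≤ ENNReal.ofReal (C / wt α x) * ∫⁻ y, Pk k x y * (Y k).indicator g y ∂ν := by
      by_contra hcon
      push Not at hcon
      have : ∑ k, ENNReal.ofReal (C / wt α x) * ∫⁻ y, Pk k x y * (Y k).indicator g y ∂ν ≤ ∑ k : Fin (n + 1), ENNReal.ofReal (lam / (n + 1)) :=
        Finset.sum_le_sum fun k _ => (hcon k).le
      rw [← ENNReal.ofReal_sum_of_nonneg (fun _ _ => by positivity)] at this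
      have e : ∑ k : Fin (n + 1), lam / ((n:ℝ) + 1) = lam := by
        simp; field_simp
      rw [e] at this
      exact absurd hlt (not_lt.2 this)
    refine Set.mem_iUnion.2 ⟨k, hsub k ⟨hx1, ?_⟩⟩
    have e2 : ∫⁻ y, Pk k x y * gk k y ∂ν = ENNReal.ofReal L * ∫⁻ y, Pk k x y * (Y k).indicator g y ∂ν := by
      rw [← lintegral_const_mul _ (hPg k x)]
      apply lintegral_congr; intro y
      simp only [hgk]; ring
    change _ ≤ ∫⁻ y, Pk k x y * gk k y ∂ν
    rw [e2]
    have e3 : wt α x = (wt α x * (n + 1) / lam) * (lam / (n + 1)) := by field_simp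
    have e4 : L = (wt α x * (n + 1) / lam) * (C / wt α x) := by rw [hL]; field_simp
    rw [e4, ENNReal.ofReal_mul (by positivity), mul_assoc]
    conv_lhs => rw [e3, ENNReal.ofReal_mul (by positivity)]
    gcongr
  have hνE : ∀ k, ν (E' k) ≤ D k * (ENNReal.ofReal L * ∫⁻ y, g y ∂ν) := by
    intro k
    have h1 : ν (E' k) ≤ ∫⁻ x in E' k, ENNReal.ofReal (wt α x) := by
      rw [hν]; unfold nu
      refine (Measure.restrict_apply_le _ _).trans ?_
      rw [withDensity_apply _ (hE'm k)]
      rfl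
    refine h1.trans ((hEb k).trans ?_)
    gcongr
    simp only [hgk]
    rw [lintegral_const_mul _ (hgm.indicator (hYm k))]
    gcongr
    apply Set.indicator_le_self
  calc _ ≤ ν (⋃ k, E' k) := measure_mono hcover
    _ ≤ ∑ k, ν (E' k) := measure_iUnion_fintype_le _ _
    _ ≤ ∑ k, D k * (ENNReal.ofReal L * ∫⁻ y, g y ∂ν) := Finset.sum_le_sum fun k _ => hνE k
    _ = (∑ k, D k) * (ENNReal.ofReal L * ENNReal.ofReal (∫ y, f y ∂ν)) := by
      rw [← Finset.sum_mul, hgint]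
    _ = ENNReal.ofReal ((∑ k, D k).toReal * (L * ∫ y, f y ∂ν)) := by
      rw [ENNReal.ofReal_mul (by positivity), ENNReal.ofReal_mul hL0.le, ENNReal.ofReal_toReal hDtop]
    _ ≤ _ := by
      apply ENNReal.ofReal_le_ofReal
      have : 0 ≤ ∫ y, f y ∂ν := integral_nonneg hf
      rw [← mul_assoc]
      gcongr
      rw [hL, hCf, ← mul_div_assoc]
      gcongr
      linarith
end
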